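/- Let K be an algebraically closed field of characteristic zero, Z and X algebraic varieties over K, and φ₁, φ₂ : Z → X dominant rational maps. Then the following are equivalent: (1) there exist infinitely many hypersurfaces H on X satisfying φ₁*H = φ₂*H; (2) there exists g ∈ K(X) \ K such that g∘φ₁ = g∘φ₂. -/

import Mathlib

/-!
# Theorem 6.1 (main theorem in the reduced case)

Algebraic varieties `X` and `Z` over an algebraically closed field `K` of characteristic
zero are modelled by (affine models with) coordinate rings `R` and `S`: finitely generated
`K`-algebras which are integral domains.  A dominant rational map `φᵢ : Z → X` is modelled
(after shrinking `Z`, which affects neither condition) by an injective `K`-algebra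
homomorphism `fᵢ : R → S`.  A hypersurface `H` on `X` is modelled by its radical vanishing
ideal: a proper radical ideal all of whose minimal primes have height one; the proper
transform `φᵢ*H` is the intersection of those minimal primes of the extension ideal
`fᵢ(I)·S` that contract to minimal primes of `I`.

A nonconstant rational function `g ∈ K(X) \ K` with `g∘φ₁ = g∘φ₂` is expressed
denominator-freely: `g = a/b`, `b ≠ 0`, `a ≠ c·b` for every constant `c ∈ K`, and
`f₁(a)/f₁(b) = f₂(a)/f₂(b)` in `K(Z)`, i.e. `f₁(a)·f₂(b) = f₂(a)·f₁(b)`.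
-/

/-- A prime ideal `P` of a commutative ring has height one. -/
def HeightOnePrime {R : Type*} [CommRing R] (P : Ideal R) : Prop :=
  P.IsPrime ∧ P ≠ ⊥ ∧ ∀ Q : Ideal R, Q.IsPrime → Q < P → Q = ⊥

/-- `I` is the radical vanishing ideal of a nonempty Zariski closed subset of pure
codimension one. -/
def IsHypersurfaceIdeal {R : Type*} [CommRing R] (I : Ideal R) : Prop :=
  I.IsRadical ∧ I ≠ ⊤ ∧ ∀ P ∈ I.minimalPrimes, HeightOnePrime P

/-- The vanishing ideal of the proper transform of `V(I)` along the dominant map induced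
by `f`. -/
def properTransform {R S : Type*} [CommRing R] [CommRing S] (f : R →+* S) (I : Ideal R) :
    Ideal S :=
  sInf {Q : Ideal S | Q ∈ (I.map f).minimalPrimes ∧ Q.comap f ∈ I.minimalPrimes}

section Derivations

/-- An algebraic extension of a domain in characteristic zero is formally étale. -/
theorem formallyEtale_of_isAlgebraic (A L : Type*) [CommRing A] [IsDomain A] [Field L]
    [CharZero L] [Algebra A L] [FaithfulSMul A L] [Algebra.IsAlgebraic A L] :
    Algebra.FormallyEtale A L := by
  let N := FractionRing A
  let _ : Algebra N L := FractionRing.liftAlgebra _ _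
  have _ : IsScalarTower A N L := FractionRing.isScalarTower_liftAlgebra _ _
  have _ : Algebra.IsAlgebraic N L :=
      (IsFractionRing.comap_isAlgebraic_iff (A := A) (K := N)).1 inferInstance
  have _ : CharZero N := (algebraMap N L).charZero_iff (algebraMap N L).injective |>.2 inferInstance
  have _ : Algebra.FormallyEtale A N := Algebra.FormallyEtale.of_isLocalization (nonZeroDivisors A)
  have _ : Algebra.FormallyEtale N L := Algebra.FormallyEtale.of_isSeparable N L
  exact Algebra.FormallyEtale.comp A N L

/-- A derivation extends to an algebraic extension in characteristic zero. -/
theorem Derivation.exists_extension {K A L : Type*} [Field K] [CommRing A] [IsDomain A] [Field L]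
    [CharZero L] [Algebra K A] [Algebra K L] [Algebra A L] [IsScalarTower K A L]
    [FaithfulSMul A L] [Algebra.IsAlgebraic A L] (d : Derivation K A L) :
    ∃ D : Derivation K L L, ∀ a, D (algebraMap A L a) = d a := by
  have _ : Algebra.FormallyEtale A L := formallyEtale_of_isAlgebraic A L
  let e := KaehlerDifferential.tensorKaehlerEquivOfFormallyEtale K A L
  let f : Ω[L⁄K] →ₗ[L] L := (d.liftKaehlerDifferential.liftBaseChange L) ∘ₗ e.symm.toLinearMap
  refine ⟨f.compDer (KaehlerDifferential.D K L), fun a => ?_⟩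
  have := KaehlerDifferential.tensorKaehlerEquivOfFormallyEtale_symm_D_algebraMap K A L a
  simp [f, e, this]

/-- Two derivations agreeing on a subring over which the field is algebraic are equal. -/
theorem Derivation.eq_of_forall_algebraMap {K A L M : Type*} [Field K] [CommRing A] [IsDomain A]
    [Field L] [CharZero L] [Algebra K A] [Algebra K L] [Algebra A L] [IsScalarTower K A L]
    [FaithfulSMul A L] [Algebra.IsAlgebraic A L] [AddCommGroup M] [Module L M] [Module K M]
    [Module A M] [IsScalarTower A L M] [IsScalarTower K L M]
    (D₁ D₂ : Derivation K L M) (h : ∀ a, D₁ (algebraMap A L a) = D₂ (algebraMap A L a)) :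
    D₁ = D₂ := by
  have _ : Algebra.FormallyEtale A L := formallyEtale_of_isAlgebraic A L
  have _ : Algebra.FormallyUnramified A L := inferInstance
  let D : Derivation A L M := Derivation.mk'
    { toFun := fun x => (D₁ - D₂) x
      map_add' := fun x y => map_add _ x y
      map_smul' := fun a x => by
        rw [Algebra.smul_def, Derivation.leibniz]
        simp [h a, algebraMap_smul] } (fun a b => Derivation.leibniz (D₁ - D₂) a b)
  have h0 : D = 0 := by
    have := D.liftKaehlerDifferential_comp
    rw [← this, Subsingleton.elim D.liftKaehlerDifferential 0]
    rfl
  ext x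
  have := congrArg (fun D => D x) h0
  simpa [D, sub_eq_zero] using this

/-- A family of prescribed values on an algebraically independent family extends to a
derivation, in characteristic zero. -/
theorem AlgebraicIndependent.exists_derivation {K L ι : Type*} [Field K] [Field L] [CharZero K]
    [Algebra K L] {x : ι → L} (hx : AlgebraicIndependent K x) (w : ι → L) :
    ∃ D : Derivation K L L, ∀ i, D (x i) = w i := by
  classical
  have _ : CharZero L := charZero_of_injective_algebraMap (algebraMap K L).injective
  obtain ⟨s, hs, hst⟩ := exists_isTranscendenceBasis_superset (s := Set.range x) hx.coe_range
  have hinj := hx.injective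
  let z : s → L := Subtype.val
  have hz : AlgebraicIndependent K z := hst.1
  let _ : Algebra (MvPolynomial s K) L := (MvPolynomial.aeval (R := K) z).toAlgebra
  have _ : IsScalarTower K (MvPolynomial s K) L := IsScalarTower.of_algHom (MvPolynomial.aeval z)
  have hinj' : Function.Injective (algebraMap (MvPolynomial s K) L) := hz
  have _ : FaithfulSMul (MvPolynomial s K) L := (faithfulSMul_iff_algebraMap_injective _ _).2 hinj'
  have _ : Algebra.IsAlgebraic (MvPolynomial s K) L := by
    have _ := hst.isAlgebraic
    refine Algebra.IsAlgebraic.ringHom_of_comp_eq (R := Algebra.adjoin K (Set.range z)) (A := L)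
      (hz.aevalEquiv.symm : _ →+* _) (RingHom.id L) hz.aevalEquiv.symm.injective
      Function.surjective_id ?_
    ext a
    obtain ⟨b, rfl⟩ := hz.aevalEquiv.surjective a
    simp [RingHom.algebraMap_toAlgebra]
  let v : s → L := fun a => if h : ∃ i, x i = a then w h.choose else 0
  obtain ⟨D, hD⟩ := (MvPolynomial.mkDerivation K v).exists_extension (L := L)
  refine ⟨D, fun i => ?_⟩
  have h1 := hD (MvPolynomial.X ⟨x i, hs ⟨i, rfl⟩⟩)
  have h2 : ∃ j, x j = x i := ⟨i, rfl⟩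
  have h3 : h2.choose = i := hinj h2.choose_spec
  simp only [RingHom.algebraMap_toAlgebra, MvPolynomial.mkDerivation_X, v] at h1
  simp only [z] at h1
  simpa [h2, h3] using! h1

end Derivations

section

open Polynomial

section Centered

/-- The valuation subring `W` is centered at the ideal `Q` of `T` along `φ : T → L`. -/
def ValuationSubring.IsCenteredAt {T L : Type*} [CommRing T] [Field L] (W : ValuationSubring L)
    (φ : T →+* L) (Q : Ideal T) : Prop :=
  ∀ a, W.valuation (φ a) ≤ 1 ∧ (W.valuation (φ a) < 1 ↔ a ∈ Q)

theorem ValuationSubring.IsCenteredAt.eq_one {T L : Type*} [CommRing T] [Field L]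
    {W : ValuationSubring L} {φ : T →+* L} {Q : Ideal T} (hW : W.IsCenteredAt φ Q) {a : T}
    (ha : a ∉ Q) : W.valuation (φ a) = 1 :=
  le_antisymm (hW a).1 (not_lt.1 fun h => ha ((hW a).2.1 h))

theorem ValuationSubring.exists_isCenteredAt {S L : Type*} [CommRing S] [Field L] (φ : S →+* L)
    (hφ : Function.Injective φ) (Q : Ideal S) [Q.IsPrime] :
    ∃ W : ValuationSubring L, W.IsCenteredAt φ Q := by
  have hu : ∀ y : Q.primeCompl, IsUnit (φ y) := fun y => by
    refine isUnit_iff_ne_zero.2 fun h => y.2 ?_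
    rw [(map_eq_zero_iff φ hφ).1 h]
    exact Q.zero_mem
  let f : Localization.AtPrime Q →+* L := IsLocalization.lift hu
  obtain ⟨A, h, hl⟩ := IsLocalRing.exists_factor_valuationRing f
  refine ⟨A, fun a => ?_⟩
  have hf : f (algebraMap S _ a) = φ a := IsLocalization.lift_eq hu a
  have hmem : φ a ∈ A := hf ▸ h _
  refine ⟨(A.valuation_le_one_iff _).2 hmem, ?_⟩
  have h1 := A.valuation_lt_one_iff ⟨φ a, hmem⟩
  rw [← h1, IsLocalRing.mem_maximalIdeal, _root_.mem_nonunits_iff]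
  have h2 : IsUnit (⟨φ a, hmem⟩ : A) ↔ IsUnit (algebraMap S (Localization.AtPrime Q) a) := by
    have h3 : (⟨φ a, hmem⟩ : A) = f.codRestrict A.toSubring h (algebraMap S _ a) :=
      Subtype.ext hf.symm
    constructor
    · intro hua
      refine hl.map_nonunit _ ?_
      have : IsUnit (f.codRestrict A.toSubring h (algebraMap S _ a)) := h3 ▸ hua
      exact this
    · intro hua
      rw [h3]
      exact hua.map (f.codRestrict A.toSubring h)
  rw [h2, IsLocalization.AtPrime.isUnit_to_map_iff (Localization.AtPrime Q) Q]
  simp [Ideal.primeCompl]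

variable {T L : Type*} [CommRing T] [Field L] [Algebra T L]

theorem ValuationSubring.mem_of_isIntegral {W : ValuationSubring L}
    (hW : ∀ a, algebraMap T L a ∈ W) {x : L} (hx : IsIntegral T x) : x ∈ W := by
  let f : T →+* W := (algebraMap T L).codRestrict W.toSubring hW
  have h : IsIntegral W x :=
    IsIntegral.map_of_comp_eq f (RingHom.id L) (by ext; rfl) hx
  obtain ⟨y, rfl⟩ := IsIntegrallyClosed.isIntegral_iff.1 h
  exact y.2

theorem isIntegral_of_forall_valuationSubring {x : L}
    (h : ∀ V : ValuationSubring L, (∀ a, algebraMap T L a ∈ V) → x ∈ V) : IsIntegral T x := by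
  have h1 : x ∈ (⨅ V : {V : ValuationSubring L //
      ((algebraMap T L).range : Set L) ⊆ V.toSubring}, V.1.toSubring) := by
    rw [Subring.mem_iInf]
    rintro ⟨V, hV⟩
    exact h V fun a => hV ⟨a, rfl⟩
  rw [iInf_valuationSubring_superset, Subalgebra.mem_toSubring, mem_integralClosure_iff,
    Subring.closure_eq] at h1
  obtain ⟨p, hp, hp0⟩ := h1
  obtain ⟨q, hq, -, hqm⟩ := Polynomial.lifts_and_natDegree_eq_and_monic
    (f := (algebraMap T L).rangeRestrict) (p := p)
    ((Polynomial.mem_lifts p).2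
      (Polynomial.map_surjective _ (algebraMap T L).rangeRestrict_surjective p)) hp
  refine ⟨q, hqm, ?_⟩
  rw [← hq, Polynomial.eval₂_map] at hp0
  exact hp0

/-- An element of a valuation ring that is a root of a polynomial some coefficient of which is
a unit is a quotient of integral elements, with denominator a unit. -/
theorem ValuationSubring.exists_integral_quotient {W : ValuationSubring L}
    (hW : ∀ a, algebraMap T L a ∈ W) {e : L} (he : e ∈ W) {p : T[X]} (hp : aeval e p = 0)
    {k : ℕ} (hk : W.valuation (algebraMap T L (p.coeff k)) = 1) :
    ∃ a ∈ Algebra.adjoin T {e}, ∃ b ∈ Algebra.adjoin T {e}, IsIntegral T a ∧ IsIntegral T b ∧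
      W.valuation b = 1 ∧ e * b = a := by
  let q : ℕ → T[X] := fun k => divX^[k] p
  let b : ℕ → L := fun k => aeval e (q k)
  have hq : ∀ k, ∀ i, (q k).coeff i = p.coeff (i + k) := by
    intro k
    induction k with
    | zero => intro i; rfl
    | succ k ih =>
      intro i
      simp only [q, Function.iterate_succ_apply'] at ih ⊢
      rw [coeff_divX, ih]
      congr 1; ring
  have hb : ∀ k, e * b (k + 1) = b k - algebraMap T L (p.coeff k) := by
    intro k
    have h1 : q k = X * q (k + 1) + C (p.coeff k) := by
      have := divX_mul_X_add (q k)
      rw [hq k 0, zero_add] at this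
      rw [← this]
      simp only [q, Function.iterate_succ_apply']
      rw [mul_comm]
    have h2 : b k = e * b (k + 1) + algebraMap T L (p.coeff k) := by
      simp only [b]
      conv_lhs => rw [h1]
      simp
    rw [h2]; ring
  have hIntg : ∀ k, IsIntegral T (b k) := by
    intro k
    refine isIntegral_of_forall_valuationSubring fun V hV => ?_
    by_cases heV : e ∈ V
    · have : b k = ∑ i ∈ Finset.range ((q k).natDegree + 1), algebraMap T L
        ((q k).coeff i) * e ^ i := by
        simp only [b]
        rw [aeval_eq_sum_range]
        simp [Algebra.smul_def]
      rw [this]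
      exact sum_mem fun i _ => V.mul_mem _ _ (hV _) (pow_mem heV i)
    · have heV' : e⁻¹ ∈ V := (V.mem_or_inv_mem e).resolve_left heV
      have he0 : e ≠ 0 := fun h => heV (h ▸ V.zero_mem)
      induction k with
      | zero => simp only [b, q, Function.iterate_zero, id, hp]; exact V.zero_mem
      | succ k ih =>
        have : b (k + 1) = e⁻¹ * (b k - algebraMap T L (p.coeff k)) := by
          rw [← hb]; field_simp
        rw [this]
        exact V.mul_mem _ _ heV' (sub_mem ih (hV _))
  have hbW : ∀ k, W.valuation (b k) ≤ 1 := fun k =>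
    (W.valuation_le_one_iff _).2 (mem_of_isIntegral hW (hIntg k))
  have hbA : ∀ k, b k ∈ Algebra.adjoin T {e} := fun k => aeval_mem_adjoin_singleton T e
  by_cases hall : ∃ k, W.valuation (b (k + 1)) = 1
  · obtain ⟨k, hk⟩ := hall
    refine ⟨b k - algebraMap T L (p.coeff k), sub_mem (hbA k) (algebraMap_mem _ _), b (k + 1),
      hbA _, (hIntg k).sub (isIntegral_algebraMap), hIntg _, hk, hb k⟩
  · push Not at hall
    have hlt : ∀ k, W.valuation (b k) < 1 := by
      intro k
      cases k with
      | zero => simp [b, q, hp]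
      | succ k => exact lt_of_le_of_ne (hbW _) (hall k)
    exfalso
    have h3 : algebraMap T L (p.coeff k) = b k - e * b (k + 1) := by rw [hb]; ring
    have h4 : W.valuation (e * b (k + 1)) < 1 := by
      rw [map_mul]
      exact (mul_le_of_le_one_left' ((W.valuation_le_one_iff _).2 he)).trans_lt (hlt _)
    have h5 := W.valuation.map_sub (b k) (e * b (k + 1))
    rw [← h3, hk] at h5
    exact absurd (h5.trans_lt (max_lt (hlt k) h4)) (lt_irrefl _)

end Centered

section LogDerivative

theorem Valuation.exists_ne_of_sum_eq_zero {L Γ ι : Type*} [Field L]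
    [LinearOrderedCommGroupWithZero Γ] (v : Valuation L Γ) (s : Finset ι) (f : ι → L)
    (h0 : ∑ i ∈ s, f i = 0) (h1 : ∃ i ∈ s, f i ≠ 0) :
    ∃ i ∈ s, ∃ j ∈ s, i ≠ j ∧ v (f i) = v (f j) ∧ f i ≠ 0 := by
  classical
  obtain ⟨i₀, hi₀, hne⟩ := h1
  obtain ⟨i, hi, hmax⟩ := s.exists_max_image (fun i => v (f i)) ⟨i₀, hi₀⟩
  have hvi : v (f i) ≠ 0 := fun h => by
    have := hmax i₀ hi₀
    simp only [h, le_zero_iff, Valuation.zero_iff] at this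
    exact hne this
  by_contra! hcon
  have hlt : ∀ j ∈ s.erase i, v (f j) < v (f i) := by
    intro j hj
    obtain ⟨hji, hj⟩ := Finset.mem_erase.1 hj
    refine lt_of_le_of_ne (hmax j hj) fun h => hvi ?_
    rw [(Valuation.zero_iff v).2 (hcon i hi j hj hji.symm h.symm)]
  have := v.map_sum_lt hvi hlt
  rw [← Finset.add_sum_erase s f hi, add_eq_zero_iff_eq_neg] at h0
  rw [h0, Valuation.map_neg] at this
  exact lt_irrefl _ this

/-- Logarithmic derivatives are additive. -/
theorem Derivation.log_mul {L : Type*} [Field L] (D : Derivation ℤ L L) {a b : L} (ha : a ≠ 0)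
    (hb : b ≠ 0) : D (a * b) / (a * b) = D a / a + D b / b := by
  rw [D.leibniz]
  simp only [smul_eq_mul]
  field_simp
  ring

theorem Derivation.log_pow {L : Type*} [Field L] (D : Derivation ℤ L L) {a : L} (ha : a ≠ 0)
    (n : ℕ) : D (a ^ n) / a ^ n = n * (D a / a) := by
  induction n with
  | zero => simp
  | succ n ih =>
    rw [pow_succ, D.log_mul (pow_ne_zero _ ha) ha, ih]
    push_cast; ring

theorem Derivation.log_zpow {L : Type*} [Field L] (D : Derivation ℤ L L) {a : L} (ha : a ≠ 0)
    (n : ℤ) : D (a ^ n) / a ^ n = n * (D a / a) := by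
  obtain ⟨m, rfl | rfl⟩ := n.eq_nat_or_neg
  · simpa using D.log_pow ha m
  · have h := D.log_mul (a := a ^ (-(m : ℤ))) (b := a ^ m) (zpow_ne_zero _ ha) (pow_ne_zero _ ha)
    have h1 : a ^ (-(m : ℤ)) * a ^ m = 1 := by
      rw [zpow_neg, zpow_natCast, inv_mul_cancel₀ (pow_ne_zero _ ha)]
    rw [h1, D.log_pow ha] at h
    simp only [Derivation.map_one_eq_zero, zero_div] at h
    push_cast
    linear_combination -h

theorem Derivation.apply_aeval {T L : Type*} [CommRing T] [Field L] [Algebra T L]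
    (D : Derivation ℤ L L) (q : T[X]) (e : L) :
    D (aeval e q) = (q.sum fun i a => D (algebraMap T L a) * e ^ i)
      + aeval e (derivative q) * D e := by
  induction q using Polynomial.induction_on' with
  | add p q hp hq =>
    rw [map_add, map_add, hp, hq, Polynomial.sum_add_index _ _ _ (by simp) (by intros; simp; ring)]
    simp only [map_add]
    ring
  | monomial n a =>
    rw [Polynomial.sum_monomial_index _ _ (by simp)]
    simp only [aeval_monomial, derivative_monomial, D.leibniz, smul_eq_mul, D.leibniz_pow,
      nsmul_eq_mul, map_mul]
    rw [_root_.map_natCast]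
    ring

section

variable {T L : Type*} [CommRing T] [Field L] [Algebra T L]

theorem exists_aeval_eq_zero_of_prime [IsDomain T] [FaithfulSMul T L] [WfDvdMonoid T] {t : T}
    (ht : Prime t) {e : L} {p : T[X]}
    (hp : p ≠ 0) (hpe : aeval e p = 0) :
    ∃ q : T[X], q.natDegree ≤ p.natDegree ∧ aeval e q = 0 ∧ ∃ k, ¬ t ∣ q.coeff k := by
  have hCt : Prime (C t : T[X]) := Polynomial.prime_C_iff.2 ht
  obtain ⟨n, q, hq, rfl⟩ := WfDvdMonoid.max_power_factor hp hCt.irreducible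
  have hC0 : (C t : T[X]) ^ n ≠ 0 := pow_ne_zero _ hCt.ne_zero
  refine ⟨q, ?_, ?_, ?_⟩
  · have hq0 : q ≠ 0 := fun h => hq (h ▸ dvd_zero _)
    rw [natDegree_mul hC0 hq0]
    omega
  · rw [map_mul, map_pow, aeval_C] at hpe
    refine (mul_eq_zero.1 hpe).resolve_left (pow_ne_zero _ ?_)
    exact (map_ne_zero_iff _ (FaithfulSMul.algebraMap_injective T L)).2 ht.ne_zero
  · by_contra! h
    exact hq ((C_dvd_iff_dvd_coeff _ _).2 h)

variable {W : ValuationSubring L} {t : T}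

theorem ValuationSubring.IsCenteredAt.mem {Q : Ideal T} (hW : W.IsCenteredAt (algebraMap T L) Q)
    (a : T) : algebraMap T L a ∈ W := (W.valuation_le_one_iff _).1 (hW a).1

theorem ValuationSubring.IsCenteredAt.valuation_eq_pow [IsDomain T] [WfDvdMonoid T]
    (hW : W.IsCenteredAt (algebraMap T L) (Ideal.span {t})) (ht : Prime t) {a : T} (ha : a ≠ 0) :
    ∃ n : ℕ, W.valuation (algebraMap T L a) = W.valuation (algebraMap T L t) ^ n := by
  obtain ⟨n, q, hq, rfl⟩ := WfDvdMonoid.max_power_factor ha ht.irreducible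
  refine ⟨n, ?_⟩
  rw [map_mul, map_mul, map_pow, map_pow, hW.eq_one fun h => hq (Ideal.mem_span_singleton.1 h),
    mul_one]

theorem ValuationSubring.IsCenteredAt.lt_one
    (hW : W.IsCenteredAt (algebraMap T L) (Ideal.span {t})) :
    W.valuation (algebraMap T L t) < 1 := (hW t).2.2 (Ideal.mem_span_singleton_self t)

theorem ValuationSubring.IsCenteredAt.pos [FaithfulSMul T L]
    (_ : W.IsCenteredAt (algebraMap T L) (Ideal.span {t})) (ht : Prime t) :
    0 < W.valuation (algebraMap T L t) := by
  refine zero_lt_iff.2 ((Valuation.ne_zero_iff _).2 ?_)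
  exact (map_ne_zero_iff _ (FaithfulSMul.algebraMap_injective T L)).2 ht.ne_zero

theorem ValuationSubring.IsCenteredAt.factorial_pow [IsDomain T] [FaithfulSMul T L]
    [WfDvdMonoid T]
    (hW : W.IsCenteredAt (algebraMap T L) (Ideal.span {t})) (ht : Prime t) {u : L} (hu : u ≠ 0)
    {p : T[X]} (hp : p ≠ 0) (hpu : aeval u p = 0) {d : ℕ} (hd : p.natDegree ≤ d) :
    ∃ k : ℤ, W.valuation u ^ d.factorial = W.valuation (algebraMap T L t) ^ k := by
  have hinj := FaithfulSMul.algebraMap_injective T L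
  set g := W.valuation (algebraMap T L t) with hg
  have hg0 : g ≠ 0 := (hW.pos ht).ne'
  rw [aeval_eq_sum_range] at hpu
  simp only [Algebra.smul_def] at hpu
  obtain ⟨i, hi, j, hj, hij, hv, hne⟩ := W.valuation.exists_ne_of_sum_eq_zero _ _ hpu
    ⟨p.natDegree, by simp, mul_ne_zero ((map_ne_zero_iff _ hinj).2 (leadingCoeff_ne_zero.2 hp))
      (pow_ne_zero _ hu)⟩
  have hvu : W.valuation u ≠ 0 := (Valuation.ne_zero_iff _).2 hu
  have key : ∀ i j : ℕ, i < j → j ≤ p.natDegree → p.coeff i ≠ 0 → p.coeff j ≠ 0 →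
      W.valuation (algebraMap T L (p.coeff i) * u ^ i)
        = W.valuation (algebraMap T L (p.coeff j) * u ^ j) →
      ∃ k : ℤ, W.valuation u ^ d.factorial = g ^ k := by
    intro i j hij hj hi0 hj0 hv
    obtain ⟨m, hm⟩ := hW.valuation_eq_pow ht hi0
    rw [← hg] at hm
    obtain ⟨n, hn⟩ := hW.valuation_eq_pow ht hj0
    rw [← hg] at hn
    have h1 : W.valuation u ^ (j - i) = g ^ ((m : ℤ) - n) := by
      rw [map_mul, map_mul, map_pow, map_pow, hm, hn] at hv
      rw [zpow_sub₀ hg0, zpow_natCast, zpow_natCast, eq_div_iff (pow_ne_zero _ hg0)]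
      have h2 : W.valuation u ^ j = W.valuation u ^ i * W.valuation u ^ (j - i) := by
        rw [← pow_add]; congr 1; omega
      rw [h2] at hv
      have h3 : W.valuation u ^ i * (W.valuation u ^ (j - i) * g ^ n)
          = W.valuation u ^ i * g ^ m := by
        rw [mul_comm _ (g ^ m), hv]; ac_rfl
      exact mul_left_cancel₀ (pow_ne_zero _ hvu) h3
    obtain ⟨c, hc⟩ := Nat.dvd_factorial (m := j - i) (n := d) (by omega) (by omega)
    refine ⟨((m : ℤ) - n) * c, ?_⟩
    rw [hc, pow_mul, h1, zpow_mul, zpow_natCast]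
  simp only [Finset.mem_range] at hi hj
  have hvj : algebraMap T L (p.coeff j) * u ^ j ≠ 0 := by
    rw [← Valuation.ne_zero_iff W.valuation, ← hv, Valuation.ne_zero_iff]; exact hne
  have hi0 : p.coeff i ≠ 0 := fun h => hne (by simp [h])
  have hj0 : p.coeff j ≠ 0 := fun h => hvj (by simp [h])
  rcases lt_or_gt_of_ne hij with h | h
  · exact key i j h (by omega) hi0 hj0 hv
  · exact key j i h (by omega) hj0 hi0 hv.symm

end

end LogDerivative

section Finiteness

variable {T L : Type*} [CommRing T] [IsDomain T] [Field L] [Algebra T L]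
  [Algebra.IsAlgebraic T L]

/-- Derivations with bounded denominators on an integrally closed domain have bounded
denominators on its integral closure in a finite extension. -/
theorem Derivation.exists_forall_isIntegral_mul [CharZero L] [IsIntegrallyClosed T] {N : Type*}
    [Field N]
    [Algebra T N] [IsFractionRing T N] [Algebra N L] [IsScalarTower T N L] (D : Derivation ℤ L L)
    {c : T} (hc : c ≠ 0) (hD : ∀ a, IsIntegral T (algebraMap T L c * D (algebraMap T L a)))
    (F : IntermediateField N L) [FiniteDimensional N F] :
    ∃ c' : T, c' ≠ 0 ∧ ∀ x ∈ F, IsIntegral T x → IsIntegral T (algebraMap T L c' * D x) := by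
  classical
  have _ : CharZero N := (algebraMap N L).charZero_iff (algebraMap N L).injective |>.2 inferInstance
  obtain ⟨s, b, hb⟩ := FiniteDimensional.exists_is_basis_integral T N F
  let b' := (Algebra.traceForm N F).dualBasis (traceForm_nondegenerate N F) b
  let d : s → L := fun i => (b' i : L)
  obtain ⟨y, hy, hyd⟩ := Algebra.IsAlgebraic.exists_integral_multiples T
    (Finset.univ.image d ∪ Finset.univ.image fun i => D (d i))
  have h1 : ∀ i, IsIntegral T (algebraMap T L y * d i) := fun i => by
    rw [← Algebra.smul_def]; exact hyd _ (by simp)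
  have h2 : ∀ i, IsIntegral T (algebraMap T L y * D (d i)) := fun i => by
    rw [← Algebra.smul_def]; exact hyd _ (by simp)
  refine ⟨c * y, mul_ne_zero hc hy, fun x hxF hx => ?_⟩
  have hx' : (⟨x, hxF⟩ : F) ∈ Submodule.span T (Set.range b') := by
    refine integralClosure_le_span_dualBasis b hb ?_
    change IsIntegral T (⟨x, hxF⟩ : F)
    have _ : IsScalarTower T F L := IsScalarTower.of_algebraMap_eq fun _ => rfl
    exact (isIntegral_algebraMap_iff (A := F) (B := L) (algebraMap F L).injective).1 hx
  rw [Submodule.mem_span_range_iff_exists_fun] at hx'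
  obtain ⟨a, ha⟩ := hx'
  have hxa : x = ∑ i, algebraMap T L (a i) * d i := by
    have := congrArg (algebraMap F L) ha
    simp only [map_sum] at this
    rw [show algebraMap F L ⟨x, hxF⟩ = x from rfl] at this
    rw [← this]
    refine Finset.sum_congr rfl fun i _ => ?_
    rw [Algebra.smul_def, map_mul]
    rfl
  rw [hxa, map_sum, Finset.mul_sum]
  refine IsIntegral.sum _ fun i _ => ?_
  rw [D.leibniz, map_mul]
  have : algebraMap T L c * algebraMap T L y *
      (algebraMap T L (a i) • D (d i) + d i • D (algebraMap T L (a i)))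
      = algebraMap T L c * algebraMap T L (a i) * (algebraMap T L y * D (d i))
        + (algebraMap T L c * D (algebraMap T L (a i))) * (algebraMap T L y * d i) := by
    simp only [smul_eq_mul]; ring
  rw [this]
  exact (((isIntegral_algebraMap).mul isIntegral_algebraMap).mul (h2 i)).add ((hD _).mul (h1 i))

variable {W : ValuationSubring L} {t : T}

/-- Elements of the valuation ring are quotients of integral elements of the same extension. -/
theorem ValuationSubring.IsCenteredAt.exists_quotient [FaithfulSMul T L] [WfDvdMonoid T]
    (hW : W.IsCenteredAt (algebraMap T L) (Ideal.span {t})) (ht : Prime t) {e : L} (he : e ∈ W) :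
    ∃ a ∈ Algebra.adjoin T {e}, ∃ b ∈ Algebra.adjoin T {e}, IsIntegral T a ∧ IsIntegral T b ∧
      W.valuation b = 1 ∧ e * b = a := by
  obtain ⟨p, hp, hpe⟩ := Algebra.IsAlgebraic.isAlgebraic (R := T) e
  obtain ⟨q, -, hq, k, hk⟩ := exists_aeval_eq_zero_of_prime ht hp hpe
  exact exists_integral_quotient hW.mem he hq
    (hW.eq_one fun h => hk (Ideal.mem_span_singleton.1 h))

/-- A polynomial with a simple root at the residue class of a unit. -/
theorem ValuationSubring.IsCenteredAt.exists_simple_root [Algebra ℚ T] [FaithfulSMul T L]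
    [WfDvdMonoid T] (hW : W.IsCenteredAt (algebraMap T L) (Ideal.span {t})) (ht : Prime t)
    {e : L} (he : e ∈ W) : ∃ q : T[X], W.valuation (aeval e q) < 1 ∧
      W.valuation (aeval e (derivative q)) = 1 := by
  classical
  have hmem : ∀ q : T[X], W.valuation (aeval e q) ≤ 1 := fun q => by
    rw [W.valuation_le_one_iff, aeval_eq_sum_range]
    refine sum_mem fun i _ => ?_
    rw [Algebra.smul_def]
    exact W.mul_mem _ _ (hW.mem _) (pow_mem he i)
  let P : ℕ → Prop := fun n => ∃ q : T[X], q.natDegree = n ∧ W.valuation (aeval e q) < 1 ∧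
    ∃ k, ¬ t ∣ q.coeff k
  have hP : ∃ n, P n := by
    obtain ⟨p, hp, hpe⟩ := Algebra.IsAlgebraic.isAlgebraic (R := T) e
    obtain ⟨q, -, hq, k, hk⟩ := exists_aeval_eq_zero_of_prime ht hp hpe
    exact ⟨_, q, rfl, by rw [hq]; simp, k, hk⟩
  obtain ⟨q, hqn, hqe, k, hk⟩ := Nat.find_spec hP
  have hlead : ¬ t ∣ q.leadingCoeff := by
    intro hdvd
    have hkn : k ≠ q.natDegree := fun h => hk (h ▸ hdvd)
    have h1 : q.eraseLead.coeff k = q.coeff k := eraseLead_coeff_of_ne _ hkn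
    have hq0 : q.eraseLead ≠ 0 := fun h => hk (by rw [← h1, h]; simp)
    have h2 : q.eraseLead.natDegree < Nat.find hP := by
      rw [← hqn]
      refine lt_of_le_of_ne (eraseLead_natDegree_le_aux) fun h => ?_
      exact hkn (by
        have := eraseLead_natDegree_lt_or_eraseLead_eq_zero q
        rcases this with h' | h'
        · omega
        · exact absurd h' hq0)
    refine Nat.find_min hP h2 ⟨_, rfl, ?_, k, by rwa [h1]⟩
    have h3 : aeval e q.eraseLead
        = aeval e q - algebraMap T L q.leadingCoeff * e ^ q.natDegree := by
      conv_rhs => rw [← eraseLead_add_monomial_natDegree_leadingCoeff q]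
      rw [map_add, aeval_monomial]
      simp
    rw [h3]
    refine lt_of_le_of_lt (Valuation.map_sub _ _ _) (max_lt hqe ?_)
    rw [map_mul]
    refine lt_of_le_of_lt (mul_le_of_le_one_right' ?_)
        ((hW _).2.2 (Ideal.mem_span_singleton.2 hdvd))
    exact (W.valuation_le_one_iff _).2 (pow_mem he _)
  have hdeg : q.natDegree ≠ 0 := by
    intro h
    obtain ⟨a, rfl⟩ := natDegree_eq_zero.1 h
    rw [leadingCoeff_C] at hlead
    rw [aeval_C, hW.eq_one fun h => hlead (Ideal.mem_span_singleton.1 h)] at hqe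
    exact lt_irrefl _ hqe
  refine ⟨q, hqe, le_antisymm (hmem _) (not_lt.1 fun h => ?_)⟩
  refine Nat.find_min hP ((natDegree_derivative_lt hdeg).trans_eq hqn)
    ⟨_, rfl, h, q.natDegree - 1, fun hdvd => hlead ?_⟩
  rw [coeff_derivative, Nat.sub_add_cancel (Nat.one_le_iff_ne_zero.2 hdeg)] at hdvd
  refine (ht.dvd_or_dvd hdvd).resolve_right fun h => ht.not_isUnit (isUnit_of_dvd_unit h ?_)
  have h4 : (((q.natDegree - 1 : ℕ) : T) + 1) = algebraMap ℚ T (q.natDegree : ℚ) := by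
    rw [_root_.map_natCast, ← Nat.cast_add_one, Nat.sub_add_cancel (Nat.one_le_iff_ne_zero.2 hdeg)]
  rw [h4]
  exact (IsUnit.mk0 _ (by exact_mod_cast hdeg)).map _

end Finiteness

section LogLemma

theorem IsFractionRing.exists_poly_natDegree_le {T N L : Type*} [CommRing T] [IsDomain T] [Field N]
    [Algebra T N] [IsFractionRing T N] [Field L] [Algebra T L] [Algebra N L] [IsScalarTower T N L]
    (F : IntermediateField N L) [FiniteDimensional N F] {x : L} (hx : x ∈ F) :
    ∃ p : T[X], p ≠ 0 ∧ aeval x p = 0 ∧ p.natDegree ≤ Module.finrank N F := by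
  let p := minpoly N (⟨x, hx⟩ : F)
  have hp : aeval x p = 0 := by
    have := congrArg (algebraMap F L) (minpoly.aeval N (⟨x, hx⟩ : F))
    rwa [← aeval_algebraMap_apply, map_zero] at this
  refine ⟨IsLocalization.integerNormalization (nonZeroDivisors T) p, fun h => ?_,
    IsLocalization.integerNormalization_aeval_eq_zero _ p hp, ?_⟩
  · exact minpoly.ne_zero (Algebra.IsIntegral.isIntegral (R := N) (⟨x, hx⟩ : F))
      ((IsFractionRing.integerNormalization_eq_zero_iff).1 h)
  · refine (natDegree_le_iff_coeff_eq_zero.2 fun i hi => ?_).trans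
      (minpoly.natDegree_le (A := N) (⟨x, hx⟩ : F))
    have h1 : p.coeff i = 0 := coeff_eq_zero_of_natDegree_lt hi
    by_contra h
    exact notMem_support_iff.2 h1
      (IsLocalization.integerNormalization_support _ p (mem_support_iff.2 h))

variable {T L : Type*} [CommRing T] [Algebra ℚ T] [Field L] [Algebra T L]
  {W : ValuationSubring L} {t : T}

theorem ValuationSubring.IsCenteredAt.valuation_natCast
    (hW : W.IsCenteredAt (algebraMap T L) (Ideal.span {t})) {n : ℕ} (hn : n ≠ 0) :
    W.valuation (n : L) = 1 := by
  have h1 : ((n : L)) = algebraMap T L (algebraMap ℚ T n) := by simp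
  have h2 : IsUnit (algebraMap ℚ T n) := (IsUnit.mk0 (n : ℚ) (by exact_mod_cast hn)).map _
  rw [h1]
  obtain ⟨b, hb⟩ := h2.exists_right_inv
  have h3 : W.valuation (algebraMap T L (algebraMap ℚ T n)) * W.valuation (algebraMap T L b)
      = 1 := by
    rw [← map_mul, ← map_mul, hb, map_one, map_one]
  refine le_antisymm (hW _).1 ?_
  rw [← h3]
  exact mul_le_of_le_one_right' (hW b).1

theorem Valuation.intCast_le_one {L Γ : Type*} [Field L] [LinearOrderedCommGroupWithZero Γ]
    (v : Valuation L Γ) (n : ℤ) : v (n : L) ≤ 1 := by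
  exact intCast_mem v.integer n

/-- A unit bound for `t • D` gives the same bound for logarithmic derivatives. -/
theorem ValuationSubring.IsCenteredAt.log_pow_mul_le_one [FaithfulSMul T L]
    (hW : W.IsCenteredAt (algebraMap T L) (Ideal.span {t})) (ht : Prime t)
    (D : Derivation ℤ L L) (hD : ∀ a, ∃ b, D (algebraMap T L a) = algebraMap T L b)
    (F : Subfield L) (hF : ∀ a, algebraMap T L a ∈ F) {d : ℕ} (hd : d ≠ 0)
    (hFd : ∀ x ∈ F, x ≠ 0 → ∃ k : ℤ, W.valuation x ^ d = W.valuation (algebraMap T L t) ^ k)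
    {G : W.ValueGroup} (hG : G ≤ 1)
    (hU : ∀ x ∈ F, W.valuation x = 1 → W.valuation (algebraMap T L t * D x) ^ d * G ≤ 1)
    {u : L} (hu : u ∈ F) (hu0 : u ≠ 0) :
    W.valuation (algebraMap T L t * (D u / u)) ^ d * G ≤ 1 := by
  have hinj := FaithfulSMul.algebraMap_injective T L
  have ht0 : algebraMap T L t ≠ 0 := (map_ne_zero_iff _ hinj).2 ht.ne_zero
  obtain ⟨k, hk⟩ := hFd u hu hu0
  let w := u ^ d * (algebraMap T L t) ^ (-k)
  have hwF : w ∈ F := MulMemClass.mul_mem (pow_mem hu d) (zpow_mem (hF t) _)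
  have hw1 : W.valuation w = 1 := by
    simp only [w]
    rw [map_mul, map_pow, map_zpow₀, hk, zpow_neg]
    exact mul_inv_cancel₀ (zpow_ne_zero _ (hW.pos ht).ne')
  have hw0 : w ≠ 0 := fun h => by simp [h] at hw1
  have h1 : D w / w = d * (D u / u) + ((-k : ℤ) : L) *
      (D (algebraMap T L t) / algebraMap T L t) := by
    simp only [w]
    rw [D.log_mul (pow_ne_zero _ hu0) (zpow_ne_zero _ ht0), D.log_pow hu0, D.log_zpow ht0]
  obtain ⟨b, hb⟩ := hD t
  have h2 : (d : L) * (algebraMap T L t * (D u / u)) =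
      algebraMap T L t * D w * w⁻¹ - ((-k : ℤ) : L) * algebraMap T L b := by
    rw [hb] at h1
    field_simp at h1 ⊢
    linear_combination -h1
  have h3 : W.valuation (algebraMap T L t * (D u / u))
      ≤ max (W.valuation (algebraMap T L t * D w)) 1 := by
    have h4 : W.valuation (algebraMap T L t * (D u / u)) =
        W.valuation ((d : L) * (algebraMap T L t * (D u / u))) := by
      rw [map_mul W.valuation (d : L), hW.valuation_natCast hd, one_mul]
    rw [h4, h2]
    refine (Valuation.map_sub _ _ _).trans (max_le_max ?_ ?_)
    · rw [map_mul, map_inv₀, hw1, inv_one, mul_one]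
    · rw [map_mul]
      exact (mul_le_of_le_one_left' (Valuation.intCast_le_one _ _)).trans (hW b).1
  rcases le_max_iff.1 h3 with h | h
  · exact (mul_le_mul_left (pow_le_pow_left' h d) G).trans (hU w hwF hw1)
  · exact mul_le_one' (pow_le_one' h d) hG

variable [IsDomain T] [WfDvdMonoid T] [Algebra.IsAlgebraic T L] [FaithfulSMul T L]

theorem ValuationSubring.IsCenteredAt.exists_derivation_residue
    (hW : W.IsCenteredAt (algebraMap T L) (Ideal.span {t})) (ht : Prime t)
    (D : Derivation ℤ L L) (hD : ∀ a, ∃ b, D (algebraMap T L a) = algebraMap T L b) {e : L}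
    (he : e ∈ W) : ∃ x y : L, W.valuation x < 1 ∧ W.valuation y ≤ W.valuation (algebraMap T L t) ∧
      (∀ F : Subring L, (∀ a, algebraMap T L a ∈ F) → e ∈ F → x ∈ F) ∧
      W.valuation (algebraMap T L t * D e) = W.valuation (algebraMap T L t * D x - y) := by
  obtain ⟨q, hq, hq'⟩ := hW.exists_simple_root ht he
  refine ⟨aeval e q, algebraMap T L t * q.sum fun i a => D (algebraMap T L a) * e ^ i, hq, ?_, ?_,
      ?_⟩
  · rw [map_mul]
    refine mul_le_of_le_one_right' ((W.valuation_le_one_iff _).2 ?_)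
    rw [Polynomial.sum]
    refine sum_mem fun i _ => ?_
    obtain ⟨b, hb⟩ := hD (q.coeff i)
    rw [hb]
    exact W.mul_mem _ _ (hW.mem _) (pow_mem he i)
  · intro F hF heF
    rw [aeval_eq_sum_range]
    refine sum_mem fun i _ => ?_
    rw [Algebra.smul_def]
    exact MulMemClass.mul_mem (hF _) (pow_mem heF i)
  · rw [D.apply_aeval]
    have : algebraMap T L t * ((q.sum fun i a => D (algebraMap T L a) * e ^ i)
        + aeval e (derivative q) * D e) - algebraMap T L t *
        (q.sum fun i a => D (algebraMap T L a) * e ^ i)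
        = aeval e (derivative q) * (algebraMap T L t * D e) := by ring
    rw [this, map_mul (W.valuation) (aeval e (derivative q)), hq', one_mul]

theorem ValuationSubring.IsCenteredAt.log_le_one [CharZero L] [IsIntegrallyClosed T]
    (hW : W.IsCenteredAt (algebraMap T L) (Ideal.span {t})) (ht : Prime t)
    (D : Derivation ℤ L L) (hD : ∀ a, ∃ b, D (algebraMap T L a) = algebraMap T L b)
    {u : L} (hu0 : u ≠ 0) : W.valuation (algebraMap T L t * (D u / u)) ≤ 1 := by
  let N := FractionRing T
  let _ : Algebra N L := FractionRing.liftAlgebra _ _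
  have _ : IsScalarTower T N L := FractionRing.isScalarTower_liftAlgebra _ _
  have _ : Algebra.IsAlgebraic N L :=
    (IsFractionRing.comap_isAlgebraic_iff (A := T) (K := N)).1 inferInstance
  let F := IntermediateField.adjoin N {u}
  have _ : FiniteDimensional N F := IntermediateField.adjoin.finiteDimensional
    (Algebra.IsIntegral.isIntegral u)
  have huF : u ∈ F := IntermediateField.mem_adjoin_simple_self N u
  have hTF : ∀ a, algebraMap T L a ∈ F := fun a => by
    rw [IsScalarTower.algebraMap_apply T N L]; exact F.algebraMap_mem _
  set g := W.valuation (algebraMap T L t) with hg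
  have hg0 : 0 < g := hW.pos ht
  have hg1 : g < 1 := hW.lt_one
  set d := (Module.finrank N F).factorial with hd'
  have hd : d ≠ 0 := Nat.factorial_ne_zero _
  have hFd : ∀ x ∈ F, x ≠ 0 → ∃ k : ℤ, W.valuation x ^ d = g ^ k := fun x hx hx0 => by
    obtain ⟨p, hp, hpx, hpd⟩ := IsFractionRing.exists_poly_natDegree_le (T := T) F hx
    exact hW.factorial_pow ht hx0 hp hpx hpd
  let U : ℕ → Prop := fun r => ∀ x ∈ F.toSubfield, W.valuation x = 1 →
    W.valuation (algebraMap T L t * D x) ^ d * g ^ r ≤ 1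
  have hex : ∃ r, U r := by
    obtain ⟨c, hc, hcD⟩ := D.exists_forall_isIntegral_mul (T := T) (N := N) one_ne_zero (fun a => by
      obtain ⟨b, hb⟩ := hD a
      rw [hb, map_one, one_mul]
      exact isIntegral_algebraMap) F
    obtain ⟨r, hr⟩ := hW.valuation_eq_pow ht hc
    refine ⟨r * d, fun x hx hx1 => ?_⟩
    have hxW : x ∈ W := (W.valuation_le_one_iff _).1 hx1.le
    obtain ⟨a, ha, b, hb, hai, hbi, hb1, hab⟩ := hW.exists_quotient ht hxW
    have hadj : ∀ y ∈ Algebra.adjoin T {x}, y ∈ F := by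
      intro y hy
      rw [Algebra.adjoin_singleton_eq_range_aeval] at hy
      obtain ⟨p, rfl⟩ := hy
      change aeval x p ∈ F
      rw [aeval_eq_sum_range]
      refine sum_mem fun i _ => ?_
      rw [Algebra.smul_def]
      exact MulMemClass.mul_mem (hTF _) (pow_mem hx i)
    have hDa := hcD a (hadj a ha) hai
    have hDb := hcD b (hadj b hb) hbi
    have h1 : b * (algebraMap T L c * D x) = algebraMap T L c * D a
        - x * (algebraMap T L c * D b) := by
      rw [← hab, D.leibniz]; simp only [smul_eq_mul]; ring
    have h2 : W.valuation (algebraMap T L c * D x) ≤ 1 := by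
      have h3 : W.valuation (b * (algebraMap T L c * D x)) ≤ 1 := by
        rw [h1, W.valuation_le_one_iff]
        exact sub_mem (mem_of_isIntegral hW.mem hDa)
          (W.mul_mem _ _ hxW (mem_of_isIntegral hW.mem hDb))
      rwa [map_mul, hb1, one_mul] at h3
    rw [map_mul, hr] at h2
    rw [pow_mul, ← mul_pow]
    refine pow_le_one' ?_ d
    rw [map_mul, mul_assoc, mul_comm (W.valuation (D x))]
    exact mul_le_one' hg1.le h2
  have hstep : ∀ r, U (r + 1) → U r := by
    intro r hr x hx hx1
    have hxW : x ∈ W := (W.valuation_le_one_iff _).1 hx1.le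
    obtain ⟨x', y, hx', hy, hxF, hxy⟩ := hW.exists_derivation_residue ht D hD hxW
    have hx'F : x' ∈ F := hxF F.toSubring hTF hx
    rw [hxy]
    have hgr : g ^ r ≤ 1 := pow_le_one' hg1.le r
    rcases le_max_iff.1 (Valuation.map_sub W.valuation (algebraMap T L t * D x') y) with h | h
    · refine (mul_le_mul_left (pow_le_pow_left' h d) _).trans ?_
      by_cases hx0 : x' = 0
      · simp [hx0, hd]
      have h1 := hW.log_pow_mul_le_one ht D hD F.toSubfield hTF hd hFd (pow_le_one' hg1.le (r + 1))
        hr hx'F hx0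
      obtain ⟨k, hk⟩ := hFd x' hx'F hx0
      have hk1 : W.valuation x' ^ d ≤ g := by
        have h2 : W.valuation x' ^ d < 1 := pow_lt_one₀ zero_le hx' hd
        rw [hk] at h2 ⊢
        have hk0 : 0 < k := by
          by_contra! hneg
          exact absurd h2 (not_lt.2 (one_le_zpow_of_nonpos₀ hg0 hg1.le hneg))
        calc g ^ k ≤ g ^ (1 : ℤ) := zpow_le_zpow_right_of_le_one₀ hg0 hg1.le (by omega)
          _ = g := zpow_one g
      have h3 : algebraMap T L t * D x' = x' * (algebraMap T L t * (D x' / x')) := by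
        field_simp
      have h4 : (W.valuation (algebraMap T L t * D x') ^ d * g ^ r) * g ≤ 1 * g := by
        rw [one_mul, mul_assoc, ← pow_succ, h3, map_mul, mul_pow, mul_assoc]
        exact (mul_le_of_le_one_right' h1).trans hk1
      exact le_of_mul_le_mul_right h4 hg0
    · refine (mul_le_mul_left (pow_le_pow_left' (h.trans (hy.trans hg1.le)) d) _).trans ?_
      rw [one_pow, one_mul]
      exact hgr
  obtain ⟨r, hr⟩ := hex
  have h0 : U 0 := by
    induction r with
    | zero => exact hr
    | succ r ih => exact ih (hstep r hr)
  have := hW.log_pow_mul_le_one ht D hD F.toSubfield hTF hd hFd (G := 1) le_rfl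
    (fun x hx hx1 => by simpa using h0 x hx hx1) huF hu0
  rw [mul_one] at this
  exact (pow_le_one_iff hd).1 this

/-- A derivation preserving `T` maps `W` to `t⁻¹ 𝔪`. -/
theorem ValuationSubring.IsCenteredAt.mul_derivation_lt_one [CharZero L] [IsIntegrallyClosed T]
    (hW : W.IsCenteredAt (algebraMap T L) (Ideal.span {t})) (ht : Prime t)
    (D : Derivation ℤ L L) (hD : ∀ a, ∃ b, D (algebraMap T L a) = algebraMap T L b)
    {u : L} (hu : W.valuation u ≤ 1) : W.valuation (algebraMap T L t * D u) < 1 := by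
  obtain ⟨x, y, hx, hy, -, hxy⟩ := hW.exists_derivation_residue ht D hD
    ((W.valuation_le_one_iff _).1 hu)
  rw [hxy]
  refine lt_of_le_of_lt (Valuation.map_sub _ _ _) (max_lt ?_ (hy.trans_lt hW.lt_one))
  by_cases hx0 : x = 0
  · simp [hx0]
  have h3 : algebraMap T L t * D x = x * (algebraMap T L t * (D x / x)) := by
    field_simp
  rw [h3, map_mul]
  exact (mul_le_of_le_one_right' (hW.log_le_one ht D hD hx0)).trans_lt hx

end LogLemma

section GoodPrimes

variable {T L : Type*} [CommRing T] [Field L] [Algebra T L]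

/-- A derivation of a finite extension of the fraction field preserves almost all valuation rings
centred at principal primes. -/
theorem Derivation.exists_forall_valuation_le_one [IsDomain T] [WfDvdMonoid T]
    [IsIntegrallyClosed T] [CharZero L]
    [Algebra.IsAlgebraic T L] [FaithfulSMul T L] {N : Type*} [Field N] [Algebra T N]
    [IsFractionRing T N] [Algebra N L] [IsScalarTower T N L] (D : Derivation ℤ L L) {c : T}
    (hc : c ≠ 0) (hD : ∀ a, IsIntegral T (algebraMap T L c * D (algebraMap T L a)))
    (F : IntermediateField N L) [FiniteDimensional N F] :
    ∃ s : T, s ≠ 0 ∧ ∀ (t : T) (W : ValuationSubring L), Prime t → ¬ t ∣ s →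
      W.IsCenteredAt (algebraMap T L) (Ideal.span {t}) → ∀ x ∈ F, W.valuation x ≤ 1 →
      W.valuation (D x) ≤ 1 := by
  obtain ⟨s, hs, hsD⟩ := D.exists_forall_isIntegral_mul hc hD F
  refine ⟨s, hs, fun t W ht hts hW x hx hx1 => ?_⟩
  have hxW : x ∈ W := (W.valuation_le_one_iff _).1 hx1
  obtain ⟨a, ha, b, hb, hai, hbi, hb1, hab⟩ := hW.exists_quotient ht hxW
  have hadj : ∀ y ∈ Algebra.adjoin T {x}, y ∈ F := fun y hy =>
    (Algebra.adjoin_le (S := F.toSubalgebra.restrictScalars T) (by simpa using hx)) hy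
  have h1 : b * (algebraMap T L s * D x) = algebraMap T L s * D a
      - x * (algebraMap T L s * D b) := by
    rw [← hab, D.leibniz]; simp only [smul_eq_mul]; ring
  have h3 : W.valuation (b * (algebraMap T L s * D x)) ≤ 1 := by
    rw [h1, W.valuation_le_one_iff]
    exact sub_mem (ValuationSubring.mem_of_isIntegral hW.mem (hsD a (hadj a ha) hai))
      (W.mul_mem _ _ hxW (ValuationSubring.mem_of_isIntegral hW.mem (hsD b (hadj b hb) hbi)))
  rwa [map_mul, map_mul, hb1, hW.eq_one (by rwa [Ideal.mem_span_singleton]), one_mul,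
    one_mul] at h3

/-- If a derivation preserving the valuation ring sends `u` to a unit, then `u` has maximal
value. -/
theorem ValuationSubring.le_of_derivation_unit (W : ValuationSubring L) (D : Derivation ℤ L L)
    (F : Subfield L) (hD : ∀ x ∈ F, W.valuation x ≤ 1 → W.valuation (D x) ≤ 1)
    {u e : L} (hu : u ∈ F) (he : e ∈ F) (he0 : e ≠ 0) (he1 : W.valuation e ≤ 1) {n k : ℕ}
    (hn : W.valuation (n : L) = 1) (hk : k ≠ 0)
    (h : W.valuation u ^ n = W.valuation e ^ k) (hDu : W.valuation (D u) = 1) :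
    W.valuation e ≤ W.valuation u := by
  have hv0 : 0 < W.valuation e := by simpa [zero_lt_iff] using he0
  have hn0 : n ≠ 0 := by rintro rfl; simp at hn
  have hu0 : 0 < W.valuation u := by
    rw [zero_lt_iff]
    intro h0
    rw [h0, zero_pow hn0] at h
    exact (pow_pos hv0 k).ne h
  let w := u ^ n * (e ^ k)⁻¹
  have hwF : w ∈ F := MulMemClass.mul_mem (pow_mem hu _) (inv_mem (pow_mem he _))
  have hw : u ^ n = e ^ k * w := by
    simp only [w]; field_simp
  have hw1 : W.valuation w = 1 := by
    simp only [w]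
    rw [map_mul, map_inv₀, map_pow, map_pow, h, mul_inv_cancel₀ (pow_pos hv0 k).ne']
  have h1 := congrArg D hw
  rw [D.leibniz, D.leibniz_pow, D.leibniz_pow] at h1
  simp only [smul_eq_mul, nsmul_eq_mul] at h1
  have h2 : W.valuation (n * (u ^ (n - 1) * D u)) = W.valuation u ^ (n - 1) := by
    rw [map_mul, map_mul, hn, hDu, one_mul, mul_one, map_pow]
  have h3 : W.valuation u ^ (n - 1) ≤ W.valuation e ^ (k - 1) := by
    rw [← h2, h1]
    refine (Valuation.map_add _ _ _).trans (max_le ?_ ?_)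
    · rw [map_mul, map_pow]
      calc W.valuation e ^ k * W.valuation (D w) ≤ W.valuation e ^ k :=
            mul_le_of_le_one_right' (hD w hwF hw1.le)
        _ ≤ _ := pow_le_pow_right_of_le_one' he1 (by omega)
    · rw [map_mul, hw1, one_mul, map_mul, map_mul, map_pow]
      refine (mul_le_of_le_one_left' ?_).trans (mul_le_of_le_one_right' (hD e he he1))
      exact_mod_cast Valuation.intCast_le_one W.valuation k
  have h4 : W.valuation u ^ n * W.valuation e ≤ W.valuation u ^ n * W.valuation u := by
    calc W.valuation u ^ n * W.valuation e
        = W.valuation u ^ (n - 1) * (W.valuation u * W.valuation e) := by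
          rw [← mul_assoc, ← pow_succ, Nat.sub_add_cancel (Nat.pos_of_ne_zero hn0)]
      _ ≤ W.valuation e ^ (k - 1) * (W.valuation u * W.valuation e) := mul_le_mul_left h3 _
      _ = W.valuation e ^ k * W.valuation u := by
          rw [mul_comm (W.valuation u), ← mul_assoc, ← pow_succ,
            Nat.sub_add_cancel (Nat.pos_of_ne_zero hk)]
      _ = _ := by rw [h]
  exact le_of_mul_le_mul_left h4 (pow_pos hu0 n)

end GoodPrimes

end

section PDeriv

namespace MvPolynomial

variable {ι K : Type*} [Field K]

theorem totalDegree_pderiv_lt {j : ι} {h : MvPolynomial ι K} (hj : pderiv j h ≠ 0) :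
    (pderiv j h).totalDegree < h.totalDegree := by
  have key : ∀ m ∈ (pderiv j h).support, (m.sum fun _ e => e) + 1 ≤ h.totalDegree := by
    intro m hm
    rw [mem_support_iff, coeff_pderiv] at hm
    have h1 : m + Finsupp.single j 1 ∈ h.support :=
      mem_support_iff.2 (left_ne_zero_of_mul hm)
    have := le_totalDegree h1
    rwa [Finsupp.sum_add_index' (fun _ => rfl) (fun _ _ _ => rfl),
      Finsupp.sum_single_index rfl] at this
  obtain ⟨m, hm⟩ := support_nonempty.2 hj
  rw [totalDegree, Finset.sup_lt_iff]
  · exact fun m hm => Nat.lt_of_succ_le (key m hm)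
  · exact lt_of_lt_of_le (Nat.succ_pos _) (key m hm)

theorem eq_C_of_forall_pderiv_eq_zero [CharZero K] {h : MvPolynomial ι K}
    (hj : ∀ j, pderiv j h = 0) :
    ∃ c, h = C c := by
  refine ⟨coeff 0 h, ?_⟩
  classical
  ext m
  rw [coeff_C]
  split_ifs with hm
  · rw [hm]
  · obtain ⟨j, hj'⟩ : ∃ j, m j ≠ 0 := by
      by_contra! hc
      exact hm (Finsupp.ext fun j => (hc j).symm)
    have h1 := coeff_pderiv (i := j) h (m - Finsupp.single j 1)
    rw [hj j, coeff_zero, tsub_add_cancel_of_le (by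
      rw [Finsupp.single_le_iff]; exact Nat.pos_of_ne_zero hj')] at h1
    rcases mul_eq_zero.1 h1.symm with h2 | h2
    · exact h2
    · exact absurd h2 (Nat.cast_add_one_ne_zero _)

/-- In a set of non-constant polynomials, an element of minimal degree has a derivative which is
nonzero and outside of the set. -/
theorem exists_pderiv_notMem [CharZero K] (S : Set (MvPolynomial ι K)) (hS : S.Nonempty)
    (hC : ∀ c, C c ∉ S) :
    ∃ h ∈ S, (∃ j, pderiv j h ≠ 0) ∧ (∀ j, pderiv j h ∉ S ∨ pderiv j h = 0) ∧
      ∀ g ∈ S, h.totalDegree ≤ g.totalDegree := by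
  let f : MvPolynomial ι K → ℕ := totalDegree
  have hmin := fun g (hg : g ∈ S) => Function.argminOn_le f S hg
  have hmem := Function.argminOn_mem f S hS
  refine ⟨_, hmem, ?_, fun j => ?_, hmin⟩
  · by_contra! hc
    obtain ⟨c, hc⟩ := eq_C_of_forall_pderiv_eq_zero hc
    exact hC c (hc ▸ hmem)
  · by_contra! hc
    exact absurd (hmin _ hc.1) (not_le.2 (totalDegree_pderiv_lt hc.2))

theorem pderiv_comm (i j : ι) (h : MvPolynomial ι K) :
    pderiv i (pderiv j h) = pderiv j (pderiv i h) := by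
  ext m
  simp only [coeff_pderiv]
  by_cases hij : i = j
  · rw [hij]
  · rw [add_right_comm]
    simp [hij, Ne.symm hij]
    ring

theorem adjoin_supported_eq_top (j : ι) :
    Algebra.adjoin (supported K ({j}ᶜ : Set ι)) {(X j : MvPolynomial ι K)} = ⊤ := by
  rw [eq_top_iff]
  intro p _
  induction p using MvPolynomial.induction_on with
  | C a =>
    exact Subalgebra.algebraMap_mem _
      (⟨C a, Subalgebra.algebraMap_mem _ a⟩ : supported K ({j}ᶜ : Set ι))
  | add p q hp hq => exact add_mem (hp trivial) (hq trivial)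
  | mul_X p i hp =>
    refine mul_mem (hp trivial) ?_
    by_cases hi : i = j
    · rw [hi]; exact Algebra.subset_adjoin rfl
    · exact Subalgebra.algebraMap_mem _ (⟨X i, X_mem_supported.2 hi⟩ : supported K ({j}ᶜ : Set ι))

theorem pderiv_eq_zero_of_mem_supported {j : ι} {p : MvPolynomial ι K}
    (hp : p ∈ supported K ({j}ᶜ : Set ι)) : pderiv j p = 0 :=
  pderiv_eq_zero_of_notMem_vars fun h => mem_supported.1 hp h rfl

/-- A prime ideal is principal if it contains an irreducible `h` and has no nonzero element
independent of a variable occurring in `h`. -/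
theorem eq_span_of_forall_pderiv_ne_zero {I : Ideal (MvPolynomial ι K)} {h : MvPolynomial ι K}
    (hh : Prime h) (hI : h ∈ I) (j : ι) (hj : ∀ r ∈ I, pderiv j r = 0 → r = 0) :
    I = Ideal.span {h} := by
  refine le_antisymm (fun r hr => ?_) ((Ideal.span_singleton_le_iff_mem _).2 hI)
  by_contra hrh
  let J := Ideal.span {h}
  have hJ : J.IsPrime := (Ideal.span_singleton_prime hh.ne_zero).2 hh
  let A := supported K ({j}ᶜ : Set ι)
  have hJI : J ≤ I := (Ideal.span_singleton_le_iff_mem _).2 hI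
  have hmk : (Ideal.Quotient.mk J r) ≠ 0 := fun h0 => hrh (Ideal.Quotient.eq_zero_iff_mem.1 h0)
  have halg : ∀ b : MvPolynomial ι K ⧸ J, IsAlgebraic A b := by
    have hX : IsAlgebraic A (Ideal.Quotient.mk J (X j)) := by
      have : h ∈ Algebra.adjoin A {(X j : MvPolynomial ι K)} := by
        rw [adjoin_supported_eq_top]; trivial
      rw [Algebra.adjoin_singleton_eq_range_aeval] at this
      obtain ⟨q, hq⟩ := this
      refine ⟨q, fun h0 => hh.ne_zero ?_, ?_⟩
      · rw [← hq, h0]; exact map_zero _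
      · have h2 : Polynomial.aeval (Ideal.Quotient.mkₐ A J (X j)) q = Ideal.Quotient.mkₐ A J h := by
          rw [Polynomial.aeval_algHom_apply]; exact congrArg _ hq
        exact h2.trans (Ideal.Quotient.eq_zero_iff_mem.2 (Ideal.mem_span_singleton_self h))
    have hle : Algebra.adjoin A {(X j : MvPolynomial ι K)} ≤
        (Subalgebra.algebraicClosure A (MvPolynomial ι K ⧸ J)).comap (Ideal.Quotient.mkₐ A J) :=
      Algebra.adjoin_le (Set.singleton_subset_iff.2 hX)
    intro b
    obtain ⟨p, rfl⟩ := Ideal.Quotient.mk_surjective b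
    have hp : p ∈ Algebra.adjoin A {(X j : MvPolynomial ι K)} := by
      rw [adjoin_supported_eq_top]; trivial
    exact hle hp
  have h5 := Ideal.comap_ne_bot_of_algebraic_mem (I := I.map (Ideal.Quotient.mk J)) hmk
    (Ideal.mem_map_of_mem _ hr) (halg _)
  apply h5
  rw [eq_bot_iff]
  intro a ha
  have h6 : (a : MvPolynomial ι K) ∈ I := by
    have h7 : Ideal.Quotient.mk J (a : MvPolynomial ι K) ∈ I.map (Ideal.Quotient.mk J) := ha
    rw [Ideal.mem_quotient_iff_mem_sup, sup_eq_left.2 hJI] at h7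
    exact h7
  exact Subtype.ext (hj _ h6 (pderiv_eq_zero_of_mem_supported a.2))

end MvPolynomial

end PDeriv

section

open MvPolynomial

section DualDerivations

variable {ι K L : Type*} [Field K] [Field L] [Algebra K L]

theorem Derivation.apply_mvPolynomial_aeval [Fintype ι] (D : Derivation K L L) (x : ι → L)
    (p : MvPolynomial ι K) : D (aeval x p) = ∑ j, aeval x (pderiv j p) * D (x j) := by
  induction p using MvPolynomial.induction_on with
  | C a => simp
  | add p q hp hq => simp [hp, hq, add_mul, Finset.sum_add_distrib]
  | mul_X p i hp =>
    classical
    simp only [map_mul, aeval_X, D.leibniz, hp, smul_eq_mul, pderiv_mul, pderiv_X, map_add,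
      add_mul, Finset.sum_add_distrib, Finset.mul_sum]
    rw [add_comm]
    congr 1
    · refine Finset.sum_congr rfl fun j _ => by ring
    · rw [Finset.sum_eq_single i]
      · simp
      · intro j _ hj
        simp [Ne.symm hj]
      · simp

theorem Derivation.apply_aeval_of_dual [Fintype ι] [DecidableEq ι] (D : Derivation K L L)
    {x : ι → L} {j : ι} (hx : ∀ l, D (x l) = Pi.single (M := fun _ => L) j 1 l)
    (p : MvPolynomial ι K) : D (aeval x p) = aeval x (pderiv j p) := by
  rw [D.apply_mvPolynomial_aeval x, Finset.sum_eq_single j]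
  · simp [hx]
  · intro l _ hl
    simp [hx, hl]
  · simp

theorem IntermediateField.mvPolynomial_aeval_mem (F : IntermediateField K L) {x : ι → L}
    (hx : ∀ j, x j ∈ F) (p : MvPolynomial ι K) : aeval x p ∈ F := by
  induction p using MvPolynomial.induction_on with
  | C a => rw [aeval_C]; exact F.algebraMap_mem a
  | add p q hp hq => rw [map_add]; exact add_mem hp hq
  | mul_X p i hp => rw [map_mul, aeval_X]; exact mul_mem hp (hx i)

variable [Fintype ι] [DecidableEq ι] [CharZero K]

theorem ValuationSubring.exists_valuation_eq_of_dual (W : ValuationSubring L)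
    (hK : ∀ c : K, c ≠ 0 → W.valuation (algebraMap K L c) = 1)
    (F : IntermediateField K L) (x : ι → L) (hxF : ∀ j, x j ∈ F)
    (hxW : ∀ j, W.valuation (x j) ≤ 1) (D : ι → Derivation K L L)
    (hDx : ∀ j l, D j (x l) = Pi.single (M := fun _ => L) j 1 l)
    (hD : ∀ j, ∀ e ∈ F, W.valuation e ≤ 1 → W.valuation (D j e) ≤ 1)
    {π : L} (hπ : π ∈ F) (hπ0 : π ≠ 0) (hπ1 : W.valuation π < 1)
    (hmax : ∀ e ∈ F, W.valuation e < 1 → W.valuation e ≤ W.valuation π)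
    (hpow : ∀ u ∈ F, u ≠ 0 → W.valuation u < 1 →
      ∃ n k : ℕ, n ≠ 0 ∧ k ≠ 0 ∧ W.valuation u ^ n = W.valuation π ^ k)
    (I : Ideal (MvPolynomial ι K)) (hI : ∀ p, p ∈ I ↔ W.valuation (aeval x p) < 1)
    (hI0 : I ≠ ⊥) (hx : AlgebraicIndependent K x) :
    ∃ h, Prime h ∧ I = Ideal.span {h} ∧ W.valuation (aeval x h) = W.valuation π := by
  have hmem : ∀ p : MvPolynomial ι K, aeval x p ∈ F := F.mvPolynomial_aeval_mem hxF
  have hle : ∀ p : MvPolynomial ι K, W.valuation (aeval x p) ≤ 1 := fun p => by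
    induction p using MvPolynomial.induction_on with
    | C a =>
      rw [aeval_C]
      rcases eq_or_ne a 0 with rfl | h
      · simp
      · exact (hK a h).le
    | add p q hp hq => rw [map_add]; exact (Valuation.map_add _ _ _).trans (max_le hp hq)
    | mul_X p i hp => rw [map_mul, aeval_X, map_mul]; exact mul_le_one' hp (hxW i)
  have hnat : ∀ n : ℕ, n ≠ 0 → W.valuation (n : L) = 1 := fun n hn => by
    rw [← map_natCast (algebraMap K L)]
    exact hK _ (Nat.cast_ne_zero.2 hn)
  have hDp : ∀ j (p : MvPolynomial ι K), D j (aeval x p) = aeval x (pderiv j p) := fun j p =>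
    (D j).apply_aeval_of_dual (hDx j) p
  have hne : ∀ p : MvPolynomial ι K, p ≠ 0 → aeval x p ≠ 0 := fun p hp h0 =>
    hp (hx (by rw [h0, map_zero]))
  have hC : ∀ c : K, c ≠ 0 → C c ∉ I := fun c hc hcI => by
    have := (hI _).1 hcI
    rw [aeval_C, hK c hc] at this
    exact lt_irrefl _ this
  have h1 : ∀ p ∉ I, W.valuation (aeval x p) = 1 := fun p hp =>
    le_antisymm (hle p) (not_lt.1 fun h => hp ((hI p).2 h))
  have hIp : I.IsPrime := by
    refine ⟨fun h => hC 1 one_ne_zero (h ▸ trivial), fun {p q} hpq => ?_⟩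
    by_contra! hc
    have := (hI _).1 hpq
    rw [map_mul, map_mul, h1 p hc.1, h1 q hc.2, one_mul] at this
    exact lt_irrefl _ this
  obtain ⟨p0, hp0, hp0'⟩ := Submodule.exists_mem_ne_zero_of_ne_bot hI0
  obtain ⟨h, ⟨hhI, hh0⟩, ⟨j, hj⟩, hmin, hdeg⟩ := exists_pderiv_notMem
    {p : MvPolynomial ι K | p ∈ I ∧ p ≠ 0} ⟨p0, hp0, hp0'⟩ (by
      rintro c ⟨hc, hc0⟩
      exact hC c (fun h => hc0 (by rw [h, map_zero])) hc)
  have hjI : pderiv j h ∉ I := fun hjI => (hmin j).elim (fun h' => h' ⟨hjI, hj⟩) (fun h' => hj h')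
  have hhv : W.valuation (aeval x h) = W.valuation π := by
    have hlt := (hI h).1 hhI
    refine le_antisymm (hmax _ (hmem h) hlt) ?_
    obtain ⟨n, k, hn, hk, hnk⟩ := hpow _ (hmem h) (hne h hh0) hlt
    refine W.le_of_derivation_unit ((D j).restrictScalars ℤ) F.toSubfield (hD j) (hmem h) hπ hπ0
      hπ1.le (hnat n hn) hk hnk ?_
    change W.valuation (D j (aeval x h)) = 1
    rw [hDp, h1 _ hjI]
  have hprime : Prime h := by
    refine UniqueFactorizationMonoid.irreducible_iff_prime.1 ⟨fun hu => ?_, ?_⟩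
    · exact hIp.ne_top (I.eq_top_of_isUnit_mem hhI hu)
    · have key : ∀ a b, h = a * b → a ∈ I → IsUnit b := by
        intro a b hab ha
        have ha0 : a ≠ 0 := fun h0 => hh0 (by rw [hab, h0, zero_mul])
        have hb0 : b ≠ 0 := fun h0 => hh0 (by rw [hab, h0, mul_zero])
        have h2 := hdeg a ⟨ha, ha0⟩
        rw [hab, totalDegree_mul_of_isDomain ha0 hb0] at h2
        have h3 : b.totalDegree = 0 := by omega
        rw [totalDegree_eq_zero_iff_eq_C] at h3
        rw [h3]
        refine IsUnit.map C (IsUnit.mk0 _ fun h0 => hb0 ?_)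
        rw [h3, h0, map_zero]
      intro a b hab
      rcases hIp.mem_or_mem (hab ▸ hhI : a * b ∈ I) with h' | h'
      · exact Or.inr (key a b hab h')
      · exact Or.inl (key b a (by rw [hab, mul_comm]) h')
  refine ⟨h, hprime, eq_span_of_forall_pderiv_ne_zero hprime hhI j ?_, hhv⟩
  by_contra! hc
  obtain ⟨r0, hr0, hr0j, hr00⟩ := hc
  obtain ⟨r, ⟨hrI, hrj, hr0⟩, ⟨l, hl⟩, hrmin, -⟩ := exists_pderiv_notMem
    {p : MvPolynomial ι K | p ∈ I ∧ pderiv j p = 0 ∧ p ≠ 0} ⟨r0, hr0, hr0j, hr00⟩ (by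
      rintro c ⟨hc, -, hc0⟩
      exact hC c (fun h => hc0 (by rw [h, map_zero])) hc)
  have hh' := hne h hh0
  set e := aeval x h with he
  let w := aeval x r * e⁻¹
  have hwF : w ∈ F := MulMemClass.mul_mem (hmem r) (inv_mem (hmem h))
  have hrw : aeval x r = e * w := by simp only [w]; field_simp
  have hwle : W.valuation w ≤ 1 := by
    simp only [w]
    rw [map_mul, map_inv₀]
    refine mul_inv_le_one_of_le₀ ?_ zero_le
    rw [hhv]
    exact hmax _ (hmem r) ((hI r).1 hrI)
  have helt : W.valuation e < 1 := (hI h).1 hhI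
  have hwlt : W.valuation w < 1 := by
    have h2 : D j (aeval x r) = 0 := by rw [hDp, hrj, map_zero]
    rw [hrw, (D j).leibniz, hDp, smul_eq_mul, smul_eq_mul] at h2
    have h3 : w * aeval x (pderiv j h) = - (e * D j w) := by linear_combination h2
    have h4 : W.valuation (w * aeval x (pderiv j h)) < 1 := by
      rw [h3, Valuation.map_neg, map_mul]
      exact (mul_le_of_le_one_right' (hD j w hwF hwle)).trans_lt helt
    rwa [map_mul, h1 _ hjI, mul_one] at h4
  have hlI : pderiv l r ∈ I := by
    rw [hI, ← hDp, hrw, (D l).leibniz, hDp, smul_eq_mul, smul_eq_mul]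
    refine (Valuation.map_add _ _ _).trans_lt (max_lt ?_ ?_)
    · rw [map_mul]; exact (mul_le_of_le_one_right' (hD l w hwF hwle)).trans_lt helt
    · rw [map_mul]; exact (mul_le_of_le_one_right' (hle _)).trans_lt hwlt
  exact (hrmin l).elim (fun h' => h' ⟨hlI, by rw [pderiv_comm, hrj, map_zero], hl⟩)
    (fun hk => hl hk)

/-- An element generating the centre in a polynomial ring has maximal value. -/
theorem ValuationSubring.valuation_le_of_dual (W : ValuationSubring L)
    (hK : ∀ c : K, c ≠ 0 → W.valuation (algebraMap K L c) = 1)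
    (F : IntermediateField K L) (x : ι → L) (hxF : ∀ j, x j ∈ F) (D : ι → Derivation K L L)
    (hDx : ∀ j l, D j (x l) = Pi.single (M := fun _ => L) j 1 l)
    (hD : ∀ j, ∀ e ∈ F, W.valuation e ≤ 1 → W.valuation (D j e) ≤ 1)
    {t : MvPolynomial ι K} (ht : Prime t)
    (hW : W.IsCenteredAt (aeval x : MvPolynomial ι K →ₐ[K] L).toRingHom (Ideal.span {t}))
    (hpow : ∀ u ∈ F, u ≠ 0 → W.valuation u < 1 →
      ∃ n k : ℕ, n ≠ 0 ∧ k ≠ 0 ∧ W.valuation u ^ n = W.valuation (aeval x t) ^ k)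
    {e : L} (he : e ∈ F) (he1 : W.valuation e < 1) :
    W.valuation e ≤ W.valuation (aeval x t) := by
  rcases eq_or_ne e 0 with rfl | he0
  · simp
  have hmem : aeval x t ∈ F := F.mvPolynomial_aeval_mem hxF t
  obtain ⟨j, hj⟩ : ∃ j, pderiv j t ≠ 0 := by
    by_contra! hc
    obtain ⟨c, rfl⟩ := eq_C_of_forall_pderiv_eq_zero hc
    refine ht.not_isUnit (IsUnit.map C (IsUnit.mk0 _ fun h0 => ht.ne_zero (by rw [h0, map_zero])))
  have hjt : ¬ t ∣ pderiv j t := fun ⟨w, hw⟩ => by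
    have hw0 : w ≠ 0 := fun h0 => hj (by rw [hw, h0, mul_zero])
    have h1 := totalDegree_pderiv_lt hj
    rw [hw, totalDegree_mul_of_isDomain ht.ne_zero hw0] at h1
    omega
  obtain ⟨n, k, hn, hk, hnk⟩ := hpow e he he0 he1
  refine W.le_of_derivation_unit ((D j).restrictScalars ℤ) F.toSubfield (hD j) hmem he he0
      he1.le ?_ hn hnk.symm ?_
  · rw [← map_natCast (algebraMap K L)]
    exact hK _ (Nat.cast_ne_zero.2 hk)
  · change W.valuation (D j (aeval x t)) = 1
    rw [(D j).apply_aeval_of_dual (hDx j)]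
    exact hW.eq_one (by rwa [Ideal.mem_span_singleton])

end DualDerivations

section LineSubst

variable {ι K B : Type*} [Field K] [CommRing B] [Algebra K B]

/-- Substitution of the line `c + Y a` in a polynomial. -/
noncomputable def lineSubst (a : ι → K) (c : ι → B) :
    MvPolynomial ι K →ₐ[K] Polynomial B :=
  aeval fun j => Polynomial.C (c j) + Polynomial.C (algebraMap K B (a j)) * Polynomial.X

theorem lineSubst_monomial (a : ι → K) (c : ι → B) (m : ι →₀ ℕ) :
    (lineSubst a c (monomial m 1)).natDegree ≤ m.degree ∧
      (lineSubst a c (monomial m 1)).coeff m.degree =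
        algebraMap K B (eval a (monomial m 1)) := by
  induction m using Finsupp.induction_linear with
  | zero => simp [← C_apply]
  | add f g hf hg =>
    have h : (monomial (f + g) (1 : K)) = monomial f 1 * monomial g 1 := by simp
    rw [h, map_mul, map_add, map_mul, map_mul]
    refine ⟨Polynomial.natDegree_mul_le.trans (add_le_add hf.1 hg.1), ?_⟩
    rw [Polynomial.coeff_mul_add_eq_of_natDegree_le hf.1 hg.1, hf.2, hg.2]
  | single i n =>
    have h : (monomial (Finsupp.single i n) (1 : K)) = X i ^ n := by
      rw [X_pow_eq_monomial]
    have h1 : (Polynomial.C (c i) + Polynomial.C (algebraMap K B (a i)) * Polynomial.X).natDegree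
        ≤ 1 := by compute_degree
    rw [h, map_pow, lineSubst, aeval_X, Finsupp.degree_single]
    refine ⟨Polynomial.natDegree_pow_le.trans ?_, ?_⟩
    · simpa using Nat.mul_le_mul_left n h1
    · have := Polynomial.coeff_pow_of_natDegree_le (m := n) h1
      rw [mul_one] at this
      rw [this]
      simp

theorem natDegree_lineSubst_le (a : ι → K) (c : ι → B) (p : MvPolynomial ι K) :
    (lineSubst a c p).natDegree ≤ p.totalDegree := by
  have h : lineSubst a c p = ∑ m ∈ p.support, p.coeff m • lineSubst a c (monomial m 1) := by
    conv_lhs => rw [p.as_sum]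
    rw [map_sum]
    refine Finset.sum_congr rfl fun m _ => ?_
    rw [← map_smul, smul_monomial, smul_eq_mul, mul_one]
  rw [h]
  refine Polynomial.natDegree_sum_le_of_forall_le _ _ fun m hm => ?_
  exact (Polynomial.natDegree_smul_le _ _).trans
    ((lineSubst_monomial a c m).1.trans (le_totalDegree hm))

theorem coeff_lineSubst (a : ι → K) (c : ι → B) (p : MvPolynomial ι K) :
    (lineSubst a c p).coeff p.totalDegree =
      algebraMap K B (eval a (homogeneousComponent p.totalDegree p)) := by
  have h : lineSubst a c p = ∑ m ∈ p.support, p.coeff m • lineSubst a c (monomial m 1) := by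
    conv_lhs => rw [p.as_sum]
    rw [map_sum]
    refine Finset.sum_congr rfl fun m _ => ?_
    rw [← map_smul, smul_monomial, smul_eq_mul, mul_one]
  rw [h, Polynomial.finsetSum_coeff, homogeneousComponent_apply, map_sum, map_sum,
    Finset.sum_filter]
  refine Finset.sum_congr rfl fun m hm => ?_
  rw [Polynomial.coeff_smul]
  split_ifs with hd
  · have h1 : (monomial m (p.coeff m)) = p.coeff m • monomial m (1 : K) := by
      rw [smul_monomial, smul_eq_mul, mul_one]
    rw [← hd, (lineSubst_monomial a c m).2, h1, smul_eval, map_mul, Algebra.smul_def]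
  · rw [Polynomial.coeff_eq_zero_of_natDegree_lt, smul_zero]
    exact (lineSubst_monomial a c m).1.trans_lt (lt_of_le_of_ne (le_totalDegree hm) hd)

theorem eval_lineSubst (a : ι → K) (c : ι → B) (p : MvPolynomial ι K) (b : B) :
    (lineSubst a c p).eval b = aeval (fun j => c j + algebraMap K B (a j) * b) p := by
  induction p using MvPolynomial.induction_on with
  | C k => simp [lineSubst]
  | add p q hp hq => simp [hp, hq]
  | mul_X p i hp => rw [map_mul, map_mul, Polynomial.eval_mul, hp]; simp [lineSubst]

theorem map_lineSubst {B' : Type*} [CommRing B'] [Algebra K B'] (g : B →ₐ[K] B') (a : ι → K)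
    (c : ι → B) (p : MvPolynomial ι K) :
    (lineSubst a c p).map g.toRingHom = lineSubst a (fun j => g (c j)) p := by
  induction p using MvPolynomial.induction_on with
  | C k =>
    have h1 : lineSubst a c (C k) = Polynomial.C (algebraMap K B k) := by
      rw [lineSubst, algHom_C]; rfl
    have h2 : lineSubst a (fun j => g (c j)) (C k) = Polynomial.C (algebraMap K B' k) := by
      rw [lineSubst, algHom_C]; rfl
    rw [h1, h2, Polynomial.map_C]
    simp
  | add p q hp hq => rw [map_add, map_add, Polynomial.map_add, hp, hq]
  | mul_X p i hp =>
    rw [map_mul, map_mul, Polynomial.map_mul, hp]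
    simp [lineSubst]

theorem eval_smul_homogeneousComponent (b : ι → K) (k : K) (n : ℕ) (p : MvPolynomial ι K) :
    eval (fun i => k * b i) (homogeneousComponent n p) =
      k ^ n * eval b (homogeneousComponent n p) := by
  rw [homogeneousComponent_apply, map_sum, map_sum, Finset.mul_sum]
  refine Finset.sum_congr rfl fun m hm => ?_
  rw [← (Finset.mem_filter.1 hm).2, eval_monomial, eval_monomial, Finsupp.prod, Finsupp.prod,
    Finsupp.degree_apply, ← Finset.prod_pow_eq_pow_sum, mul_left_comm, ← Finset.prod_mul_distrib]
  simp only [mul_pow]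

end LineSubst

/-- The hyperplane coordinates `x_j - a_j x_{j₀}`, where `a_{j₀} = 1`, form a Noether
normalisation of `R ⧸ P`, where `P` lies over the prime generated by `h`. -/
structure IsNormalDirection {ι K R : Type*} [Field K] [CommRing R] [Algebra K R] (x : ι → R)
    (P : Ideal R) (h : MvPolynomial ι K) (a : ι → K) (j₀ : ι) : Prop where
  prime : Prime h
  mem_iff : ∀ p, aeval x p ∈ P ↔ h ∣ p
  one : a j₀ = 1
  lead : eval a (homogeneousComponent h.totalDegree h) ≠ 0

section NormalDirection

variable {ι K R : Type*} [Field K] [CommRing R] [Algebra K R]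

/-- Coordinates along the hyperplane transversal to `a`. -/
def sliceCoord (x : ι → R) (a : ι → K) (j₀ : ι) (j : ι) : R :=
  x j - algebraMap K R (a j) * x j₀

variable {x : ι → R} {P : Ideal R} {h : MvPolynomial ι K} {a : ι → K} {j₀ : ι}

theorem Prime.totalDegree_ne_zero (hh : Prime h) : h.totalDegree ≠ 0 := fun h0 => by
  rw [totalDegree_eq_zero_iff_eq_C] at h0
  refine hh.not_isUnit (h0 ▸ IsUnit.map C (IsUnit.mk0 _ fun h1 => hh.ne_zero ?_))
  rw [h0, h1, map_zero]

/-- Every polynomial has a normal direction. -/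
theorem exists_isNormalDirection [Infinite K] (hh : Prime h)
    (hP : ∀ p, aeval x p ∈ P ↔ h ∣ p) : ∃ a j₀, IsNormalDirection x P h a j₀ := by
  have h0 : homogeneousComponent h.totalDegree h ≠ 0 := by
    intro h0
    have h1 : ∃ m ∈ h.support, m.degree = h.totalDegree := by
      obtain ⟨m, hm, hm'⟩ := Finset.exists_mem_eq_sup h.support (support_nonempty.2 hh.ne_zero)
        fun s => s.sum fun _ e => e
      exact ⟨m, hm, hm'.symm⟩
    obtain ⟨m, hm, hmd⟩ := h1
    have h2 := congrArg (coeff m) h0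
    rw [coeff_homogeneousComponent, if_pos hmd, coeff_zero] at h2
    exact mem_support_iff.1 hm h2
  obtain ⟨b, hb⟩ : ∃ b, eval b (homogeneousComponent h.totalDegree h) ≠ 0 := by
    by_contra! hc
    exact h0 (MvPolynomial.funext fun b => by rw [hc, map_zero])
  obtain ⟨j, hj⟩ : ∃ j, b j ≠ 0 := by
    by_contra! hc
    have hb0 : b = 0 := by ext j; exact hc j
    apply hb
    have h3 := eval_smul_homogeneousComponent b 0 h.totalDegree h
    rw [zero_pow hh.totalDegree_ne_zero, zero_mul] at h3
    rwa [hb0, show (0 : ι → K) = fun i => 0 * b i by ext; simp]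
  refine ⟨fun i => (b j)⁻¹ * b i, j, hh, hP, inv_mul_cancel₀ hj, ?_⟩
  rw [eval_smul_homogeneousComponent]
  exact mul_ne_zero (pow_ne_zero _ (inv_ne_zero hj)) hb

/-- The coordinate transversal to the slice is integral over the slice coordinates. -/
theorem IsNormalDirection.isIntegral_coord (hd : IsNormalDirection x P h a j₀) :
    ((Ideal.Quotient.mk P).comp
      (aeval (sliceCoord x a j₀) : MvPolynomial ι K →ₐ[K] R).toRingHom).IsIntegralElem
      (Ideal.Quotient.mk P (x j₀)) := by
  set e := eval a (homogeneousComponent h.totalDegree h) with he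
  have hc := coeff_lineSubst a (X : ι → MvPolynomial ι K) h
  rw [← he] at hc
  have hnd := natDegree_lineSubst_le a (X : ι → MvPolynomial ι K) h
  refine ⟨Polynomial.C (C e⁻¹) * lineSubst a X h, ?_, ?_⟩
  · refine Polynomial.monic_of_natDegree_le_of_coeff_eq_one h.totalDegree
      ((Polynomial.natDegree_C_mul_le _ _).trans hnd) ?_
    rw [Polynomial.coeff_C_mul, hc, algebraMap_eq, ← C_mul, inv_mul_cancel₀ hd.lead, C_1]
  · rw [← Polynomial.hom_eval₂, Polynomial.eval₂_eq_eval_map, Polynomial.map_mul]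
    erw [map_lineSubst]
    rw [Polynomial.eval_mul, eval_lineSubst, map_mul]
    have h1 : (fun j => aeval (sliceCoord x a j₀) (X j : MvPolynomial ι K) +
        algebraMap K R (a j) * x j₀) = x := by
      ext j; rw [aeval_X, sliceCoord, sub_add_cancel]
    rw [h1, Ideal.Quotient.eq_zero_iff_mem.2 ((hd.mem_iff h).2 dvd_rfl), mul_zero]

theorem IsNormalDirection.isIntegral (hd : IsNormalDirection x P h a j₀)
    (hx : (aeval x : MvPolynomial ι K →ₐ[K] R).toRingHom.IsIntegral) :
    ((Ideal.Quotient.mk P).comp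
      (aeval (sliceCoord x a j₀) : MvPolynomial ι K →ₐ[K] R).toRingHom).IsIntegral := by
  set g := (Ideal.Quotient.mk P).comp
      (aeval (sliceCoord x a j₀) : MvPolynomial ι K →ₐ[K] R).toRingHom with hg
  let _ : Algebra (MvPolynomial ι K) (R ⧸ P) := g.toAlgebra
  have hgC : ∀ k : K, g (C k) = Ideal.Quotient.mk P (algebraMap K R k) := fun k => by
    simp [hg]
  have h0 : ∀ p, g p ∈ integralClosure (MvPolynomial ι K) (R ⧸ P) := fun p =>
    Subalgebra.algebraMap_mem _ p
  have hxj : ∀ j, Ideal.Quotient.mk P (x j) ∈ integralClosure (MvPolynomial ι K) (R ⧸ P) := by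
    intro j
    have h1 : Ideal.Quotient.mk P (x j) = g (X j) + g (C (a j)) * Ideal.Quotient.mk P (x j₀) := by
      rw [hgC, ← map_mul]
      simp [hg, sliceCoord]
    rw [h1]
    exact add_mem (h0 _) (mul_mem (h0 _) hd.isIntegral_coord)
  have hxp : ∀ p : MvPolynomial ι K, Ideal.Quotient.mk P (aeval x p) ∈
      integralClosure (MvPolynomial ι K) (R ⧸ P) := by
    intro p
    induction p using MvPolynomial.induction_on with
    | C k => rw [algHom_C, ← hgC]; exact h0 _
    | add p q hp hq => rw [map_add, map_add]; exact add_mem hp hq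
    | mul_X p i hp => rw [map_mul, map_mul, aeval_X]; exact mul_mem hp (hxj i)
  intro r
  obtain ⟨r, rfl⟩ := Ideal.Quotient.mk_surjective r
  obtain ⟨q, hq, hqr⟩ := hx r
  have h2 : IsIntegral (integralClosure (MvPolynomial ι K) (R ⧸ P)) (Ideal.Quotient.mk P r) := by
    let G : MvPolynomial ι K →+* integralClosure (MvPolynomial ι K) (R ⧸ P) :=
      ((Ideal.Quotient.mk P).comp (aeval x : MvPolynomial ι K →ₐ[K] R).toRingHom).codRestrict
        (integralClosure (MvPolynomial ι K) (R ⧸ P)) hxp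
    refine ⟨q.map G, hq.map _, ?_⟩
    rw [Polynomial.eval₂_map]
    have h3 : (algebraMap (integralClosure (MvPolynomial ι K) (R ⧸ P)) (R ⧸ P)).comp G =
        (Ideal.Quotient.mk P).comp (aeval x : MvPolynomial ι K →ₐ[K] R).toRingHom := by
      ext <;> rfl
    rw [h3, ← Polynomial.hom_eval₂, hqr, map_zero]
  exact isIntegral_trans (R := MvPolynomial ι K) _ h2

theorem IsNormalDirection.eq_zero_of_mem [IsDomain R] (hd : IsNormalDirection x P h a j₀)
    (p : MvPolynomial ι K) (hp : aeval (sliceCoord x a j₀) p ∈ P) :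
    aeval (sliceCoord x a j₀) p = 0 := by
  set p' : MvPolynomial ι K := aeval (fun j => X j - C (a j) * X j₀) p with hp'
  have h1 : aeval x p' = aeval (sliceCoord x a j₀) p := by
    rw [hp', ← AlgHom.comp_apply]
    congr 1
    ext j
    simp [sliceCoord]
  have h2 : lineSubst a X p' = Polynomial.C p' := by
    have : lineSubst a X p' = ((Polynomial.CAlgHom (R := K) (A := MvPolynomial ι K)).comp
        (aeval (fun j => X j - C (a j) * X j₀) : MvPolynomial ι K →ₐ[K] MvPolynomial ι K)) p := by
      rw [hp', ← AlgHom.comp_apply]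
      congr 1
      ext j : 1
      simp only [AlgHom.comp_apply, aeval_X, map_sub, map_mul, lineSubst, algHom_C,
        Polynomial.CAlgHom_apply, hd.one, map_one, one_mul, Polynomial.algebraMap_apply,
        algebraMap_eq]
      ring
    exact this
  obtain ⟨q, hq⟩ := (hd.mem_iff p').1 (h1 ▸ hp)
  rw [← h1]
  by_contra h3
  have h4 : p' ≠ 0 := fun h => h3 (by rw [h, map_zero])
  have h5 : lineSubst a X h * lineSubst a X q = Polynomial.C p' := by rw [← map_mul, ← hq, h2]
  have h6 : lineSubst a (X : ι → MvPolynomial ι K) h * lineSubst a X q ≠ 0 := by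
    rw [h5]; simpa using h4
  have h7 := congrArg Polynomial.natDegree h5
  rw [Polynomial.natDegree_mul (left_ne_zero_of_mul h6) (right_ne_zero_of_mul h6),
    Polynomial.natDegree_C] at h7
  have h8 : (lineSubst a (X : ι → MvPolynomial ι K) h).coeff h.totalDegree = 0 :=
    Polynomial.coeff_eq_zero_of_natDegree_lt (by have := hd.prime.totalDegree_ne_zero; omega)
  rw [coeff_lineSubst, algebraMap_eq, C_eq_zero] at h8
  exact hd.lead h8

end NormalDirection

section SepSum

variable {R B B' : Type*} [CommRing R] [CommRing B'] [CommRing B]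

/-- The difference quotient `(f^ψ(φ y) - f^ψ(ψ y)) / (φ y - ψ y)`, written out as a polynomial
expression. -/
noncomputable def sepSum (f : Polynomial R) (y : R) (φ ψ : R →+* B) : B :=
  ∑ k ∈ Finset.range (f.natDegree + 1),
    ψ (f.coeff k) * ∑ i ∈ Finset.range k, φ y ^ i * ψ y ^ (k - 1 - i)

theorem map_sepSum (f : Polynomial R) (y : R) (φ ψ : R →+* B) (g : B →+* B') :
    g (sepSum f y φ ψ) = sepSum f y (g.comp φ) (g.comp ψ) := by
  simp [sepSum]

theorem sepSum_self (f : Polynomial R) (y : R) (φ : R →+* B) :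
    sepSum f y φ φ = φ (f.derivative.eval y) := by
  have h1 : f.derivative.eval y =
      ∑ k ∈ Finset.range (f.natDegree + 1), f.coeff k * (k * y ^ (k - 1)) := by
    rw [Polynomial.derivative_eval, Polynomial.sum_over_range _ (by simp)]
    exact Finset.sum_congr rfl fun _ _ => by ring
  rw [h1, map_sum, sepSum]
  refine Finset.sum_congr rfl fun k _ => ?_
  rw [map_mul, map_mul, _root_.map_natCast, map_pow]
  congr 1
  rw [Finset.sum_congr rfl (g := fun _ => φ y ^ (k - 1)), Finset.sum_const, Finset.card_range,
    nsmul_eq_mul]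
  intro i hi
  have := Finset.mem_range.1 hi
  rw [← pow_add]
  congr 1
  omega

theorem sepSum_mul_sub (f : Polynomial R) (y : R) (φ ψ : R →+* B) :
    sepSum f y φ ψ * (φ y - ψ y) = f.eval₂ ψ (φ y) - ψ (f.eval y) := by
  have h1 : ψ (f.eval y) = f.eval₂ ψ (ψ y) := (Polynomial.eval₂_at_apply ψ y).symm
  rw [h1, Polynomial.eval₂_eq_sum_range, Polynomial.eval₂_eq_sum_range, ← Finset.sum_sub_distrib,
    sepSum, Finset.sum_mul]
  refine Finset.sum_congr rfl fun k _ => ?_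
  rw [mul_assoc, (Commute.all _ _).geom_sum₂_mul, mul_sub]

end SepSum

section Branches

variable {ι K R L : Type*} [Field K] [CommRing R] [Algebra K R] [Field L] [Algebra K L]

/-- The points of `Spec (R ⧸ P)` over `L` with the same coordinates `c` as `σ`. -/
def branches (P : Ideal R) (c : ι → R) (σ : R →ₐ[K] L) : Set (R →ₐ[K] L) :=
  {τ | (∀ r, τ r = 0 ↔ r ∈ P) ∧ ∀ j, τ (c j) = σ (c j)}

variable {P : Ideal R} {c : ι → R} {σ τ : R →ₐ[K] L}

theorem eval₂_eq_zero_of_mem_branches (hτ : τ ∈ branches P c σ)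
    {q : Polynomial (MvPolynomial ι K)} {r : R}
    (hq : q.eval₂ (aeval c : MvPolynomial ι K →ₐ[K] R).toRingHom r ∈ P) :
    q.eval₂ (σ.comp (aeval c : MvPolynomial ι K →ₐ[K] R)).toRingHom (τ r) = 0 := by
  have h := (hτ.1 _).2 hq
  rw [← AlgHom.coe_toRingHom, Polynomial.hom_eval₂] at h
  rw [← h]
  congr 1
  ext p
  · simp
  · simpa using (hτ.2 p).symm

variable {x : ι → R} {h : MvPolynomial ι K} {a : ι → K} {j₀ : ι}

theorem IsNormalDirection.exists_monic (hd : IsNormalDirection x P h a j₀)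
    (hx : (aeval x : MvPolynomial ι K →ₐ[K] R).toRingHom.IsIntegral) (r : R) :
    ∃ q : Polynomial (MvPolynomial ι K), q.Monic ∧
      q.eval₂ (aeval (sliceCoord x a j₀) : MvPolynomial ι K →ₐ[K] R).toRingHom r ∈ P := by
  obtain ⟨q, hq, hqr⟩ := hd.isIntegral hx (Ideal.Quotient.mk P r)
  refine ⟨q, hq, ?_⟩
  rwa [← Polynomial.hom_eval₂, Ideal.Quotient.eq_zero_iff_mem] at hqr

theorem IsNormalDirection.finite_branches [Algebra.FiniteType K R]
    (hd : IsNormalDirection x P h a j₀)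
    (hx : (aeval x : MvPolynomial ι K →ₐ[K] R).toRingHom.IsIntegral) (σ : R →ₐ[K] L) :
    (branches P (sliceCoord x a j₀) σ).Finite := by
  classical
  obtain ⟨s, hs⟩ := Algebra.FiniteType.out (R := K) (A := R)
  choose q hq hqr using hd.exists_monic hx
  let e : (R →ₐ[K] L) → s → L := fun τ r => τ r
  have he : Set.InjOn e (branches P (sliceCoord x a j₀) σ) := by
    intro τ _ τ' _ hττ'
    refine AlgHom.ext_of_adjoin_eq_top hs fun r hr => ?_
    exact congrFun hττ' ⟨r, hr⟩
  refine Set.Finite.of_finite_image ?_ he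
  refine (Set.Finite.pi (t := fun r : s => {b | ((q r).map (σ.comp (aeval (sliceCoord x a j₀) :
    MvPolynomial ι K →ₐ[K] R)).toRingHom).IsRoot b}) fun r => ?_).subset ?_
  · exact Polynomial.finite_setOfPred_isRoot ((hq r).map _).ne_zero
  · rintro _ ⟨τ, hτ, rfl⟩ r _
    rw [Set.mem_ofPred_eq, Polynomial.IsRoot, Polynomial.eval_map]
    exact eval₂_eq_zero_of_mem_branches hτ (hqr r)

theorem sliceCoord_eq_of_mem_branches (hτ : τ ∈ branches P (sliceCoord x a j₀) σ) (j : ι) :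
    τ (x j) = σ (x j) - algebraMap K L (a j) * (σ (x j₀) - τ (x j₀)) := by
  have := hτ.2 j
  simp only [sliceCoord, map_sub, map_mul, AlgHom.commutes] at this
  linear_combination this

theorem IsNormalDirection.sub_ne_zero (hd : IsNormalDirection x P h a j₀)
    (hσ : Function.Injective σ) (hxi : AlgebraicIndependent K x)
    (hτ : τ ∈ branches P (sliceCoord x a j₀) σ) : σ (x j₀) - τ (x j₀) ≠ 0 := by
  intro h0
  have h1 : τ.comp (aeval x) = σ.comp (aeval x : MvPolynomial ι K →ₐ[K] R) := by
    ext j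
    simpa [h0] using sliceCoord_eq_of_mem_branches hτ j
  have h2 := DFunLike.congr_fun h1 h
  simp only [AlgHom.comp_apply] at h2
  rw [(hτ.1 _).2 ((hd.mem_iff h).2 dvd_rfl)] at h2
  have h3 := hσ (h2.symm.trans (map_zero σ).symm)
  exact hd.prime.ne_zero (hxi (h3.trans (map_zero _).symm))

/-- The sum over the branches `τ` of `P` of the logarithmic derivatives of
`σ x_{j₀} - τ x_{j₀}`, weighted by the Lagrange factors at `y`. -/
noncomputable def branchForm (P : Ideal R) (x : ι → R) (a : ι → K) (j₀ : ι) (f : Polynomial R)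
    (y : R) (σ : R →ₐ[K] L) (D : Derivation K L L) : L :=
  (σ (f.derivative.eval y))⁻¹ * ∑ᶠ τ ∈ branches P (sliceCoord x a j₀) σ,
    sepSum f y σ.toRingHom τ.toRingHom *
      (D (σ (x j₀) - τ (x j₀)) / (σ (x j₀) - τ (x j₀)))

end Branches

theorem RingHom.exists_comp_eq_of_injective {R B B' : Type*} [CommRing R] [CommRing B]
    [CommRing B'] (i : B →+* B') (hi : Function.Injective i) (φ : R →+* B')
    (h : ∀ r, ∃ b, i b = φ r) : ∃ ψ : R →+* B, i.comp ψ = φ := by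
  choose ψ hψ using h
  refine ⟨⟨⟨⟨ψ, hi ?_⟩, fun a b => hi ?_⟩, hi ?_, fun a b => hi ?_⟩, RingHom.ext hψ⟩ <;> simp [hψ]

theorem Polynomial.Monic.exists_map_eq_of_isRoot {M L : Type*} [Field M] [Field L] [IsAlgClosed M]
    {q : Polynomial M} (hq : q.Monic) (g : M →+* L) {u : L} (hu : q.eval₂ g u = 0) :
    ∃ b, g b = u := by
  have h1 := (IsAlgClosed.splits q).eq_prod_roots_of_monic hq
  rw [h1, Polynomial.eval₂_multiset_prod, Multiset.prod_eq_zero_iff, Multiset.map_map,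
    Multiset.mem_map] at hu
  obtain ⟨b, _, hb⟩ := hu
  refine ⟨b, ?_⟩
  have hb' : u - g b = 0 := by simpa using hb
  exact (sub_eq_zero.1 hb').symm

section Derivation

variable {ι K M L : Type*} [Fintype ι] [DecidableEq ι] [Field K] [CharZero K] [Field M] [Field L]
  [Algebra K M] [Algebra K L]

/-- The chain rule along an embedding of fields. -/
theorem Derivation.apply_algHom_eq_sum [Algebra (MvPolynomial ι K) M]
    [IsScalarTower K (MvPolynomial ι K) M] [FaithfulSMul (MvPolynomial ι K) M]
    [Algebra.IsAlgebraic (MvPolynomial ι K) M] (D0 : ι → Derivation K M M)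
    (hD0 : ∀ j l, D0 j (algebraMap (MvPolynomial ι K) M (X l)) =
      Pi.single (M := fun _ => M) j 1 l)
    (g : M →ₐ[K] L) (D : Derivation K L L) (u : M) :
    D (g u) = ∑ j, D (g (algebraMap (MvPolynomial ι K) M (X j))) * g (D0 j u) := by
  have _ : CharZero M := charZero_of_injective_algebraMap (algebraMap K M).injective
  let _ : Algebra M L := g.toRingHom.toAlgebra
  have _ : IsScalarTower K M L := IsScalarTower.of_algebraMap_eq fun k => (g.commutes k).symm
  let _ : Algebra (MvPolynomial ι K) L :=
    ((algebraMap M L).comp (algebraMap (MvPolynomial ι K) M)).toAlgebra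
  have _ : IsScalarTower (MvPolynomial ι K) M L := IsScalarTower.of_algebraMap_eq fun k => rfl
  have _ : IsScalarTower K (MvPolynomial ι K) L := IsScalarTower.of_algebraMap_eq fun k => by
    rw [IsScalarTower.algebraMap_apply K M L, IsScalarTower.algebraMap_apply K (MvPolynomial ι K) M]
    rfl
  let D1 : Derivation K M L := D.compAlgebraMap M
  let D2 : Derivation K M L := ∑ j, D (g (algebraMap (MvPolynomial ι K) M (X j))) •
    (Algebra.linearMap M L).compDer (D0 j)
  have hD2 : ∀ v, D2 v = ∑ j, D (g (algebraMap (MvPolynomial ι K) M (X j))) * g (D0 j v) := by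
    intro v
    change Derivation.coeFnAddMonoidHom (∑ j, D (g (algebraMap (MvPolynomial ι K) M (X j))) •
      (Algebra.linearMap M L).compDer (D0 j)) v = _
    rw [map_sum, Finset.sum_apply]
    rfl
  suffices h : D1 = D2 by
    rw [← hD2, ← h]; rfl
  refine Derivation.eq_of_forall_algebraMap (A := MvPolynomial ι K) D1 D2 fun p => ?_
  have h3 : D1.compAlgebraMap (MvPolynomial ι K) = D2.compAlgebraMap (MvPolynomial ι K) := by
    ext l
    change D (g (algebraMap (MvPolynomial ι K) M (X l))) = D2
        (algebraMap (MvPolynomial ι K) M (X l))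
    rw [hD2, Finset.sum_eq_single l]
    · rw [hD0, Pi.single_eq_same, map_one, mul_one]
    · intro b _ hb
      rw [hD0, Pi.single_eq_of_ne (Ne.symm hb), map_zero, mul_zero]
    · simp
  exact DFunLike.congr_fun h3 p

end Derivation

section Descent

variable {ι K R M L : Type*} [Field K] [CommRing R] [Algebra K R] [Field M] [Algebra K M]
  [Field L] [Algebra K L] {P : Ideal R} {x : ι → R} {h : MvPolynomial ι K} {a : ι → K} {j₀ : ι}

theorem IsNormalDirection.branches_comp [IsAlgClosed M] (hd : IsNormalDirection x P h a j₀)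
    (hx : (aeval x : MvPolynomial ι K →ₐ[K] R).toRingHom.IsIntegral) (σ : R →ₐ[K] M)
    (g : M →ₐ[K] L) :
    branches P (sliceCoord x a j₀) (g.comp σ) =
      (fun τ => g.comp τ) '' branches P (sliceCoord x a j₀) σ := by
  apply Set.Subset.antisymm
  · intro τ hτ
    obtain ⟨ψ, hψ⟩ := RingHom.exists_comp_eq_of_injective g.toRingHom g.toRingHom.injective
      τ.toRingHom fun r => by
        obtain ⟨q, hq, hqr⟩ := hd.exists_monic hx r
        have h1 := eval₂_eq_zero_of_mem_branches hτ hqr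
        refine (hq.map (σ.comp (aeval (sliceCoord x a j₀) :
          MvPolynomial ι K →ₐ[K] R)).toRingHom).exists_map_eq_of_isRoot g.toRingHom ?_
        rw [Polynomial.eval₂_map]
        exact h1
    have hψ' : ∀ r, g (ψ r) = τ r := fun r => RingHom.congr_fun hψ r
    let ψ' : R →ₐ[K] M := ⟨ψ, fun k => g.toRingHom.injective (by
      change g (ψ _) = g _
      rw [hψ', AlgHom.commutes, AlgHom.commutes])⟩
    have hψ'' : ∀ r, g (ψ' r) = τ r := hψ'
    refine ⟨ψ', ⟨fun r => ?_, fun j => g.toRingHom.injective ?_⟩, AlgHom.ext hψ'⟩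
    · rw [← hτ.1, ← hψ'', map_eq_zero_iff g g.toRingHom.injective]
    · change g _ = g _
      rw [hψ'', hτ.2]
      rfl
  · rintro _ ⟨τ, hτ, rfl⟩
    refine ⟨fun r => ?_, fun j => congrArg g (hτ.2 j)⟩
    rw [AlgHom.comp_apply, map_eq_zero_iff g g.toRingHom.injective, hτ.1]

theorem IsNormalDirection.branchForm_comp [Fintype ι] [IsAlgClosed M] [Algebra.FiniteType K R]
    (hd : IsNormalDirection x P h a j₀)
    (hx : (aeval x : MvPolynomial ι K →ₐ[K] R).toRingHom.IsIntegral) (σ : R →ₐ[K] M)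
    (g : M →ₐ[K] L) (f : Polynomial R) (y : R) (D : Derivation K L L) (D0 : ι → Derivation K M M)
    (e : ι → L) (hD : ∀ u, D (g u) = ∑ j, e j * g (D0 j u)) :
    branchForm P x a j₀ f y (g.comp σ) D = ∑ j, e j * g (branchForm P x a j₀ f y σ (D0 j)) := by
  have hfin := hd.finite_branches hx σ
  have hinj : Function.Injective fun τ : R →ₐ[K] M => g.comp τ := fun τ τ' hτ =>
    AlgHom.ext fun r => g.toRingHom.injective (DFunLike.congr_fun hτ r)
  unfold branchForm
  rw [hd.branches_comp hx, finsum_mem_image hinj.injOn, finsum_mem_eq_finite_toFinset_sum _ hfin]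
  simp only [finsum_mem_eq_finite_toFinset_sum _ hfin, map_mul, map_sum, map_inv₀, Finset.mul_sum]
  rw [Finset.sum_comm]
  refine Finset.sum_congr rfl fun τ _ => ?_
  have h1 : sepSum f y (g.comp σ).toRingHom (g.comp τ).toRingHom =
      g (sepSum f y σ.toRingHom τ.toRingHom) :=
    (map_sepSum f y σ.toRingHom τ.toRingHom g.toRingHom).symm
  simp only [AlgHom.comp_apply]
  rw [h1, ← map_sub, hD, Finset.sum_div, Finset.mul_sum, Finset.mul_sum]
  refine Finset.sum_congr rfl fun j _ => ?_
  rw [map_div₀]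
  ring

/-- The branch forms descend to rational differential forms on `R`. -/
theorem IsNormalDirection.exists_descent [Fintype ι] [CharZero K] [IsDomain R]
    [Algebra.FiniteType K R] (F : Type*) [Field F] [Algebra R F] [IsFractionRing R F]
    [Algebra K F] [IsScalarTower K R F]
    (hd : IsNormalDirection x P h a j₀) (hxi : AlgebraicIndependent K x)
    (hx : (aeval x : MvPolynomial ι K →ₐ[K] R).toRingHom.IsIntegral) (f : Polynomial R) (y : R) :
    ∃ w : ι → F, ∀ {L : Type*} [Field L] [IsAlgClosed L] [Algebra K L] (σ : F →ₐ[K] L)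
      (D : Derivation K L L),
      branchForm P x a j₀ f y (σ.comp (IsScalarTower.toAlgHom K R F)) D =
        ∑ j, D (σ (algebraMap R F (x j))) * σ (w j) := by
  classical
  have _ : CharZero F := charZero_of_injective_algebraMap (algebraMap K F).injective
  let M := AlgebraicClosure F
  let _ : Algebra (MvPolynomial ι K) M :=
    ((algebraMap F M).comp ((algebraMap R F).comp (aeval x).toRingHom)).toAlgebra
  have _ : IsScalarTower K (MvPolynomial ι K) M := IsScalarTower.of_algebraMap_eq fun k => by
    change _ = algebraMap F M (algebraMap R F (aeval x (C k)))
    rw [algHom_C, ← IsScalarTower.algebraMap_apply K R F, ← IsScalarTower.algebraMap_apply K F M]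
  have hinj : Function.Injective (algebraMap (MvPolynomial ι K) M) :=
    (algebraMap F M).injective.comp ((IsFractionRing.injective R F).comp hxi)
  have _ : FaithfulSMul (MvPolynomial ι K) M := (faithfulSMul_iff_algebraMap_injective _ _).2 hinj
  have _ : Algebra.IsAlgebraic (MvPolynomial ι K) M := by
    let _ : Algebra (MvPolynomial ι K) R := (aeval x).toRingHom.toAlgebra
    have _ : IsScalarTower (MvPolynomial ι K) R M := IsScalarTower.of_algebraMap_eq fun p => rfl
    have _ : Algebra.IsIntegral (MvPolynomial ι K) R := ⟨hx⟩
    have _ : Algebra.IsAlgebraic R M :=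
        (IsFractionRing.comap_isAlgebraic_iff (K := F)).2 inferInstance
    exact Algebra.IsAlgebraic.trans (MvPolynomial ι K) R M
  have hX : ∀ j, algebraMap (MvPolynomial ι K) M (X j) = algebraMap F M (algebraMap R F (x j)) :=
    fun j => by
      change algebraMap F M (algebraMap R F (aeval x (X j))) = _
      rw [aeval_X]
  have hxM : AlgebraicIndependent K fun j => algebraMap (MvPolynomial ι K) M (X j) := by
    have h1 := hxi.map' (f := (IsScalarTower.toAlgHom K F M).comp (IsScalarTower.toAlgHom K R F))
      ((algebraMap F M).injective.comp (IsFractionRing.injective R F))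
    convert h1 using 1
    exact funext hX
  choose D0 hD0 using fun j => hxM.exists_derivation (Pi.single (M := fun _ => M) j 1)
  let σ0 : R →ₐ[K] M := (IsScalarTower.toAlgHom K F M).comp (IsScalarTower.toAlgHom K R F)
  have hmem : ∀ j, branchForm P x a j₀ f y σ0 (D0 j) ∈ Set.range (algebraMap F M) := by
    intro j
    have _ : IsGalois F M := ⟨⟩
    rw [InfiniteGalois.mem_range_algebraMap_iff_fixed]
    intro g
    let g' : M →ₐ[K] M := (g : M →ₐ[F] M).restrictScalars K
    have h1 := hd.branchForm_comp hx σ0 g' f y (D0 j) D0 _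
      (Derivation.apply_algHom_eq_sum D0 hD0 g' (D0 j))
    have h2 : g'.comp σ0 = σ0 := AlgHom.ext fun r => g.commutes _
    rw [h2, Finset.sum_eq_single j] at h1
    · have h3 : g' (algebraMap (MvPolynomial ι K) M (X j)) =
          algebraMap (MvPolynomial ι K) M (X j) := by
        rw [hX]; exact g.commutes _
      rw [h3, hD0, Pi.single_eq_same, one_mul] at h1
      exact h1.symm
    · intro b _ hb
      have h3 : g' (algebraMap (MvPolynomial ι K) M (X b)) =
          algebraMap (MvPolynomial ι K) M (X b) := by
        rw [hX]; exact g.commutes _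
      rw [h3, hD0, Pi.single_eq_of_ne hb, zero_mul]
    · simp
  choose w hw using hmem
  refine ⟨w, fun {L} _ _ _ σ D => ?_⟩
  let _ : Algebra F L := σ.toRingHom.toAlgebra
  let g : M →ₐ[F] L := IsAlgClosed.lift
  have _ : IsScalarTower K F L := IsScalarTower.of_algebraMap_eq fun k => (σ.commutes k).symm
  let g' : M →ₐ[K] L := g.restrictScalars K
  have h1 := hd.branchForm_comp hx σ0 g' f y D D0 _
      (Derivation.apply_algHom_eq_sum D0 hD0 g' D)
  have hg : ∀ u, g' (algebraMap F M u) = σ u := fun u => g.commutes u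
  have h2 : g'.comp σ0 = σ.comp (IsScalarTower.toAlgHom K R F) := AlgHom.ext fun r => hg _
  rw [h2] at h1
  rw [h1]
  refine Finset.sum_congr rfl fun j _ => ?_
  rw [← hw, hX, hg, hg]

end Descent

theorem ValuationSubring.residue_eq_zero_iff {L : Type*} [Field L] (W : ValuationSubring L)
    (u : W) : IsLocalRing.residue W u = 0 ↔ W.valuation (u : L) < 1 := by
  rw [IsLocalRing.residue_eq_zero_iff, W.valuation_lt_one_iff]

section Local

variable {ι K R L : Type*} [Field K] [CommRing R] [Algebra K R] [Field L] [Algebra K L]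
  {P : Ideal R} {x : ι → R} {h : MvPolynomial ι K} {a : ι → K} {j₀ : ι} {σ τ : R →ₐ[K] L}
  {W : ValuationSubring L}

theorem IsNormalDirection.valuation_le_one_of_mem_branches (hd : IsNormalDirection x P h a j₀)
    (hx : (aeval x : MvPolynomial ι K →ₐ[K] R).toRingHom.IsIntegral)
    (hσ : ∀ r, W.valuation (σ r) ≤ 1) (hτ : τ ∈ branches P (sliceCoord x a j₀) σ) (r : R) :
    W.valuation (τ r) ≤ 1 := by
  let _ : Algebra (MvPolynomial ι K) L :=
    (σ.comp (aeval (sliceCoord x a j₀) : MvPolynomial ι K →ₐ[K] R)).toRingHom.toAlgebra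
  obtain ⟨q, hq, hqr⟩ := hd.exists_monic hx r
  rw [W.valuation_le_one_iff]
  refine ValuationSubring.mem_of_isIntegral (T := MvPolynomial ι K) (fun p => ?_)
    ⟨q, hq, eval₂_eq_zero_of_mem_branches hτ hqr⟩
  rw [← W.valuation_le_one_iff]
  exact hσ _

/-- A ring homomorphism with values in a valuation ring. -/
def ValuationSubring.restrictHom (W : ValuationSubring L) (σ : R →ₐ[K] L)
    (hσ : ∀ r, W.valuation (σ r) ≤ 1) : R →+* W :=
  σ.toRingHom.codRestrict W fun r => (W.valuation_le_one_iff _).1 (hσ r)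

theorem ValuationSubring.residue_restrictHom_eq_iff (hσ : ∀ r, W.valuation (σ r) ≤ 1)
    (hτ : ∀ r, W.valuation (τ r) ≤ 1) (r : R) :
    IsLocalRing.residue W (W.restrictHom σ hσ r) = IsLocalRing.residue W (W.restrictHom τ hτ r) ↔
      W.valuation (σ r - τ r) < 1 := by
  rw [← sub_eq_zero, ← map_sub, ValuationSubring.residue_eq_zero_iff]
  rfl

theorem ValuationSubring.valuation_restrictHom_sepSum (hσ : ∀ r, W.valuation (σ r) ≤ 1)
    (hτ : ∀ r, W.valuation (τ r) ≤ 1) (f : Polynomial R) (y : R) :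
    ((sepSum f y (W.restrictHom σ hσ) (W.restrictHom τ hτ) : W) : L) =
      sepSum f y σ.toRingHom τ.toRingHom :=
  map_sepSum f y _ _ W.subtype

/-- The branches which are not congruent to `σ` do not contribute to the residue. -/
theorem IsNormalDirection.valuation_term_lt_one [IsDomain R] (hd : IsNormalDirection x P h a j₀)
    (hx : (aeval x : MvPolynomial ι K →ₐ[K] R).toRingHom.IsIntegral)
    (hxi : AlgebraicIndependent K x) (hσi : Function.Injective σ)
    (f : Polynomial (MvPolynomial ι K)) {y β : R}
    (hy : (f.map (aeval x).toRingHom).eval y = 0)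
    (hβ : ∀ r, ∃ q : Polynomial (MvPolynomial ι K),
      β * r = (q.map (aeval x : MvPolynomial ι K →ₐ[K] R).toRingHom).eval y)
    (hσ : ∀ r, W.valuation (σ r) ≤ 1) (hσβ : W.valuation (σ β) = 1)
    (D : Derivation K L L) {π : L} (hlog : ∀ u, u ≠ 0 → W.valuation (π * (D u / u)) ≤ 1)
    (hD : ∀ u, W.valuation u ≤ 1 → W.valuation (π * D u) < 1)
    (hτ : τ ∈ branches P (sliceCoord x a j₀) σ) (hne : ¬ ∀ r, W.valuation (σ r - τ r) < 1) :
    W.valuation (π * (sepSum (f.map (aeval x).toRingHom) y σ.toRingHom τ.toRingHom *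
      (D (σ (x j₀) - τ (x j₀)) / (σ (x j₀) - τ (x j₀))))) < 1 := by
  have hτ1 := hd.valuation_le_one_of_mem_branches hx hσ hτ
  set ρ := σ (x j₀) - τ (x j₀) with hρ
  have hρ0 : ρ ≠ 0 := hd.sub_ne_zero hσi hxi hτ
  have hρ1 : W.valuation ρ ≤ 1 := W.valuation.map_sub_le (hσ _) (hτ1 _)
  set s := sepSum (f.map (aeval x).toRingHom) y σ.toRingHom τ.toRingHom with hs
  have hs' := ValuationSubring.valuation_restrictHom_sepSum hσ hτ1
    (f.map (aeval x).toRingHom) y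
  rw [← hs] at hs'
  have hs1 : W.valuation s ≤ 1 := by rw [← hs']; exact W.valuation_le_one _
  rcases hρ1.lt_or_eq with hlt | heq
  · have hs2 : W.valuation s < 1 := by
      set φ := (IsLocalRing.residue W).comp (W.restrictHom σ hσ) with hφ
      set ψ := (IsLocalRing.residue W).comp (W.restrictHom τ hτ1) with hψ
      have hφψ : ∀ r, φ r = ψ r ↔ W.valuation (σ r - τ r) < 1 :=
        ValuationSubring.residue_restrictHom_eq_iff hσ hτ1
      have hA : φ.comp (aeval x : MvPolynomial ι K →ₐ[K] R).toRingHom =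
          ψ.comp (aeval x : MvPolynomial ι K →ₐ[K] R).toRingHom := by
        ext j
        · simp only [RingHom.comp_apply, AlgHom.toRingHom_eq_coe, RingHom.coe_coe, algHom_C, hφψ,
            AlgHom.commutes, sub_self, map_zero, zero_lt_one]
        · simp only [RingHom.comp_apply, AlgHom.toRingHom_eq_coe, RingHom.coe_coe, aeval_X]
          rw [hφψ, sliceCoord_eq_of_mem_branches hτ, sub_sub_cancel, ← AlgHom.commutes σ, map_mul]
          exact (mul_le_of_le_one_left' (hσ _)).trans_lt hlt
      have hpoly : ∀ q : Polynomial (MvPolynomial ι K), φ y = ψ y →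
          φ ((q.map (aeval x : MvPolynomial ι K →ₐ[K] R).toRingHom).eval y) =
          ψ ((q.map (aeval x : MvPolynomial ι K →ₐ[K] R).toRingHom).eval y) := by
        intro q hyy
        rw [← Polynomial.eval₂_eq_eval_map, Polynomial.hom_eval₂, Polynomial.hom_eval₂, hA, hyy]
      have hyne : φ y ≠ ψ y := by
        intro hyy
        refine hne fun r => (hφψ r).1 ?_
        have hβ1 : φ β = ψ β := by
          obtain ⟨q, hq⟩ := hβ 1
          rw [mul_one] at hq
          rw [hq]; exact hpoly q hyy
        have hβ0 : φ β ≠ 0 := by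
          rw [hφ, RingHom.comp_apply, Ne, W.residue_eq_zero_iff]
          exact hσβ.not_lt
        obtain ⟨q, hq⟩ := hβ r
        have := hpoly q hyy
        rw [← hq, map_mul, map_mul, ← hβ1] at this
        exact mul_left_cancel₀ hβ0 this
      rw [← hs', ← W.residue_eq_zero_iff, map_sepSum]
      have h1 := sepSum_mul_sub (f.map (aeval x).toRingHom) y φ ψ
      rw [hy, map_zero, sub_zero, Polynomial.eval₂_map, ← hA, ← Polynomial.eval₂_map,
        Polynomial.eval₂_at_apply, hy, map_zero] at h1
      exact (mul_eq_zero.1 h1).resolve_right (sub_ne_zero_of_ne hyne)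
    rw [mul_left_comm, map_mul]
    exact (mul_le_of_le_one_right' (hlog ρ hρ0)).trans_lt hs2
  · have h1 : π * (s * (D ρ / ρ)) = s * ((π * D ρ) / ρ) := by ring
    rw [h1, map_mul, map_div₀, heq, div_one]
    exact (mul_le_of_le_one_left' hs1).trans_lt (hD ρ hρ1)

theorem Valuation.finset_sum_lt_one {α : Type*} (s : Finset α) (F : α → L)
    (hF : ∀ i ∈ s, W.valuation (F i) < 1) : W.valuation (∑ i ∈ s, F i) < 1 :=
  Valuation.map_sum_lt _ one_ne_zero hF

/-- The branch form of `P` has no pole at a place whose centre does not contain `P`. -/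
theorem IsNormalDirection.valuation_branchForm_lt_one [IsDomain R] [Algebra.FiniteType K R]
    (hd : IsNormalDirection x P h a j₀)
    (hx : (aeval x : MvPolynomial ι K →ₐ[K] R).toRingHom.IsIntegral)
    (hxi : AlgebraicIndependent K x) (hσi : Function.Injective σ)
    (f : Polynomial (MvPolynomial ι K)) {y β : R}
    (hy : (f.map (aeval x).toRingHom).eval y = 0)
    (hβ : ∀ r, ∃ q : Polynomial (MvPolynomial ι K),
      β * r = (q.map (aeval x : MvPolynomial ι K →ₐ[K] R).toRingHom).eval y)
    (hσ : ∀ r, W.valuation (σ r) ≤ 1) (hσβ : W.valuation (σ β) = 1)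
    (hσy : W.valuation (σ ((f.map (aeval x).toRingHom).derivative.eval y)) = 1)
    (D : Derivation K L L) {π : L} (hlog : ∀ u, u ≠ 0 → W.valuation (π * (D u / u)) ≤ 1)
    (hD : ∀ u, W.valuation u ≤ 1 → W.valuation (π * D u) < 1)
    (hP : ∃ r ∈ P, W.valuation (σ r) = 1) :
    W.valuation (π * branchForm P x a j₀ (f.map (aeval x).toRingHom) y σ D) < 1 := by
  rw [branchForm, mul_left_comm, map_mul, map_inv₀, hσy, inv_one, one_mul,
    finsum_mem_eq_finite_toFinset_sum _ (hd.finite_branches hx σ), Finset.mul_sum]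
  refine Valuation.finset_sum_lt_one _ _ fun τ hτ => ?_
  rw [Set.Finite.mem_toFinset] at hτ
  refine hd.valuation_term_lt_one hx hxi hσi f hy hβ hσ hσβ D hlog hD hτ fun hne => ?_
  obtain ⟨r, hr, hr1⟩ := hP
  have := hne r
  rw [(hτ.1 r).2 hr, sub_zero, hr1] at this
  exact this.ne rfl

theorem derivative_lineSubst {B : Type*} [CommRing B] [Algebra K B] (a : ι → K) (c : ι → B)
    (p : MvPolynomial ι K) :
    (lineSubst a c p).derivative = lineSubst a c (mkDerivation K (fun j => C (a j)) p) := by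
  induction p using MvPolynomial.induction_on with
  | C k =>
    have h1 : lineSubst a c (C k) = Polynomial.C (algebraMap K B k) := by
      rw [lineSubst, algHom_C]; rfl
    rw [h1, Polynomial.derivative_C, derivation_C, map_zero]
  | add p q hp hq => rw [map_add, map_add, map_add, map_add, hp, hq]
  | mul_X p i hp =>
    have h1 : lineSubst a c (C (a i)) = Polynomial.C (algebraMap K B (a i)) := by
      rw [lineSubst, algHom_C]; rfl
    rw [map_mul, Polynomial.derivative_mul, hp, Derivation.leibniz, mkDerivation_X, map_add,
      smul_eq_mul, smul_eq_mul, map_mul, map_mul, h1]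
    have h2 : (lineSubst a c (X i)).derivative = Polynomial.C (algebraMap K B (a i)) := by
      simp [lineSubst]
    rw [h2]
    ring

theorem IsNormalDirection.not_dvd [CharZero K] (hd : IsNormalDirection x P h a j₀) :
    ¬ h ∣ mkDerivation K (fun j => C (a j)) h := by
  intro hdvd
  have h1 := map_dvd (lineSubst a (X : ι → MvPolynomial ι K)) hdvd
  rw [← derivative_lineSubst] at h1
  have h2 : (lineSubst a (X : ι → MvPolynomial ι K) h).natDegree ≠ 0 := by
    intro h0
    have h8 : (lineSubst a (X : ι → MvPolynomial ι K) h).coeff h.totalDegree = 0 :=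
      Polynomial.coeff_eq_zero_of_natDegree_lt (by have := hd.prime.totalDegree_ne_zero; omega)
    rw [coeff_lineSubst, algebraMap_eq, C_eq_zero] at h8
    exact hd.lead h8
  exact h2 (Polynomial.derivative_eq_zero.1
    (Polynomial.eq_zero_of_dvd_of_natDegree_lt h1 (Polynomial.natDegree_derivative_lt h2)))

theorem IsNormalDirection.valuation_sub_eq [CharZero K] (hd : IsNormalDirection x P h a j₀)
    (hσP : ∀ r, W.valuation (σ r) ≤ 1 ∧ (W.valuation (σ r) < 1 ↔ r ∈ P))
    (hτ : τ ∈ branches P (sliceCoord x a j₀) σ)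
    (hlt : W.valuation (σ (x j₀) - τ (x j₀)) < 1) :
    W.valuation (σ (x j₀) - τ (x j₀)) = W.valuation (σ (aeval x h)) := by
  set ρ := σ (x j₀) - τ (x j₀) with hρ
  have hσ := fun r => (hσP r).1
  set σ' := W.restrictHom σ hσ with hσ'
  let ρ' : W := ⟨ρ, (W.valuation_le_one_iff _).1 hlt.le⟩
  set Q := (lineSubst a x h).map σ' with hQ
  have hQ0 : Q.coeff 0 = σ' (aeval x h) := by
    rw [hQ, Polynomial.coeff_map, Polynomial.coeff_zero_eq_eval_zero, eval_lineSubst]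
    simp
  have hQ1 : Q.coeff 1 = σ' (aeval x (mkDerivation K (fun j => C (a j)) h)) := by
    have h1 : (lineSubst a x h).coeff 1 = (lineSubst a x h).derivative.coeff 0 := by
      rw [Polynomial.coeff_derivative]; simp
    rw [hQ, Polynomial.coeff_map, h1, derivative_lineSubst, Polynomial.coeff_zero_eq_eval_zero,
      eval_lineSubst]
    simp
  have hev : Q.eval (-ρ') = 0 := by
    apply Subtype.val_injective
    have h1 : (W.subtype (Q.eval (-ρ')) : L) = (lineSubst a (fun j => σ (x j)) h).eval (-ρ) := by
      rw [← map_lineSubst, ← Polynomial.eval_map_apply, hQ, Polynomial.map_map]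
      rfl
    change W.subtype (Q.eval (-ρ')) = 0
    rw [h1, eval_lineSubst]
    have h2 : (fun j => σ (x j) + algebraMap K L (a j) * -ρ) = fun j => τ (x j) := by
      ext j
      rw [sliceCoord_eq_of_mem_branches hτ]
      ring
    have h3 : aeval (fun j => τ (x j)) h = τ (aeval x h) := by
      rw [← AlgHom.comp_apply]
      congr 1
      ext j; simp
    rw [h2, h3, (hτ.1 _).2 ((hd.mem_iff h).2 dvd_rfl)]
  rw [← Polynomial.divX_mul_X_add Q, ← Polynomial.divX_mul_X_add Q.divX, Polynomial.coeff_divX,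
    hQ0, hQ1] at hev
  simp only [Polynomial.eval_add, Polynomial.eval_mul, Polynomial.eval_X, Polynomial.eval_C] at hev
  set w := Q.divX.divX.eval (-ρ') with hw
  have hu : W.valuation (σ (aeval x (mkDerivation K (fun j => C (a j)) h))) = 1 :=
    ((hσP _).1.lt_or_eq).resolve_left fun hl =>
      hd.not_dvd ((hd.mem_iff _).1 ((hσP _).2.1 hl))
  have h4 : σ (aeval x h) =
      ρ * (σ (aeval x (mkDerivation K (fun j => C (a j)) h)) - ρ * (w : L)) := by
    have h5 := congrArg W.subtype hev
    simp only [map_add, map_mul, map_neg, map_zero] at h5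
    change ((w : L) * -ρ + σ _) * -ρ + σ _ = 0 at h5
    linear_combination h5
  have h6 : W.valuation (ρ * (w : L)) < 1 := by
    rw [map_mul]
    exact (mul_le_of_le_one_right' (W.valuation_le_one w)).trans_lt hlt
  have h7 : W.valuation (σ (aeval x (mkDerivation K (fun j => C (a j)) h)) - ρ * (w : L)) = 1 := by
    rw [← hu]
    exact Valuation.map_sub_eq_of_lt_left _ (hu.symm ▸ h6)
  rw [h4, map_mul, h7, mul_one]

/-- The ring of elements integral over the slice coordinates. -/
theorem IsNormalDirection.exists_mem_branches [IsDomain R] [IsAlgClosed L]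
    (hd : IsNormalDirection x P h a j₀)
    (hx : (aeval x : MvPolynomial ι K →ₐ[K] R).toRingHom.IsIntegral)
    (hσP : ∀ r, W.valuation (σ r) ≤ 1 ∧ (W.valuation (σ r) < 1 ↔ r ∈ P)) :
    ∃ τ₀ ∈ branches P (sliceCoord x a j₀) σ, (∀ r, W.valuation (σ r - τ₀ r) < 1) ∧
      ∀ τ ∈ branches P (sliceCoord x a j₀) σ, (∀ r, W.valuation (σ r - τ r) < 1) → τ = τ₀ := by
  have hσ := fun r => (hσP r).1
  let G : MvPolynomial ι K →ₐ[K] L := σ.comp (aeval (sliceCoord x a j₀))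
  let A0 := G.range
  let B0 := integralClosure A0 L
  have hBW : ∀ b : B0, W.valuation (b : L) ≤ 1 := fun b => by
    rw [W.valuation_le_one_iff]
    refine ValuationSubring.mem_of_isIntegral (T := A0) ?_ b.2
    rintro ⟨_, p, rfl⟩
    rw [← W.valuation_le_one_iff]
    exact hσ _
  let i : B0 →+* W := (algebraMap B0 L).codRestrict W fun b => (W.valuation_le_one_iff _).1 (hBW b)
  let j : B0 →+* IsLocalRing.ResidueField W := (IsLocalRing.residue W).comp i
  have hj0 : ∀ b, j b = 0 ↔ W.valuation (b : L) < 1 := fun b => W.residue_eq_zero_iff (i b)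
  have hj : Function.Injective j := by
    rw [RingHom.injective_iff_ker_eq_bot]
    refine Ideal.eq_bot_of_comap_eq_bot (R := A0) ?_
    rw [eq_bot_iff]
    rintro ⟨_, p, rfl⟩ hp
    rw [Ideal.mem_comap, RingHom.mem_ker, hj0] at hp
    have h1 : aeval (sliceCoord x a j₀) p ∈ P := (hσP _).2.1 hp
    rw [Ideal.mem_bot]
    apply Subtype.ext
    change σ (aeval (sliceCoord x a j₀) p) = 0
    rw [hd.eq_zero_of_mem p h1, map_zero]
  set σ' := W.restrictHom σ hσ with hσ'
  have hj' : ∀ b r, j b = IsLocalRing.residue W (σ' r) ↔ W.valuation (σ r - b) < 1 := by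
    intro b r
    rw [eq_comm, ← sub_eq_zero]
    change IsLocalRing.residue W (σ' r) - IsLocalRing.residue W (i b) = 0 ↔ _
    rw [← map_sub, W.residue_eq_zero_iff]
    rfl
  have hIntg : ∀ {q : Polynomial (MvPolynomial ι K)} {u : L}, q.Monic →
      q.eval₂ G.toRingHom u = 0 → u ∈ B0 := by
    intro q u hq hqu
    refine ⟨q.map (G.toRingHom.codRestrict A0 fun p => ⟨p, rfl⟩), hq.map _, ?_⟩
    rw [Polynomial.eval₂_map]
    exact hqu
  have hexist : ∀ r, ∃ b, j b = ((IsLocalRing.residue W).comp σ') r := by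
    intro r
    obtain ⟨q, hq, hqr⟩ := hd.exists_monic hx r
    have h1 : W.valuation ((q.map G.toRingHom).eval (σ r)) < 1 := by
      have h2 := (hσP _).2.2 hqr
      rw [← AlgHom.coe_toRingHom, Polynomial.hom_eval₂] at h2
      rw [Polynomial.eval_map]
      have h3 : G.toRingHom = σ.toRingHom.comp
          (aeval (sliceCoord x a j₀) : MvPolynomial ι K →ₐ[K] R).toRingHom := rfl
      rw [h3]
      exact h2
    rw [(IsAlgClosed.splits _).eval_eq_prod_roots_of_monic (hq.map _)] at h1
    by_contra! hcon
    refine h1.ne ?_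
    rw [map_multiset_prod, Multiset.map_map]
    refine Multiset.prod_eq_one fun v hv => ?_
    obtain ⟨b, hb, rfl⟩ := Multiset.mem_map.1 hv
    have hbB : b ∈ B0 := hIntg hq (by
      have := (Polynomial.mem_roots'.1 hb).2
      rwa [Polynomial.IsRoot, Polynomial.eval_map] at this)
    have h4 : ¬ W.valuation (σ r - b) < 1 := fun hlt =>
      hcon ⟨b, hbB⟩ ((hj' ⟨b, hbB⟩ r).2 hlt)
    exact le_antisymm (W.valuation.map_sub_le (hσ r) (hBW ⟨b, hbB⟩)) (not_lt.1 h4)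
  obtain ⟨ψ, hψ⟩ := RingHom.exists_comp_eq_of_injective j hj _ hexist
  have hψ1 : ∀ r, j (ψ r) = IsLocalRing.residue W (σ' r) := RingHom.congr_fun hψ
  have hψ2 : ∀ (r) (b : B0), W.valuation (σ r - b) < 1 → (ψ r : L) = b := fun r b hb =>
    congrArg Subtype.val (hj ((hψ1 r).trans ((hj' b r).2 hb).symm))
  let τ₀ : R →ₐ[K] L := ⟨(algebraMap B0 L).comp ψ, fun k => by
    refine hψ2 _ ⟨algebraMap K L k, ?_⟩ ?_
    · exact hIntg (Polynomial.monic_X_sub_C (C k)) (by simp [G])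
    · simp⟩
  have hτ₀ : ∀ r, τ₀ r = ψ r := fun _ => rfl
  refine ⟨τ₀, ⟨fun r => ?_, fun l => ?_⟩, fun r => ?_, fun τ hτ hττ => ?_⟩
  · rw [hτ₀, ← (hσP r).2]
    refine ⟨fun h0 => ?_, fun hlt => hψ2 r 0 (by simpa using hlt)⟩
    have := (hj' _ _).1 (hψ1 r)
    rwa [h0, sub_zero] at this
  · refine hψ2 _ ⟨σ (sliceCoord x a j₀ l), ?_⟩ ?_
    · exact hIntg (Polynomial.monic_X_sub_C (X l)) (by simp [G])
    · simp
  · exact (hj' _ _).1 (hψ1 r)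
  · ext r
    obtain ⟨q, hq, hqr⟩ := hd.exists_monic hx r
    exact (hψ2 r ⟨τ r, hIntg hq (eval₂_eq_zero_of_mem_branches hτ hqr)⟩ (hττ r)).symm

/-- The branch form of `P` has residue one along `P`. -/
theorem IsNormalDirection.valuation_branchForm_sub_lt_one [CharZero K] [IsDomain R]
    [Algebra.FiniteType K R] [IsAlgClosed L] (hd : IsNormalDirection x P h a j₀)
    (hx : (aeval x : MvPolynomial ι K →ₐ[K] R).toRingHom.IsIntegral)
    (hxi : AlgebraicIndependent K x) (hσi : Function.Injective σ)
    (f : Polynomial (MvPolynomial ι K)) {y β : R}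
    (hy : (f.map (aeval x).toRingHom).eval y = 0)
    (hβ : ∀ r, ∃ q : Polynomial (MvPolynomial ι K),
      β * r = (q.map (aeval x : MvPolynomial ι K →ₐ[K] R).toRingHom).eval y)
    (hσβ : W.valuation (σ β) = 1)
    (hσy : W.valuation (σ ((f.map (aeval x).toRingHom).derivative.eval y)) = 1)
    (D : Derivation K L L) {π : L} (hlog : ∀ u, u ≠ 0 → W.valuation (π * (D u / u)) ≤ 1)
    (hD : ∀ u, W.valuation u ≤ 1 → W.valuation (π * D u) < 1)
    (hσP : ∀ r, W.valuation (σ r) ≤ 1 ∧ (W.valuation (σ r) < 1 ↔ r ∈ P))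
    (hπ0 : π ≠ 0) (hπ : W.valuation (σ (aeval x h)) = W.valuation π) :
    W.valuation (π * branchForm P x a j₀ (f.map (aeval x).toRingHom) y σ D - D π) < 1 := by
  classical
  have hσ := fun r => (hσP r).1
  obtain ⟨τ₀, hτ₀, hcong, huniq⟩ := hd.exists_mem_branches hx hσP
  have hτ1 := hd.valuation_le_one_of_mem_branches hx hσ hτ₀
  set e := σ ((f.map (aeval x).toRingHom).derivative.eval y) with he
  have he0 : e ≠ 0 := fun h0 => by rw [h0, map_zero] at hσy; exact zero_ne_one hσy
  set ρ := σ (x j₀) - τ₀ (x j₀) with hρ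
  set s := sepSum (f.map (aeval x).toRingHom) y σ.toRingHom τ₀.toRingHom with hs
  have hρ0 : ρ ≠ 0 := hd.sub_ne_zero hσi hxi hτ₀
  have hρπ : W.valuation ρ = W.valuation π :=
    (hd.valuation_sub_eq hσP hτ₀ (hcong _)).trans hπ
  have hse : W.valuation (s - e) < 1 := by
    have h1 := ValuationSubring.valuation_restrictHom_sepSum hσ hτ1 (f.map (aeval x).toRingHom) y
    have h2 : (IsLocalRing.residue W).comp (W.restrictHom σ hσ) =
        (IsLocalRing.residue W).comp (W.restrictHom τ₀ hτ1) :=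
      RingHom.ext fun r => (ValuationSubring.residue_restrictHom_eq_iff hσ hτ1 r).2 (hcong r)
    have h3 : IsLocalRing.residue W (sepSum (f.map (aeval x).toRingHom) y (W.restrictHom σ hσ)
        (W.restrictHom τ₀ hτ1) -
          W.restrictHom σ hσ ((f.map (aeval x).toRingHom).derivative.eval y)) = 0 := by
      rw [map_sub, map_sepSum, ← h2, sepSum_self, RingHom.comp_apply, sub_self]
    rw [W.residue_eq_zero_iff] at h3
    rw [hs, ← h1]
    exact h3
  have hfin := hd.finite_branches hx σ
  set u := ρ / π with hu
  have hu0 : u ≠ 0 := div_ne_zero hρ0 hπ0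
  have hu1 : W.valuation u = 1 := by
    rw [hu, map_div₀, hρπ, div_self ((Valuation.ne_zero_iff _).2 hπ0)]
  have hρu : ρ = π * u := by rw [hu]; field_simp
  have h1 : π * branchForm P x a j₀ (f.map (aeval x).toRingHom) y σ D - D π =
      e⁻¹ * (∑ τ ∈ hfin.toFinset.erase τ₀, π * (sepSum (f.map (aeval x).toRingHom) y σ.toRingHom
        τ.toRingHom * (D (σ (x j₀) - τ (x j₀)) / (σ (x j₀) - τ (x j₀)))) +
        ((s - e) * (π * (D ρ / ρ)) + e * (u⁻¹ * (π * D u)))) := by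
    rw [branchForm, ← he, finsum_mem_eq_finite_toFinset_sum _ hfin,
      ← Finset.sum_erase_add _ _ (hfin.mem_toFinset.2 hτ₀), ← hs, ← hρ]
    rw [← Finset.mul_sum]
    have h2 : D ρ / ρ = D π / π + D u / u := by
      rw [hρu, Derivation.leibniz, smul_eq_mul, smul_eq_mul]
      field_simp
      ring
    rw [h2]
    field_simp
    ring
  rw [h1, map_mul, map_inv₀, hσy, inv_one, one_mul]
  refine Valuation.map_add_lt _ (Valuation.finset_sum_lt_one _ _ fun τ hτ => ?_)
    (Valuation.map_add_lt _ ?_ ?_)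
  · rw [Finset.mem_erase, Set.Finite.mem_toFinset] at hτ
    exact hd.valuation_term_lt_one hx hxi hσi f hy hβ hσ hσβ D hlog hD hτ.2 fun hne =>
      hτ.1 (huniq τ hτ.2 hne)
  · rw [map_mul]
    exact (mul_le_of_le_one_right' (hlog ρ hρ0)).trans_lt hse
  · rw [map_mul, hσy, one_mul, map_mul, map_inv₀, hu1, inv_one, one_mul]
    exact hD u hu1.le

end Local

theorem aeval_mul_homogeneousComponent {ι K B : Type*} [Field K] [CommRing B] [Algebra K B]
    (b : ι → B) (k : B) (n : ℕ) (p : MvPolynomial ι K) :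
    aeval (fun i => k * b i) (homogeneousComponent n p) =
      k ^ n * aeval b (homogeneousComponent n p) := by
  rw [homogeneousComponent_apply, map_sum, map_sum, Finset.mul_sum]
  refine Finset.sum_congr rfl fun m hm => ?_
  rw [← (Finset.mem_filter.1 hm).2, aeval_monomial, aeval_monomial, Finsupp.prod, Finsupp.prod,
    Finsupp.degree_apply, ← Finset.prod_pow_eq_pow_sum, mul_left_comm, ← Finset.prod_mul_distrib]
  simp only [mul_pow]

section Bounds

variable {ι K L : Type*} [Field K] [Field L] [Algebra K L] {W : ValuationSubring L}

theorem ValuationSubring.valuation_aeval_le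
    (hK : ∀ c : K, c ≠ 0 → W.valuation (algebraMap K L c) = 1)
    {g : W.ValueGroup} (hg : 1 ≤ g) {u : ι → L} (hu : ∀ j, W.valuation (u j) ≤ g)
    (p : MvPolynomial ι K) {n : ℕ} (hn : p.totalDegree ≤ n) : W.valuation (aeval u p) ≤ g ^ n := by
  refine le_trans ?_ (pow_le_pow_right₀ hg hn)
  rw [aeval_def, eval₂_eq]
  refine Valuation.map_sum_le _ fun m hm => ?_
  rw [map_mul, hK _ (mem_support_iff.1 hm), one_mul, map_prod]
  refine le_trans ?_ (pow_le_pow_right₀ hg (le_totalDegree hm))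
  rw [Finsupp.sum, ← Finset.prod_pow_eq_pow_sum]
  refine Finset.prod_le_prod' fun i _ => ?_
  rw [map_pow]
  exact pow_le_pow_left' (hu i) _

theorem ValuationSubring.valuation_le_of_isRoot {q : Polynomial L} (hq : q.Monic)
    {G : W.ValueGroup} (hG : 1 ≤ G) (hqG : ∀ k, W.valuation (q.coeff k) ≤ G) {u : L}
    (hu : q.IsRoot u) : W.valuation u ≤ G := by
  by_contra! hlt
  have h0 : q.natDegree ≠ 0 := by
    intro h0
    rw [Polynomial.Monic.natDegree_eq_zero hq |>.1 h0] at hu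
    simp at hu
  have hu0 : 0 < W.valuation u := (zero_lt_one.trans_le hG).trans hlt
  rw [Polynomial.IsRoot, Polynomial.eval_eq_sum_range, Finset.sum_range_succ, hq.coeff_natDegree,
    one_mul] at hu
  have h1 : W.valuation (∑ k ∈ Finset.range q.natDegree, q.coeff k * u ^ k) <
      W.valuation (u ^ q.natDegree) := by
    refine Valuation.map_sum_lt _ ?_ fun k hk => ?_
    · rw [map_pow]; exact pow_ne_zero _ hu0.ne'
    · rw [map_mul, map_pow, map_pow]
      have hk' := Finset.mem_range.1 hk
      calc W.valuation (q.coeff k) * W.valuation u ^ k ≤ G * W.valuation u ^ k := by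
            gcongr; exact hqG k
        _ < W.valuation u * W.valuation u ^ k := by
            gcongr
            exact pow_pos hu0 _
        _ = W.valuation u ^ (k + 1) := (pow_succ' _ _).symm
        _ ≤ W.valuation u ^ q.natDegree := pow_le_pow_right₀ (hG.trans hlt.le) hk'
  have h2 := Valuation.map_add_eq_of_lt_left _ h1
  rw [add_comm, hu, map_zero, map_pow] at h2
  exact pow_ne_zero _ hu0.ne' h2.symm

theorem ValuationSubring.valuation_aeval_sub_lt_one
    (hK : ∀ c : K, c ≠ 0 → W.valuation (algebraMap K L c) = 1) {b b' : ι → L}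
    (hb : ∀ j, W.valuation (b j - b' j) < 1) (hb' : ∀ j, W.valuation (b' j) ≤ 1)
    (p : MvPolynomial ι K) : W.valuation (aeval b p - aeval b' p) < 1 := by
  have hb1 : ∀ j, W.valuation (b j) ≤ 1 := fun j => by
    have := W.valuation.map_add_le (hb j).le (hb' j)
    rwa [sub_add_cancel] at this
  induction p using MvPolynomial.induction_on with
  | C k => simp
  | add p q hp hq =>
    rw [map_add, map_add, add_sub_add_comm]
    exact Valuation.map_add_lt _ hp hq
  | mul_X p i hp =>
    rw [map_mul, map_mul, aeval_X, aeval_X]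
    have h1 : aeval b p * b i - aeval b' p * b' i =
        (aeval b p - aeval b' p) * b i + aeval b' p * (b i - b' i) := by ring
    rw [h1]
    refine Valuation.map_add_lt _ ?_ ?_
    · rw [map_mul]
      exact (mul_le_of_le_one_right' (hb1 i)).trans_lt hp
    · rw [map_mul]
      refine (mul_le_of_le_one_left' ?_).trans_lt (hb i)
      have := ValuationSubring.valuation_aeval_le hK le_rfl hb' p le_rfl
      rwa [one_pow] at this

theorem ValuationSubring.valuation_le_of_line
    (hK : ∀ c : K, c ≠ 0 → W.valuation (algebraMap K L c) = 1) {h : MvPolynomial ι K} {a : ι → K}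
    (hlead : eval a (homogeneousComponent h.totalDegree h) ≠ 0) {g : W.ValueGroup} (hg : 1 ≤ g)
    {c : ι → L} (hc : ∀ j, W.valuation (c j) ≤ g) {ξ : L}
    (hξ : aeval (fun j => c j + algebraMap K L (a j) * ξ) h = 0) : W.valuation ξ ≤ g := by
  by_contra! hlt
  have hv1 : 1 < W.valuation ξ := hg.trans_lt hlt
  have hv0 : 0 < W.valuation ξ := zero_lt_one.trans hv1
  have hξ0 : ξ ≠ 0 := fun h0 => by rw [h0, map_zero] at hv0; exact lt_irrefl _ hv0
  have hK1 : ∀ k : K, W.valuation (algebraMap K L k) ≤ 1 := fun k => by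
    by_cases hk : k = 0
    · simp [hk]
    · exact (hK k hk).le
  set b : ι → L := fun j => c j / ξ + algebraMap K L (a j) with hb
  have hcb : ∀ j, W.valuation (b j - algebraMap K L (a j)) < 1 := fun j => by
    rw [hb]
    simp only [add_sub_cancel_right, map_div₀]
    rw [div_lt_one₀ hv0]
    exact (hc j).trans_lt hlt
  have hb1 : ∀ j, W.valuation (b j) ≤ 1 := fun j => by
    have := W.valuation.map_add_le (hcb j).le (hK1 (a j))
    rwa [sub_add_cancel] at this
  have h1 : (fun j => c j + algebraMap K L (a j) * ξ) = fun j => ξ * b j := by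
    ext j
    rw [hb]
    field_simp
  have hlast : W.valuation (aeval b (homogeneousComponent h.totalDegree h)) = 1 := by
    have h2 := ValuationSubring.valuation_aeval_sub_lt_one hK hcb (fun j => hK1 (a j))
      (homogeneousComponent h.totalDegree h)
    have h3 : aeval (fun j => algebraMap K L (a j)) (homogeneousComponent h.totalDegree h) =
        algebraMap K L (eval a (homogeneousComponent h.totalDegree h)) := by
      have := aeval_algebraMap_apply L a (homogeneousComponent h.totalDegree h)
      rwa [aeval_eq_eval] at this
    rw [h3] at h2
    have h4 := hK _ hlead
    have h5 := Valuation.map_add_eq_of_lt_left W.valuation (h2.trans_eq h4.symm)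
    rwa [add_sub_cancel, h4] at h5
  rw [h1, ← sum_homogeneousComponent h, map_sum, Finset.sum_range_succ] at hξ
  simp only [aeval_mul_homogeneousComponent] at hξ
  have h6 : W.valuation (ξ ^ h.totalDegree * aeval b (homogeneousComponent h.totalDegree h)) =
      W.valuation ξ ^ h.totalDegree := by rw [map_mul, map_pow, hlast, mul_one]
  have h7 : W.valuation (∑ d ∈ Finset.range h.totalDegree,
      ξ ^ d * aeval b (homogeneousComponent d h)) <
      W.valuation (ξ ^ h.totalDegree * aeval b (homogeneousComponent h.totalDegree h)) := by
    rw [h6]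
    refine Valuation.map_sum_lt _ (pow_ne_zero _ hv0.ne') fun d hd => ?_
    rw [map_mul, map_pow]
    have h8 := ValuationSubring.valuation_aeval_le hK le_rfl hb1 (homogeneousComponent d h) le_rfl
    rw [one_pow] at h8
    exact (mul_le_of_le_one_right' h8).trans_lt (pow_lt_pow_right₀ hv1 (Finset.mem_range.1 hd))
  have h9 := Valuation.map_add_eq_of_lt_left _ h7
  rw [add_comm, hξ, map_zero, h6] at h9
  exact pow_ne_zero _ hv0.ne' h9.symm

variable {R : Type*} [CommRing R] [Algebra K R]
  {P : Ideal R} {x : ι → R} {h : MvPolynomial ι K} {a : ι → K} {j₀ : ι} {σ : R →ₐ[K] L}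

/-- The exponent in the uniform bound for branch forms. -/
noncomputable def branchBound (f : Polynomial (MvPolynomial ι K)) : ℕ :=
  ((Finset.range (f.natDegree + 1)).sup fun k => (f.coeff k).totalDegree) * (f.natDegree + 1) +
    f.natDegree + 1

theorem IsNormalDirection.valuation_branchForm_le [IsDomain R] [Algebra.FiniteType K R]
    (hd : IsNormalDirection x P h a j₀)
    (hx : (aeval x : MvPolynomial ι K →ₐ[K] R).toRingHom.IsIntegral)
    (hxi : AlgebraicIndependent K x) (hσi : Function.Injective σ)
    (hK : ∀ c : K, c ≠ 0 → W.valuation (algebraMap K L c) = 1)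
    {f : Polynomial (MvPolynomial ι K)} (hf : f.Monic) {y : R}
    (hy : (f.map (aeval x).toRingHom).eval y = 0)
    {g : W.ValueGroup} (hg : 1 ≤ g) (hgx : ∀ j, W.valuation (σ (x j)) ≤ g)
    (hgy : W.valuation (σ y) ≤ g)
    (hgf : W.valuation (σ ((f.map (aeval x).toRingHom).derivative.eval y))⁻¹ ≤ g)
    (D : Derivation K L L) {π : L} (hlog : ∀ u, u ≠ 0 → W.valuation (π * (D u / u)) ≤ 1) :
    W.valuation (π * branchForm P x a j₀ (f.map (aeval x).toRingHom) y σ D) ≤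
      g ^ branchBound f := by
  have hK1 : ∀ k : K, W.valuation (algebraMap K L k) ≤ 1 := fun k => by
    by_cases hk : k = 0
    · simp [hk]
    · exact (hK k hk).le
  set d := (Finset.range (f.natDegree + 1)).sup fun k => (f.coeff k).totalDegree with hd'
  have hcoef : ∀ k, (f.coeff k).totalDegree ≤ d := fun k => by
    by_cases hk : k < f.natDegree + 1
    · exact Finset.le_sup (f := fun k => (f.coeff k).totalDegree) (Finset.mem_range.2 hk)
    · rw [Polynomial.coeff_eq_zero_of_natDegree_lt (by omega), totalDegree_zero]
      exact Nat.zero_le _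
  have hexp : branchBound f = (d + (d + 1) * f.natDegree) + 1 := by
    rw [branchBound, ← hd']; ring
  rw [branchForm, mul_left_comm, map_mul, map_inv₀, hexp, pow_succ',
    finsum_mem_eq_finite_toFinset_sum _ (hd.finite_branches hx σ), Finset.mul_sum]
  rw [map_inv₀] at hgf
  refine mul_le_mul' hgf (Valuation.map_sum_le _ fun τ hτ => ?_)
  rw [Set.Finite.mem_toFinset] at hτ
  rw [mul_left_comm, map_mul]
  refine (mul_le_of_le_one_right' (hlog _ (hd.sub_ne_zero hσi hxi hτ))).trans ?_
  have hc : ∀ j, W.valuation (σ (sliceCoord x a j₀ j)) ≤ g := fun j => by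
    rw [sliceCoord, map_sub, map_mul, AlgHom.commutes]
    refine W.valuation.map_sub_le (hgx j) ?_
    rw [map_mul]
    exact (mul_le_of_le_one_left' (hK1 _)).trans (hgx _)
  have hτx : ∀ j, τ (x j) = σ (sliceCoord x a j₀ j) + algebraMap K L (a j) * τ (x j₀) := fun j => by
    rw [sliceCoord_eq_of_mem_branches hτ, sliceCoord, map_sub, map_mul, AlgHom.commutes]
    ring
  have haev : ∀ p : MvPolynomial ι K, τ (aeval x p) = aeval (fun j => τ (x j)) p := fun p => by
    rw [← AlgHom.comp_apply]
    congr 1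
    ext j; simp
  have hξ : W.valuation (τ (x j₀)) ≤ g := by
    refine ValuationSubring.valuation_le_of_line hK hd.lead hg hc ?_
    rw [← funext hτx, ← haev, (hτ.1 _).2 ((hd.mem_iff h).2 dvd_rfl)]
  have hτg : ∀ j, W.valuation (τ (x j)) ≤ g := fun j => by
    rw [hτx]
    refine W.valuation.map_add_le (hc j) ?_
    rw [map_mul]
    exact (mul_le_of_le_one_left' (hK1 _)).trans hξ
  have hcf : ∀ k, W.valuation (τ (aeval x (f.coeff k))) ≤ g ^ d := fun k => by
    rw [haev]
    exact ValuationSubring.valuation_aeval_le hK hg hτg _ (hcoef k)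
  have hτy : W.valuation (τ y) ≤ g ^ d := by
    refine ValuationSubring.valuation_le_of_isRoot
      (q := (f.map (aeval x).toRingHom).map τ.toRingHom) ((hf.map _).map _)
      (one_le_pow₀ hg) (fun k => ?_) ?_
    · rw [Polynomial.coeff_map, Polynomial.coeff_map]
      exact hcf k
    · rw [Polynomial.IsRoot, Polynomial.eval_map, ← AlgHom.coe_toRingHom τ]
      change Polynomial.eval₂ τ.toRingHom (τ.toRingHom y) _ = 0
      rw [Polynomial.eval₂_at_apply, hy, map_zero]
  have hle : g ^ d ≤ g ^ (d + 1) := pow_le_pow_right₀ hg (Nat.le_succ d)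
  have hle' : g ≤ g ^ (d + 1) := by
    conv_lhs => rw [← pow_one g]
    exact pow_le_pow_right₀ hg (by omega)
  rw [sepSum]
  refine Valuation.map_sum_le _ fun k hk => ?_
  have hk' : k ≤ f.natDegree := by
    have h1 := Finset.mem_range.1 hk
    have h2 := Polynomial.natDegree_map_le (f := (aeval x : MvPolynomial ι K →ₐ[K] R).toRingHom)
      (p := f)
    omega
  rw [map_mul, pow_add]
  refine mul_le_mul' ?_ ?_
  · rw [Polynomial.coeff_map]; exact hcf k
  · refine Valuation.map_sum_le _ fun i hi => ?_
    have hi' := Finset.mem_range.1 hi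
    rw [map_mul, map_pow, map_pow, pow_mul]
    calc _ ≤ (g ^ (d + 1)) ^ i * (g ^ (d + 1)) ^ (k - 1 - i) :=
          mul_le_mul' (pow_le_pow_left' (hgy.trans hle') _) (pow_le_pow_left' (hτy.trans hle) _)
      _ = (g ^ (d + 1)) ^ (k - 1) := by rw [← pow_add]; congr 1; omega
      _ ≤ _ := pow_le_pow_right₀ (one_le_pow₀ hg) (by omega)

end Bounds

end

section HeightOne

variable {R S : Type*} [CommRing R] [CommRing S]

theorem HeightOnePrime.eq_of_le {P Q : Ideal R} (hP : HeightOnePrime P) (hQ : Q.IsPrime)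
    (hQ0 : Q ≠ ⊥) (h : Q ≤ P) : Q = P := by
  by_contra hne
  exact hQ0 (hP.2.2 Q hQ (lt_of_le_of_ne h hne))

theorem HeightOnePrime.of_mem_minimalPrimes_span [IsDomain R] [IsNoetherianRing R] {a : R}
    (ha : a ≠ 0) {P : Ideal R} (hP : P ∈ (Ideal.span {a}).minimalPrimes) : HeightOnePrime P := by
  have hPp : P.IsPrime := hP.isPrime
  have haP : a ∈ P := hP.1.2 (Ideal.mem_span_singleton_self a)
  have hle : P.height ≤ 1 := Ideal.height_le_one_of_isPrincipal_of_mem_minimalPrimes _ P hP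
  refine ⟨hPp, fun h0 => ha (by simpa [h0] using haP), fun Q hQ hlt => ?_⟩
  have hQ0 : Q.height < P.height :=
    Ideal.height_strict_mono_of_isPrime_of_isPrime hlt
  have hQ1 : Q.height = 0 := by
    have := hQ0.trans_le hle
    rwa [Order.lt_one_iff] at this
  have := Ideal.mem_minimalPrimes_of_height_le (I := (⊥ : Ideal R)) (J := Q) bot_le (by simp [hQ1])
  exact le_bot_iff.1 (this.2 ⟨Ideal.isPrime_bot, le_rfl⟩ bot_le)

theorem HeightOnePrime.mem_minimalPrimes {I P : Ideal R} (hP : HeightOnePrime P) (hI : I ≠ ⊥)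
    (hIP : I ≤ P) : P ∈ I.minimalPrimes :=
  ⟨⟨hP.1, hIP⟩, fun _ hQ hQP => (hP.eq_of_le hQ.1 (fun h0 => hI (le_bot_iff.1 (h0 ▸ hQ.2))) hQP).ge⟩

theorem finite_heightOnePrime [IsDomain R] [IsNoetherianRing R] {a : R} (ha : a ≠ 0) :
    {P : Ideal R | HeightOnePrime P ∧ a ∈ P}.Finite := by
  refine (Ideal.finite_minimalPrimes_of_isNoetherianRing R (Ideal.span {a})).subset fun P hP => ?_
  refine hP.1.mem_minimalPrimes ?_ ?_
  · simpa using ha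
  · simpa [Ideal.span_le] using hP.2

theorem HeightOnePrime.exists_comap_eq_span {T : Type*} [CommRing T] [IsDomain T]
    [UniqueFactorizationMonoid T] [IsDomain S] [Algebra T S] [FaithfulSMul T S]
    [Algebra.IsIntegral T S] {Q : Ideal S} (hQ : HeightOnePrime Q) :
    ∃ t : T, Prime t ∧ Q.comap (algebraMap T S) = Ideal.span {t} := by
  have _ : Q.IsPrime := hQ.1
  have hne : Q.comap (algebraMap T S) ≠ ⊥ := by
    obtain ⟨q, hq, hq0⟩ := Submodule.exists_mem_ne_zero_of_ne_bot hQ.2.1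
    exact Ideal.comap_ne_bot_of_integral_mem hq0 hq (Algebra.IsIntegral.isIntegral q)
  obtain ⟨t, htQ, ht⟩ := Ideal.IsPrime.exists_mem_prime_of_ne_bot
    (Ideal.comap_isPrime (algebraMap T S) Q) hne
  refine ⟨t, ht, ?_⟩
  by_contra hcon
  have hlt : Ideal.span {t} < Q.comap (algebraMap T S) :=
    lt_of_le_of_ne ((Ideal.span_singleton_le_iff_mem _).2 htQ) (Ne.symm hcon)
  have _ : (Ideal.span {t}).IsPrime := (Ideal.span_singleton_prime ht.ne_zero).2 ht
  have _ : Q.LiesOver (Q.comap (algebraMap T S)) := ⟨rfl⟩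
  obtain ⟨Q', hQ', hp, hl⟩ := Ideal.exists_ideal_lt_liesOver_of_lt Q hlt
  have h0 := hQ.2.2 Q' hp hQ'
  have h1 : t ∈ Q'.under T := by
    rw [← hl.over]; exact Ideal.mem_span_singleton_self t
  rw [h0, Ideal.mem_comap, Ideal.mem_bot, FaithfulSMul.algebraMap_eq_zero_iff] at h1
  exact ht.ne_zero h1

theorem HeightOnePrime.of_comap_eq_span {A : Type*} [CommRing A] [IsDomain A] [IsDomain R]
    [UniqueFactorizationMonoid A] [Algebra A R] [Algebra.IsIntegral A R]
    {P : Ideal R} (hP : P.IsPrime) {h : A} (hh : Prime h)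
    (hPh : P.comap (algebraMap A R) = Ideal.span {h}) (hP0 : P ≠ ⊥) : HeightOnePrime P := by
  refine ⟨hP, hP0, fun Q hQ hlt => ?_⟩
  by_contra hQ0
  have hne : Q.comap (algebraMap A R) ≠ ⊥ := by
    obtain ⟨q, hq, hq0⟩ := Submodule.exists_mem_ne_zero_of_ne_bot hQ0
    exact Ideal.comap_ne_bot_of_integral_mem hq0 hq (Algebra.IsIntegral.isIntegral q)
  obtain ⟨t, htQ, ht⟩ := Ideal.IsPrime.exists_mem_prime_of_ne_bot
    (Ideal.comap_isPrime (algebraMap A R) Q) hne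
  have h1 : h ∣ t := by
    rw [← Ideal.mem_span_singleton, ← hPh]
    exact Ideal.comap_mono hlt.le htQ
  have h2 : h ∈ Q.comap (algebraMap A R) :=
    Ideal.mem_of_dvd _ ((hh.dvd_prime_iff_associated ht).1 h1).symm.dvd htQ
  have h3 : Q.comap (algebraMap A R) < P.comap (algebraMap A R) :=
    Ideal.comap_lt_comap_of_integral_mem_sdiff hlt.le (Set.exists_of_ssubset hlt).choose_spec
      (Algebra.IsIntegral.isIntegral _)
  refine h3.not_ge ?_
  rw [hPh, Ideal.span_singleton_le_iff_mem]
  exact h2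

theorem RingHom.exists_forall_exists_comap_eq [IsDomain R] [IsDomain S] [IsNoetherianRing R]
    (f : R →+* S) (hf : Function.Injective f) (hft : f.FiniteType) :
    ∃ b : R, b ≠ 0 ∧ ∀ P : Ideal R, P.IsPrime → b ∉ P →
      ∃ Q : Ideal S, Q.IsPrime ∧ Q.comap f = P := by
  obtain ⟨C, hC⟩ := PrimeSpectrum.exists_constructibleSetData_iff.2
    (PrimeSpectrum.isConstructible_range_comap (RingHom.FinitePresentation.of_finiteType.1 hft))
  have hbot : (⟨⊥, Ideal.isPrime_bot⟩ : PrimeSpectrum R) ∈ C.toSet := by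
    rw [hC]
    refine ⟨⟨⊥, Ideal.isPrime_bot⟩, ?_⟩
    ext1
    exact Ideal.comap_bot_of_injective f hf
  rw [PrimeSpectrum.ConstructibleSetData.toSet, Set.mem_iUnion₂] at hbot
  obtain ⟨B, hB, hB1, hB2⟩ := hbot
  refine ⟨B.f, fun h0 => hB2 (by simp [h0]), fun P hP hbP => ?_⟩
  have hmem : (⟨P, hP⟩ : PrimeSpectrum R) ∈ C.toSet := by
    rw [PrimeSpectrum.ConstructibleSetData.toSet, Set.mem_iUnion₂]
    refine ⟨B, hB, ?_, ?_⟩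
    · rw [PrimeSpectrum.mem_zeroLocus] at hB1 ⊢
      intro x hx
      have := hB1 hx
      simp only [SetLike.mem_coe, Ideal.mem_bot] at this
      rw [this]
      exact P.zero_mem
    · rw [PrimeSpectrum.mem_zeroLocus]
      simpa using hbP
  rw [hC] at hmem
  obtain ⟨Q, hQ⟩ := hmem
  exact ⟨Q.asIdeal, Q.2, congrArg PrimeSpectrum.asIdeal hQ⟩

theorem finite_heightOnePrime_not_comap [IsDomain R] [IsDomain S] [IsNoetherianRing R]
    [IsNoetherianRing S]
    (f : R →+* S) (hf : Function.Injective f) (hft : f.FiniteType) {s : S} (hs : s ≠ 0) :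
    {P : Ideal R | HeightOnePrime P ∧
      ¬ ∃ Q : Ideal S, HeightOnePrime Q ∧ s ∉ Q ∧ Q.comap f = P}.Finite := by
  obtain ⟨b, hb, hbP⟩ := f.exists_forall_exists_comap_eq hf hft
  refine ((finite_heightOnePrime hb).union ((finite_heightOnePrime hs).image
    (Ideal.comap f))).subset fun P ⟨hP, hPn⟩ => ?_
  by_cases hbp : b ∈ P
  · exact Or.inl ⟨hP, hbp⟩
  · right
    obtain ⟨Q₀, hQ₀, hQP⟩ := hbP P hP.1 hbp
    obtain ⟨h, hh, hh0⟩ := Submodule.exists_mem_ne_zero_of_ne_bot hP.2.1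
    obtain ⟨Q, hQ, hQQ⟩ := Ideal.exists_minimalPrimes_le (I := Ideal.span {f h}) (J := Q₀) (by
      rw [Ideal.span_singleton_le_iff_mem, ← Ideal.mem_comap, hQP]; exact hh)
    have hQ1 : HeightOnePrime Q := .of_mem_minimalPrimes_span ((map_ne_zero_iff f hf).2 hh0) hQ
    have hhQ : h ∈ Q.comap f := hQ.1.2 (Ideal.mem_span_singleton_self _)
    have _ := hQ1.1
    have hc : Q.comap f = P := hP.eq_of_le (Ideal.comap_isPrime f Q)
      (fun h0 => hh0 (by simpa [h0] using hhQ)) (hQP ▸ Ideal.comap_mono hQQ)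
    refine ⟨Q, ⟨hQ1, ?_⟩, hc⟩
    by_contra hsQ
    exact hPn ⟨Q, hQ1, hsQ, hc⟩

end HeightOne

section ProperTransform

variable {R S : Type*} [CommRing R] [CommRing S]

theorem IsHypersurfaceIdeal.ne_bot [IsDomain R] {I : Ideal R} (hI : IsHypersurfaceIdeal I)
    : I ≠ ⊥ := by
  rintro rfl
  exact (hI.2.2 ⊥ ⟨⟨Ideal.isPrime_bot, le_rfl⟩, fun _ _ _ => bot_le⟩).2.1 rfl

theorem map_ne_bot_of_injective {f : R →+* S} (hf : Function.Injective f) {I : Ideal R}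
    (hI : I ≠ ⊥) : I.map f ≠ ⊥ := by
  rwa [Ne, Ideal.map_eq_bot_iff_of_injective hf]

theorem Ideal.IsPrime.exists_le_of_sInf_le {P : Ideal R} (hP : P.IsPrime) {s : Set (Ideal R)}
    (hs : s.Finite) (h : sInf s ≤ P) : ∃ Q ∈ s, Q ≤ P := by
  have h1 : hs.toFinset.inf id ≤ P := by
    rwa [Finset.inf_id_eq_sInf, Set.Finite.coe_toFinset]
  obtain ⟨Q, hQ, hle⟩ := hP.inf_le'.1 h1
  exact ⟨Q, hs.mem_toFinset.1 hQ, hle⟩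

theorem comap_mem_minimalPrimes_of_properTransform_le [IsNoetherianRing S] {f₁ f₂ : R →+* S}
    (hf₁ : Function.Injective f₁) (hf₂ : Function.Injective f₂) {I : Ideal R}
    (hI : I ≠ ⊥) (h : properTransform f₂ I ≤ properTransform f₁ I)
    {Q : Ideal S} (hQ : HeightOnePrime Q) (hQ₁ : Q.comap f₁ ∈ I.minimalPrimes) :
    Q.comap f₂ ∈ I.minimalPrimes := by
  have hle : properTransform f₂ I ≤ Q := h.trans (sInf_le
    ⟨hQ.mem_minimalPrimes (map_ne_bot_of_injective hf₁ hI) (Ideal.map_le_iff_le_comap.2 hQ₁.1.2),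
      hQ₁⟩)
  have hfin : {Q : Ideal S | Q ∈ (I.map f₂).minimalPrimes ∧ Q.comap f₂ ∈ I.minimalPrimes}.Finite :=
    (Ideal.finite_minimalPrimes_of_isNoetherianRing S (I.map f₂)).subset fun _ h => h.1
  obtain ⟨Q', ⟨hQ'1, hQ'2⟩, hQ'Q⟩ := hQ.1.exists_le_of_sInf_le hfin hle
  rwa [← hQ.eq_of_le hQ'1.1.1
    (fun h0 => map_ne_bot_of_injective hf₂ hI (le_bot_iff.1 (h0 ▸ hQ'1.1.2))) hQ'Q]

theorem HeightOnePrime.of_comap_mem_minimalPrimes [IsDomain S] [IsNoetherianRing S] {f : R →+* S}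
    (hf : Function.Injective f) {I : Ideal R} {Q : Ideal S} {a : R} (ha : a ≠ 0) (haI : a ∈ I)
    (hQ : Q ∈ (I.map f).minimalPrimes) (hP : HeightOnePrime (Q.comap f)) : HeightOnePrime Q := by
  have _ := hQ.1.1
  have haQ : f a ∈ Q := hQ.1.2 (Ideal.mem_map_of_mem f haI)
  obtain ⟨Q', hQ', hle⟩ := Ideal.exists_minimalPrimes_le (I := Ideal.span {f a}) (J := Q)
    ((Ideal.span_singleton_le_iff_mem _).2 haQ)
  have h1 : HeightOnePrime Q' := .of_mem_minimalPrimes_span ((map_ne_zero_iff f hf).2 ha) hQ'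
  have _ := h1.1
  have hhQ : a ∈ Q'.comap f := hQ'.1.2 (Ideal.mem_span_singleton_self _)
  have hc : Q'.comap f = Q.comap f := hP.eq_of_le (Ideal.comap_isPrime f Q')
      (fun h0 => ha (by simpa [h0] using hhQ)) (Ideal.comap_mono hle)
  have h2 : Q ≤ Q' := hQ.2 ⟨h1.1, Ideal.map_le_iff_le_comap.2
    ((Ideal.map_le_iff_le_comap.1 hQ.1.2).trans hc.ge)⟩ hle
  rwa [le_antisymm h2 hle]

theorem minimalPrimes_sInf_of_heightOnePrime {s : Set (Ideal R)} (hs : s.Finite)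
    (hs1 : ∀ P ∈ s, HeightOnePrime P) : (sInf s).minimalPrimes = s := by
  have key : ∀ P : Ideal R, P.IsPrime → sInf s ≤ P → ∃ P' ∈ s, P' ≤ P :=
    fun P hP hle => hP.exists_le_of_sInf_le hs hle
  ext P
  constructor
  · intro hP
    obtain ⟨P', hP', hle⟩ := key P hP.1.1 hP.1.2
    rwa [le_antisymm (hP.2 ⟨(hs1 P' hP').1, sInf_le hP'⟩ hle) hle]
  · intro hP
    refine ⟨⟨(hs1 P hP).1, sInf_le hP⟩, fun Q hQ hle => ?_⟩
    obtain ⟨P', hP', hle'⟩ := key Q hQ.1 hQ.2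
    rw [← (hs1 P hP).eq_of_le (hs1 P' hP').1 (hs1 P' hP').2.1 (hle'.trans hle)]
    exact hle'

theorem isHypersurfaceIdeal_sInf {s : Set (Ideal R)} (hs : s.Finite) (hne : s.Nonempty)
    (hs1 : ∀ P ∈ s, HeightOnePrime P) : IsHypersurfaceIdeal (sInf s) := by
  refine ⟨?_, ?_, fun P hP => ?_⟩
  · rw [sInf_eq_iInf]
    exact Ideal.isRadical_iInf _ fun P => Ideal.isRadical_iInf _ fun hP => (hs1 P hP).1.isRadical
  · obtain ⟨P, hP⟩ := hne
    exact fun h => (hs1 P hP).1.ne_top (top_le_iff.1 (h ▸ sInf_le hP))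
  · rw [minimalPrimes_sInf_of_heightOnePrime hs hs1] at hP
    exact hs1 P hP

/-- The minimal primes of `a` not containing `b`: the components of the zero locus of `a` on the
basic open set defined by `b`. -/
def openMinimalPrimes (a b : R) : Set (Ideal R) := {P | P ∈ (Ideal.span {a}).minimalPrimes ∧ b ∉ P}

theorem finite_openMinimalPrimes [IsNoetherianRing R] (a b : R) : (openMinimalPrimes a b).Finite :=
  (Ideal.finite_minimalPrimes_of_isNoetherianRing R _).subset fun _ h => h.1

theorem heightOnePrime_of_mem_openMinimalPrimes [IsDomain R] [IsNoetherianRing R] {a b : R}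
    (ha : a ≠ 0) {P : Ideal R} (hP : P ∈ openMinimalPrimes a b) : HeightOnePrime P :=
  .of_mem_minimalPrimes_span ha hP.1

theorem mem_of_mem_openMinimalPrimes {a b : R} {P : Ideal R} (hP : P ∈ openMinimalPrimes a b) :
    a ∈ P := hP.1.1.2 (Ideal.mem_span_singleton_self a)

theorem mem_sInf_openMinimalPrimes (a b : R) : a ∈ sInf (openMinimalPrimes a b) :=
  Ideal.mem_sInf.2 fun _ hP => mem_of_mem_openMinimalPrimes hP

theorem mem_properTransform_set_of_mem [IsDomain R] [IsDomain S] [IsNoetherianRing R]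
    [IsNoetherianRing S]
    {f₁ f₂ : R →+* S} (hf₁ : Function.Injective f₁) (hf₂ : Function.Injective f₂) {a b : R}
    (ha : a ≠ 0) (hab : f₁ a * f₂ b = f₂ a * f₁ b) {Q : Ideal S}
    (hs : HeightOnePrime Q → Q.comap f₂ ≠ ⊥ → HeightOnePrime (Q.comap f₂)) (hb : f₂ b ∉ Q)
    (hQ : Q ∈ ((sInf (openMinimalPrimes a b)).map f₁).minimalPrimes)
    (hQ₁ : Q.comap f₁ ∈ openMinimalPrimes a b) :
    Q ∈ ((sInf (openMinimalPrimes a b)).map f₂).minimalPrimes ∧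
      Q.comap f₂ ∈ openMinimalPrimes a b := by
  have hQh : HeightOnePrime Q := .of_comap_mem_minimalPrimes hf₁ ha (mem_sInf_openMinimalPrimes a b)
    hQ (heightOnePrime_of_mem_openMinimalPrimes ha hQ₁)
  have h1 : f₂ a * f₁ b ∈ Q := by
    rw [← hab]
    exact Q.mul_mem_right _ (Ideal.mem_comap.1 (mem_of_mem_openMinimalPrimes hQ₁))
  have h2 : a ∈ Q.comap f₂ := (hQh.1.mem_or_mem h1).resolve_right hQ₁.2
  have hne : Q.comap f₂ ≠ ⊥ := fun h0 => ha (by simpa [h0] using h2)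
  have h3 := hs hQh hne
  have h4 : Q.comap f₂ ∈ openMinimalPrimes a b :=
    ⟨h3.mem_minimalPrimes (by simpa using ha) ((Ideal.span_singleton_le_iff_mem _).2 h2), hb⟩
  refine ⟨hQh.mem_minimalPrimes (map_ne_bot_of_injective hf₂ fun h0 => ha ?_) ?_, h4⟩
  · have := mem_sInf_openMinimalPrimes a b
    rwa [h0] at this
  · exact Ideal.map_le_iff_le_comap.2 (sInf_le h4)

theorem properTransform_sInf_openMinimalPrimes_le [IsDomain R] [IsDomain S] [IsNoetherianRing R]
    [IsNoetherianRing S]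
    {f₁ f₂ : R →+* S} (hf₁ : Function.Injective f₁) (hf₂ : Function.Injective f₂) {a b : R}
    (ha : a ≠ 0) (hab : f₁ a * f₂ b = f₂ a * f₁ b) {s : S}
    (hs : ∀ Q, HeightOnePrime Q → s ∉ Q → Q.comap f₂ ≠ ⊥ → HeightOnePrime (Q.comap f₂))
    (hbad : ∀ Q, HeightOnePrime Q → s * f₂ b ∈ Q → f₁ a ∈ Q → f₁ b ∈ Q) :
    properTransform f₂ (sInf (openMinimalPrimes a b)) ≤
      properTransform f₁ (sInf (openMinimalPrimes a b)) := by
  rw [properTransform, properTransform, minimalPrimes_sInf_of_heightOnePrime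
    (finite_openMinimalPrimes a b) fun P hP => heightOnePrime_of_mem_openMinimalPrimes ha hP]
  refine sInf_le_sInf fun Q ⟨hQ, hQ₁⟩ => ?_
  have hQh : HeightOnePrime Q := .of_comap_mem_minimalPrimes hf₁ ha (mem_sInf_openMinimalPrimes a b)
    hQ (heightOnePrime_of_mem_openMinimalPrimes ha hQ₁)
  have h1 : s * f₂ b ∉ Q := fun h => hQ₁.2 (hbad Q hQh h
    (Ideal.mem_comap.1 (mem_of_mem_openMinimalPrimes hQ₁)))
  exact mem_properTransform_set_of_mem hf₁ hf₂ ha hab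
    (fun h => hs Q h fun h' => h1 (Q.mul_mem_right _ h'))
    (fun h' => h1 (Q.mul_mem_left _ h')) hQ hQ₁

theorem finite_compl_openMinimalPrimes_nonempty {K : Type*} [Field K] [IsAlgClosed K] [Algebra K R]
    [IsDomain R] [Algebra.FiniteType K R] {a b : R} (hb : b ≠ 0)
    (hab : ∀ c : K, a ≠ algebraMap K R c * b) :
    {c : K | (openMinimalPrimes (a - algebraMap K R c * b) b).Nonempty}ᶜ.Finite := by
  let B := Localization.Away b
  have hle : Submonoid.powers b
      ≤ nonZeroDivisors R := powers_le_nonZeroDivisors_of_noZeroDivisors hb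
  have _ : IsDomain B := IsLocalization.isDomain_localization hle
  have hinj : Function.Injective (algebraMap R B) := IsLocalization.injective B hle
  have hbu : IsUnit (algebraMap R B b) := IsLocalization.Away.algebraMap_isUnit b
  obtain ⟨b', hb'⟩ := hbu.exists_left_inv
  have _ : Algebra.FiniteType R B := IsLocalization.finiteType_of_monoid_fg (Submonoid.powers b) B
  have _ : Algebra.FiniteType K B := Algebra.FiniteType.trans ‹_› ‹Algebra.FiniteType R B›
  set e : B := algebraMap R B a * b' with he
  have hec : ∀ c : K, e - algebraMap K B c = b' * algebraMap R B (a - algebraMap K R c * b) := by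
    intro c
    rw [map_sub, map_mul, ← IsScalarTower.algebraMap_apply, mul_sub, mul_left_comm, hb', mul_one,
      he, mul_comm]
  have htr : Function.Injective (Polynomial.aeval (R := K) e) := by
    rw [← transcendental_iff_injective]
    intro halg
    obtain ⟨c, hc⟩ := minpoly.mem_range_of_degree_eq_one K e
      (IsAlgClosed.degree_eq_one_of_irreducible K (minpoly.irreducible halg.isIntegral))
    have h0 := hec c
    rw [hc, sub_self, eq_comm, mul_eq_zero] at h0
    refine h0.elim (fun h1 => one_ne_zero (α := B) ?_) fun h1 => hab c ?_
    · rw [← hb', h1, zero_mul]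
    · rw [← sub_eq_zero]
      exact (map_eq_zero_iff _ hinj).1 h1
  obtain ⟨p, hp, hpP⟩ := RingHom.exists_forall_exists_comap_eq
    (Polynomial.aeval (R := K) e).toRingHom htr
    (RingHom.FiniteType.of_comp_finiteType (f := (Polynomial.C : K →+* Polynomial K)) (by
      rw [AlgHom.toRingHom_eq_coe, ← Polynomial.algebraMap_eq, AlgHom.comp_algebraMap]
      exact RingHom.finiteType_algebraMap.2 inferInstance))
  refine (Polynomial.finite_setOfPred_isRoot hp).subset fun c hc => ?_
  by_contra hroot
  apply hc
  have hpr : (Ideal.span {(Polynomial.X - Polynomial.C c : Polynomial K)}).IsPrime :=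
    (Ideal.span_singleton_prime (Polynomial.X_sub_C_ne_zero c)).2 (Polynomial.prime_X_sub_C c)
  obtain ⟨Q, hQ, hQc⟩ := hpP _ hpr (by
    rw [Ideal.mem_span_singleton, Polynomial.dvd_iff_isRoot]; exact hroot)
  have h1 : (Polynomial.X - Polynomial.C c : Polynomial K) ∈
      Q.comap (Polynomial.aeval (R := K) e).toRingHom := by
    rw [hQc]; exact Ideal.mem_span_singleton_self _
  have h2 : b' * algebraMap R B (a - algebraMap K R c * b) ∈ Q := by
    rw [← hec]
    simpa using h1
  have hbQ : algebraMap R B b ∉ Q := fun h => hQ.ne_top (Q.eq_top_of_isUnit_mem h hbu)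
  have h3 : algebraMap R B (a - algebraMap K R c * b) ∈ Q := by
    refine (hQ.mem_or_mem h2).resolve_left fun h => hQ.ne_top ?_
    rw [Ideal.eq_top_iff_one, ← hb']
    exact Q.mul_mem_right _ h
  obtain ⟨P, hP, hPQ⟩ := Ideal.exists_minimalPrimes_le
    (I := Ideal.span {a - algebraMap K R c * b}) (J := Q.comap (algebraMap R B))
    ((Ideal.span_singleton_le_iff_mem _).2 h3)
  exact ⟨P, hP, fun h => hbQ (hPQ h)⟩

theorem Ideal.eq_of_sub_mem_of_notMem {K : Type*} [Field K] [Algebra K R] {a b : R} {P : Ideal R}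
    (hb : b ∉ P) {c c' : K} (hc : a - algebraMap K R c * b ∈ P)
    (hc' : a - algebraMap K R c' * b ∈ P) : c = c' := by
  by_contra hne
  have h1 := P.sub_mem hc' hc
  have h2 : a - algebraMap K R c' * b - (a - algebraMap K R c * b) =
      algebraMap K R (c - c') * b := by rw [map_sub]; ring
  rw [h2] at h1
  refine hb ?_
  have h3 := P.mul_mem_left (algebraMap K R (c - c')⁻¹) h1
  rwa [← mul_assoc, ← map_mul, inv_mul_cancel₀ (sub_ne_zero.2 hne), map_one, one_mul] at h3

theorem infinite_hypersurfaceIdeal {K : Type*} [Field K] [IsAlgClosed K] [Algebra K R]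
    [IsDomain R] [Algebra.FiniteType K R] [IsDomain S] [IsNoetherianRing S] [Algebra K S]
    (f₁ f₂ : R →ₐ[K] S) (hf₁ : Function.Injective f₁) (hf₂ : Function.Injective f₂)
    {s : S} (hs0 : s ≠ 0)
    (hs₁ : ∀ Q, HeightOnePrime Q → s ∉ Q → Q.comap (f₁ : R →+* S) ≠ ⊥ →
      HeightOnePrime (Q.comap (f₁ : R →+* S)))
    (hs₂ : ∀ Q, HeightOnePrime Q → s ∉ Q → Q.comap (f₂ : R →+* S) ≠ ⊥ →
      HeightOnePrime (Q.comap (f₂ : R →+* S)))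
    {a b : R} (hb : b ≠ 0) (hab : ∀ c : K, a ≠ algebraMap K R c * b)
    (h : f₁ a * f₂ b = f₂ a * f₁ b) :
    {I : Ideal R | IsHypersurfaceIdeal I ∧
      properTransform (f₁ : R →+* S) I = properTransform (f₂ : R →+* S) I}.Infinite := by
  have _ : IsNoetherianRing R := Algebra.FiniteType.isNoetherianRing K R
  have ha : ∀ c : K, a - algebraMap K R c * b ≠ 0 := fun c => sub_ne_zero.2 (hab c)
  have hbad : ∀ f : R →ₐ[K] S, ∀ d : S, d ≠ 0 → {c : K | ∃ Q, HeightOnePrime Q ∧ d ∈ Q ∧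
      f (a - algebraMap K R c * b) ∈ Q ∧ f b ∉ Q}.Finite := fun f d hd => by
    refine ((finite_heightOnePrime hd).biUnion (t := fun Q => {c : K |
      f a - algebraMap K S c * f b ∈ Q ∧ f b ∉ Q}) fun Q _ => Set.Subsingleton.finite
        fun c hc c' hc' => Ideal.eq_of_sub_mem_of_notMem hc.2 hc.1 hc'.1).subset ?_
    rintro c ⟨Q, hQ, hdQ, hc, hcb⟩
    refine Set.mem_biUnion (x := Q) ⟨hQ, hdQ⟩ ⟨?_, hcb⟩
    simpa using hc
  have hfb₁ : f₁ b ≠ 0 := (map_ne_zero_iff f₁ hf₁).2 hb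
  have hfb₂ : f₂ b ≠ 0 := (map_ne_zero_iff f₂ hf₂).2 hb
  have hfin := ((finite_compl_openMinimalPrimes_nonempty hb hab).union
    (hbad f₁ (s * f₂ b) (mul_ne_zero hs0 hfb₂))).union
    (hbad f₂ (s * f₁ b) (mul_ne_zero hs0 hfb₁))
  have _ : Infinite K := IsAlgClosed.instInfinite
  refine (hfin.infinite_compl.image (f := fun c => sInf (openMinimalPrimes
    (a - algebraMap K R c * b) b)) ?_).mono ?_
  · intro c hc c' hc' hcc
    simp only [Set.compl_union, Set.mem_inter_iff, compl_compl] at hc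
    obtain ⟨P, hP⟩ := hc.1.1
    have hm : ∀ c : K, (sInf (openMinimalPrimes (a - algebraMap K R c * b) b)).minimalPrimes =
        openMinimalPrimes (a - algebraMap K R c * b) b := fun c =>
      minimalPrimes_sInf_of_heightOnePrime (finite_openMinimalPrimes _ b)
        fun P hP => heightOnePrime_of_mem_openMinimalPrimes (ha c) hP
    have hP' : P ∈ openMinimalPrimes (a - algebraMap K R c' * b) b := by
      rw [← hm c', ← show sInf _ = sInf _ from hcc, hm c]; exact hP
    exact Ideal.eq_of_sub_mem_of_notMem hP.2 (mem_of_mem_openMinimalPrimes hP)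
      (mem_of_mem_openMinimalPrimes hP')
  · rintro _ ⟨c, hc, rfl⟩
    simp only [Set.compl_union, Set.mem_inter_iff, compl_compl] at hc
    obtain ⟨⟨hne, hc₁⟩, hc₂⟩ := hc
    have hc₁' : ∀ Q, HeightOnePrime Q → s * f₂ b ∈ Q → f₁ (a - algebraMap K R c * b) ∈ Q →
        f₁ b ∈ Q := fun Q hQ h1 h2 => by
      by_contra h3
      exact hc₁ ⟨Q, hQ, h1, h2, h3⟩
    have hc₂' : ∀ Q, HeightOnePrime Q → s * f₁ b ∈ Q → f₂ (a - algebraMap K R c * b) ∈ Q →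
        f₂ b ∈ Q := fun Q hQ h1 h2 => by
      by_contra h3
      exact hc₂ ⟨Q, hQ, h1, h2, h3⟩
    have hcab : f₁ (a - algebraMap K R c * b) * f₂ b = f₂ (a - algebraMap K R c * b) * f₁ b := by
      rw [map_sub, map_sub, map_mul, map_mul, AlgHom.commutes, AlgHom.commutes, sub_mul, sub_mul, h]
      ring
    refine ⟨isHypersurfaceIdeal_sInf (finite_openMinimalPrimes _ b) hne
      fun P hP => heightOnePrime_of_mem_openMinimalPrimes (ha c) hP, le_antisymm ?_ ?_⟩
    · exact properTransform_sInf_openMinimalPrimes_le (f₁ := (f₂ : R →+* S)) (f₂ := (f₁ : R →+* S))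
        hf₂ hf₁ (ha c) hcab.symm hs₁ hc₂'
    · exact properTransform_sInf_openMinimalPrimes_le (f₁ := (f₁ : R →+* S)) (f₂ := (f₂ : R →+* S))
        hf₁ hf₂ (ha c) hcab hs₂ hc₁'

end ProperTransform

section

open MvPolynomial

theorem ValuationSubring.exists_algebraMap_eq_of_forall_valuation_le_one {T N L : Type*}
    [CommRing T] [IsDomain T] [UniqueFactorizationMonoid T] [Field N] [Algebra T N]
    [IsFractionRing T N] [Field L] [Algebra N L] [Algebra T L] [IsScalarTower T N L] (u : N)
    (h : ∀ (t : T) (W : ValuationSubring L), Prime t →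
      W.IsCenteredAt (algebraMap T L) (Ideal.span {t}) → W.valuation (algebraMap N L u) ≤ 1) :
    ∃ p : T, algebraMap T N p = u := by
  obtain ⟨a, b, hab, hu⟩ := IsFractionRing.exists_reduced_fraction (A := T) u
  have hb0 : (b : T) ≠ 0 := nonZeroDivisors.coe_ne_zero b
  have hinj : Function.Injective (algebraMap T L) := by
    rw [IsScalarTower.algebraMap_eq T N L]
    exact (algebraMap N L).injective.comp (IsFractionRing.injective T N)
  by_cases hbu : IsUnit (b : T)
  · obtain ⟨c, hc⟩ := hbu.exists_right_inv
    refine ⟨a * c, ?_⟩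
    rw [← hu, IsLocalization.eq_mk'_iff_mul_eq, ← map_mul, mul_assoc, mul_comm c, hc, mul_one]
  · obtain ⟨t, ht, htb⟩ := WfDvdMonoid.exists_irreducible_factor hbu hb0
    have htp : Prime t := UniqueFactorizationMonoid.irreducible_iff_prime.1 ht
    have _ : (Ideal.span {t}).IsPrime := (Ideal.span_singleton_prime htp.ne_zero).2 htp
    obtain ⟨W, hW⟩ := ValuationSubring.exists_isCenteredAt (algebraMap T L) hinj (Ideal.span {t})
    have hta : ¬ t ∣ a := fun hta => htp.not_isUnit (hab hta htb)
    have h1 := hW.eq_one (a := a) (by rwa [Ideal.mem_span_singleton])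
    have h2 : W.valuation (algebraMap T L b) < 1 :=
      (hW b).2.2 (Ideal.mem_span_singleton.2 htb)
    have h3 : algebraMap T L a = algebraMap N L u * algebraMap T L b := by
      rw [IsScalarTower.algebraMap_apply T N L, IsScalarTower.algebraMap_apply T N L, ← map_mul,
        ← hu, IsLocalization.mk'_spec]
    rw [h3, map_mul] at h1
    exact absurd h1 (ne_of_lt (lt_of_le_of_lt (mul_le_of_le_one_left' (h t W htp hW)) h2))

section Infinity

variable {κ K L : Type*} [DecidableEq κ] [Field K] [Field L] [Algebra K L]

/-- The ring homomorphism sending `X i` to the inverse of `z i` and each other variable `X j`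
to `z j`. -/
noncomputable def invCoord (K : Type*) [Field K] [Algebra K L] (z : κ → L) (i : κ) :
    MvPolynomial κ K →+* L :=
  (aeval (Function.update z i (z i)⁻¹) : MvPolynomial κ K →ₐ[K] L).toRingHom

/-- The polynomial obtained from `p` by reversing the powers of the variable `X i`. -/
noncomputable def reverseCoord (i : κ) (p : MvPolynomial κ K) : MvPolynomial κ K :=
  ∑ m ∈ p.support, monomial (m.update i (p.degreeOf i - m i)) (p.coeff m)

theorem invCoord_reverseCoord [Fintype κ] {z : κ → L} {i : κ} (hz : z i ≠ 0)
    (p : MvPolynomial κ K) :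
    invCoord K z i (reverseCoord i p) = aeval z p * (z i)⁻¹ ^ p.degreeOf i := by
  have h1 : aeval z p = ∑ m ∈ p.support, aeval z (monomial m (p.coeff m)) := by
    conv_lhs => rw [p.as_sum]
    rw [map_sum]
  rw [invCoord, reverseCoord, map_sum, h1, Finset.sum_mul]
  refine Finset.sum_congr rfl fun m hm => ?_
  have hmi : m i ≤ p.degreeOf i := monomial_le_degreeOf i hm
  rw [AlgHom.toRingHom_eq_coe, RingHom.coe_coe, aeval_monomial, aeval_monomial, mul_assoc]
  congr 1
  rw [Finsupp.prod_fintype _ _ (fun _ => pow_zero _), Finsupp.prod_fintype _ _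
      (fun _ => pow_zero _),
    ← Finset.mul_prod_erase _ _ (Finset.mem_univ i), ← Finset.mul_prod_erase _ _
        (Finset.mem_univ i)]
  have h2 : ∏ x ∈ Finset.univ.erase i, Function.update z i (z i)⁻¹ x ^
      (m.update i (p.degreeOf i - m i)) x = ∏ x ∈ Finset.univ.erase i, z x ^ m x := by
    refine Finset.prod_congr rfl fun j hj => ?_
    have hj' : j ≠ i := Finset.ne_of_mem_erase hj
    rw [Function.update_of_ne hj', Finsupp.coe_update, Function.update_of_ne hj']
  rw [h2, Finsupp.coe_update, Function.update_self, Function.update_self]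
  have h3 : (z i)⁻¹ ^ p.degreeOf i = (z i)⁻¹ ^ (m i) * (z i)⁻¹ ^ (p.degreeOf i - m i) := by
    rw [← pow_add, Nat.add_sub_cancel' hmi]
  rw [h3]
  have h4 : z i ^ m i * (z i)⁻¹ ^ m i = 1 := by
    rw [← mul_pow, mul_inv_cancel₀ hz, one_pow]
  linear_combination (- (z i)⁻¹ ^ (p.degreeOf i - m i) * ∏ x ∈ Finset.univ.erase i, z x ^ m x) * h4

theorem not_X_dvd_reverseCoord (i : κ) {p : MvPolynomial κ K} (hp : p ≠ 0) :
    ¬ X i ∣ reverseCoord i p := by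
  rintro ⟨r, hr⟩
  obtain ⟨m₀, hm₀, hd⟩ : ∃ m ∈ p.support, m i = p.degreeOf i := by
    rw [degreeOf_eq_sup]
    obtain ⟨m, hm, h⟩ := Finset.exists_mem_eq_sup p.support
      (MvPolynomial.support_nonempty.2 hp) (fun m => m i)
    exact ⟨m, hm, h.symm⟩
  have h1 : coeff (m₀.update i 0) (reverseCoord i p) = 0 := by
    rw [hr, mul_comm, coeff_mul_X']
    simp
  rw [reverseCoord, coeff_sum, Finset.sum_eq_single m₀] at h1
  · rw [hd, Nat.sub_self, coeff_monomial, if_pos rfl] at h1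
    exact (mem_support_iff.1 hm₀) h1
  · intro m hm hne
    rw [coeff_monomial, if_neg]
    intro h
    refine hne (Finsupp.ext fun j => ?_)
    have hj := DFunLike.congr_fun h j
    rw [Finsupp.coe_update, Finsupp.coe_update] at hj
    by_cases hji : j = i
    · subst hji
      rw [Function.update_self, Function.update_self] at hj
      have := monomial_le_degreeOf j hm
      omega
    · rwa [Function.update_of_ne hji, Function.update_of_ne hji] at hj
  · exact fun h => absurd hm₀ h

theorem ValuationSubring.IsCenteredAt.degreeOf_le [Fintype κ] {z : κ → L} {i : κ} (hz : z i ≠ 0)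
    {W : ValuationSubring L} (hW : W.IsCenteredAt (invCoord K z i) (Ideal.span {X i}))
    {p : MvPolynomial κ K} {n : ℕ} (hp : W.valuation (aeval z p * (z i)⁻¹ ^ n) ≤ 1) :
    p.degreeOf i ≤ n := by
  by_cases hp0 : p = 0
  · rw [hp0, degreeOf_zero]
    exact Nat.zero_le n
  by_contra! hlt
  have h1 := hW.eq_one (a := reverseCoord i p)
    (by rw [Ideal.mem_span_singleton]; exact not_X_dvd_reverseCoord i hp0)
  have h2 : W.valuation (z i)⁻¹ < 1 := by
    have := (hW (X i)).2.2 (Ideal.mem_span_singleton_self _)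
    simpa [invCoord] using this
  rw [invCoord_reverseCoord hz, ← Nat.add_sub_cancel' hlt.le, pow_add, ← mul_assoc, map_mul,
    map_pow] at h1
  refine absurd h1 (ne_of_lt (lt_of_le_of_lt (mul_le_of_le_one_left' hp) ?_))
  exact pow_lt_one₀ zero_le h2 (by omega)

theorem invCoord_injective [Fintype κ] {z : κ → L} {i : κ} (hz : z i ≠ 0)
    (hzi : AlgebraicIndependent K z) : Function.Injective (invCoord K z i) := by
  rw [injective_iff_map_eq_zero]
  intro p hp
  by_contra hp0
  have h1 := invCoord_reverseCoord (z := Function.update z i (z i)⁻¹) (i := i)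
    (by rw [Function.update_self]; exact inv_ne_zero hz) p
  have h2 : aeval (Function.update z i (z i)⁻¹) p = 0 := hp
  rw [h2, zero_mul, invCoord, Function.update_self, inv_inv, Function.update_idem,
    Function.update_eq_self] at h1
  have h3 : reverseCoord i p = 0 := (injective_iff_map_eq_zero _).1 hzi _ h1
  exact not_X_dvd_reverseCoord i hp0 (h3 ▸ dvd_zero _)

theorem isAlgebraic_invCoord [Fintype κ] [Algebra (MvPolynomial κ K) L]
    [Algebra.IsAlgebraic (MvPolynomial κ K) L] {z : κ → L} {i : κ} (hz : z i ≠ 0)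
    (haz : ∀ p : MvPolynomial κ K, aeval z p = algebraMap _ L p) :
    @Algebra.IsAlgebraic (MvPolynomial κ K) L _ _ (invCoord K z i).toAlgebra := by
  refine @Algebra.IsAlgebraic.mk _ _ _ _ (invCoord K z i).toAlgebra fun e => ?_
  obtain ⟨p, hp, hpe⟩ := Algebra.IsAlgebraic.isAlgebraic (R := MvPolynomial κ K) e
  let d : ℕ := p.support.sup fun j => (p.coeff j).degreeOf i
  let r : ℕ → MvPolynomial κ K := fun j =>
    reverseCoord i (p.coeff j) * X i ^ (d - (p.coeff j).degreeOf i)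
  have hr0 : ∀ j ∈ p.support, r j ≠ 0 := fun j hj => by
    refine mul_ne_zero (fun h => ?_) (pow_ne_zero _ (X_ne_zero i))
    exact not_X_dvd_reverseCoord i (Polynomial.mem_support_iff.1 hj) (h ▸ dvd_zero _)
  have hr : ∀ j ∈ p.support, invCoord K z i (r j) =
      algebraMap _ L (p.coeff j) * (z i)⁻¹ ^ d := fun j hj => by
    have h1 : (p.coeff j).degreeOf i ≤ d :=
      Finset.le_sup (f := fun j => (p.coeff j).degreeOf i) hj
    have h2 : invCoord K z i (X i) = (z i)⁻¹ := by simp [invCoord]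
    rw [map_mul, map_pow, invCoord_reverseCoord hz, haz, h2, mul_assoc, ← pow_add,
      Nat.add_sub_cancel' h1]
  refine ⟨∑ j ∈ p.support, Polynomial.monomial j (r j), fun h => ?_, ?_⟩
  · obtain ⟨j, hj⟩ := Polynomial.support_nonempty.2 hp
    have h3 := congrArg (fun q => Polynomial.coeff q j) h
    simp only [Polynomial.finsetSum_coeff, Polynomial.coeff_monomial, Finset.sum_ite_eq',
      Polynomial.coeff_zero, if_pos hj] at h3
    exact hr0 j hj h3
  · have h4 : ∑ j ∈ p.support, algebraMap _ L (p.coeff j) * e ^ j = 0 := by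
      rw [← hpe, Polynomial.aeval_eq_sum_range' (Nat.lt_succ_self _), Finset.sum_subset
        (Polynomial.supp_subset_range_natDegree_succ)]
      · simp only [Algebra.smul_def]
      · intro j _ hj
        rw [Polynomial.notMem_support_iff.1 hj, map_zero, zero_mul]
    have h5 : ∑ j ∈ p.support, invCoord K z i (r j) * e ^ j = 0 := by
      rw [← mul_zero ((z i)⁻¹ ^ d), ← h4, Finset.mul_sum]
      exact Finset.sum_congr rfl fun j hj => by rw [hr j hj]; ring
    let _ := (invCoord K z i).toAlgebra
    rw [Polynomial.aeval_def, Polynomial.eval₂_finsetSum]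
    simp only [Polynomial.eval₂_monomial]
    exact h5

end Infinity

theorem ValuationSubring.valuation_comap_le_one_iff {L M : Type*} [Field L] [Field M]
    (W : ValuationSubring M) (g : L →+* M) (x : L) :
    (W.comap g).valuation x ≤ 1 ↔ W.valuation (g x) ≤ 1 := by
  rw [ValuationSubring.valuation_le_one_iff, ValuationSubring.valuation_le_one_iff,
    ValuationSubring.mem_comap]

theorem ValuationSubring.valuation_lt_one_iff_inv {L : Type*} [Field L]
    (W : ValuationSubring L) (x : L) :
    W.valuation x < 1 ↔ x = 0 ∨ ¬ W.valuation x⁻¹ ≤ 1 := by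
  by_cases hx : x = 0
  · simp [hx]
  · rw [or_iff_right hx, map_inv₀, not_le, one_lt_inv₀]
    exact zero_lt_iff.2 ((map_ne_zero _).2 hx)

theorem ValuationSubring.IsCenteredAt.comap {T L M : Type*} [CommRing T] [Field L] [Field M]
    {W : ValuationSubring M} {φ : T →+* L} {Q : Ideal T} (g : L →+* M)
    (hW : W.IsCenteredAt (g.comp φ) Q) : (W.comap g).IsCenteredAt φ Q := by
  intro a
  refine ⟨(W.valuation_comap_le_one_iff g _).2 (hW a).1, ?_⟩
  rw [ValuationSubring.valuation_lt_one_iff_inv, W.valuation_comap_le_one_iff, map_inv₀,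
    ← map_eq_zero g, ← ValuationSubring.valuation_lt_one_iff_inv]
  exact (hW a).2

section Bound

variable {T L : Type*} [CommRing T] [IsDomain T] [Field L] [Algebra T L]
  [Algebra.IsAlgebraic T L]

theorem ValuationSubring.exists_valuation_mul_le_one (e : L) :
    ∃ s : T, s ≠ 0 ∧ ∀ W : ValuationSubring L, (∀ a, algebraMap T L a ∈ W) →
      W.valuation (algebraMap T L s * e) ≤ 1 := by
  obtain ⟨s, hs, hse⟩ := Algebra.IsAlgebraic.exists_integral_multiples T ({e} : Finset L)
  refine ⟨s, hs, fun W hW => ?_⟩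
  rw [ValuationSubring.valuation_le_one_iff, ← Algebra.smul_def]
  exact W.mem_of_isIntegral hW (hse e (Finset.mem_singleton_self e))

theorem ValuationSubring.exists_valuation_pow_mul_le_one [FaithfulSMul T L] [WfDvdMonoid T] {t : T}
    (ht : Prime t)
    (e : L) : ∃ n : ℕ, ∀ W : ValuationSubring L,
      W.IsCenteredAt (algebraMap T L) (Ideal.span {t}) →
      W.valuation (algebraMap T L t ^ n * e) ≤ 1 := by
  obtain ⟨s, hs, hse⟩ := ValuationSubring.exists_valuation_mul_le_one (T := T) e
  obtain ⟨n, c, hc, rfl⟩ := WfDvdMonoid.max_power_factor hs ht.irreducible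
  refine ⟨n, fun W hW => ?_⟩
  have h1 := hse W hW.mem
  have h2 := hW.eq_one (a := c) (by rwa [Ideal.mem_span_singleton])
  rwa [map_mul (algebraMap T L), map_pow, mul_right_comm, map_mul W.valuation, h2, mul_one] at h1

end Bound


theorem finiteDimensional_of_forall_valuation_le_one {κ K N L : Type*} [Fintype κ] [DecidableEq κ]
    [Field K] [CharZero K] [Field N] [Field L] [IsAlgClosed L] [Algebra K L] [Algebra K N]
    [Algebra (MvPolynomial κ K) N] [IsFractionRing (MvPolynomial κ K) N]
    [Algebra (MvPolynomial κ K) L] [Algebra N L] [IsScalarTower (MvPolynomial κ K) N L]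
    [IsScalarTower K (MvPolynomial κ K) N] [IsScalarTower K (MvPolynomial κ K) L]
    [IsScalarTower K N L] [Algebra.IsAlgebraic (MvPolynomial κ K) L]
    (E : IntermediateField N L) [FiniteDimensional N E]
    {s : MvPolynomial κ K} (hs : s ≠ 0) (M : ℕ) (V : Submodule K L)
    (hE : ∀ ξ ∈ V, ξ ∈ E)
    (hfin : ∀ ξ ∈ V, ∀ (t : MvPolynomial κ K) (W : ValuationSubring L), Prime t →
      W.IsCenteredAt (algebraMap (MvPolynomial κ K) L) (Ideal.span {t}) →
      W.valuation (algebraMap _ L s * ξ) ≤ 1)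
    (hinf : ∀ ξ ∈ V, ∀ (i : κ) (W : ValuationSubring L),
      W.IsCenteredAt (invCoord K (fun j => algebraMap (MvPolynomial κ K) L (X j)) i)
        (Ideal.span {X i}) →
      W.valuation ((algebraMap (MvPolynomial κ K) L (X i))⁻¹ ^ M * ξ) ≤ 1) :
    FiniteDimensional K V := by
  classical
  let T := MvPolynomial κ K
  let z : κ → L := fun j => algebraMap T L (X j)
  have hinj : Function.Injective (algebraMap T L) := by
    rw [IsScalarTower.algebraMap_eq T N L]
    exact (algebraMap N L).injective.comp (IsFractionRing.injective T N)
  have haz : ∀ p : T, aeval z p = algebraMap T L p := fun p => by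
    have : aeval z = IsScalarTower.toAlgHom K T L := algHom_ext (fun j => by rw [aeval_X]; rfl)
    rw [this]; rfl
  have hz : ∀ i, z i ≠ 0 := fun i h => X_ne_zero i (hinj (h.trans (map_zero _).symm))
  have _ : Algebra.IsAlgebraic N L :=
    (IsFractionRing.comap_isAlgebraic_iff (A := T) (K := N) (C := L)).1 inferInstance
  have _ : IsAlgClosure N L := ⟨inferInstance, inferInstance⟩
  have _ : Normal N L := IsAlgClosure.normal N L
  have _ : CharZero N := charZero_of_injective_algebraMap (algebraMap K N).injective
  have hzi : AlgebraicIndependent K z := by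
    rw [AlgebraicIndependent]
    intro p q h
    exact hinj (by rwa [← haz, ← haz])
  have halg : ∀ i, @Algebra.IsAlgebraic (MvPolynomial κ K) L _ _ (invCoord K z i).toAlgebra :=
    fun i => isAlgebraic_invCoord (hz i) haz
  obtain ⟨κ', b, hb⟩ := FiniteDimensional.exists_is_basis_integral T N E
  have hbd : ∀ (i : κ) (k : κ'), ∃ n : ℕ, ∀ W : ValuationSubring L,
      W.IsCenteredAt (invCoord K z i) (Ideal.span {X i}) →
      W.valuation ((z i)⁻¹ ^ n * (b k : L)) ≤ 1 := fun i k => by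
    let _ := (invCoord K z i).toAlgebra
    have _ : Algebra.IsAlgebraic (MvPolynomial κ K) L := halg i
    have _ : FaithfulSMul (MvPolynomial κ K) L :=
      (faithfulSMul_iff_algebraMap_injective _ _).2 (invCoord_injective (hz i) hzi)
    obtain ⟨n, hn⟩ := ValuationSubring.exists_valuation_pow_mul_le_one
      (X_prime : Prime (X i : MvPolynomial κ K)) (b k : L)
    refine ⟨n, fun W hW => ?_⟩
    have h1 := hn W hW
    have h2 : algebraMap (MvPolynomial κ K) L (X i) = (z i)⁻¹ := by
      change invCoord K z i (X i) = _
      simp [invCoord]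
    rwa [h2] at h1
  choose m hm using hbd
  let n : ℕ := Finset.univ.sup fun q : κ × κ' => M + m q.1 q.2 + s.degreeOf q.1
  let S := algebraMap N E (algebraMap T N s)
  have hS : (S : L) = algebraMap T L s := by
    change algebraMap N L _ = _
    rw [← IsScalarTower.algebraMap_apply]
  let Q : Submodule K N :=
    (restrictDegree κ K n).map (IsScalarTower.toAlgHom K T N).toLinearMap
  have key : ∀ (ξ : E) (k : κ'), (ξ : L) ∈ V → Algebra.trace N E (S * ξ * b k) ∈ Q := by
    intro ξ k hξ
    have htr := trace_eq_sum_embeddings (K := N) (L := E) L (x := S * ξ * b k)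
    have hτ : ∀ (τ : E →ₐ[N] L) (x : E), τ.liftNormal L (x : L) = τ x :=
      fun τ x => τ.liftNormal_commutes L x
    have hle : ∀ (W : ValuationSubring L) (x : L), (∀ τ : E →ₐ[N] L,
        (W.comap (τ.liftNormal L : L →+* L)).valuation (x * (S * ξ * b k : E)) ≤ 1) →
        (∃ y : N, x = algebraMap N L y) →
        W.valuation (x * algebraMap N L (Algebra.trace N E (S * ξ * b k))) ≤ 1 := by
      rintro W _ h ⟨y, rfl⟩
      rw [htr, Finset.mul_sum]
      refine Valuation.map_sum_le _ fun τ _ => ?_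
      have h1 := (W.valuation_comap_le_one_iff _ _).1 (h τ)
      rwa [RingHom.coe_coe, map_mul, AlgHom.commutes, hτ] at h1
    have hcomp : ∀ (g : L →ₐ[N] L), (g : L →+* L).comp (algebraMap T L) = algebraMap T L :=
      fun g => by
        refine RingHom.ext fun x => ?_
        rw [IsScalarTower.algebraMap_eq T N L]
        exact g.commutes _
    obtain ⟨p, hp⟩ := ValuationSubring.exists_algebraMap_eq_of_forall_valuation_le_one (T := T)
      (L := L) (Algebra.trace N E (S * ξ * b k)) (fun t W ht hW => by
        have := hle W 1 (fun τ => by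
          have hWτ : (W.comap (τ.liftNormal L : L →+* L)).IsCenteredAt (algebraMap T L)
              (Ideal.span {t}) := ValuationSubring.IsCenteredAt.comap _ (by rwa [hcomp])
          have h1 := hfin ξ hξ t _ ht hWτ
          have h2 : IsIntegral T (b k : L) := (hb k).map (E.val.restrictScalars T)
          have h3 := (ValuationSubring.valuation_le_one_iff _ _).2
            (ValuationSubring.mem_of_isIntegral hWτ.mem h2)
          have h4 := mul_le_one' h1 h3
          rw [← map_mul] at h4
          rw [one_mul, MulMemClass.coe_mul, MulMemClass.coe_mul, hS]
          exact h4) ⟨1, (map_one _).symm⟩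
        rwa [one_mul] at this)
    refine ⟨p, ?_, hp⟩
    refine (mem_restrictDegree _ _ _).2 fun q hq i => (monomial_le_degreeOf i hq).trans ?_
    refine le_trans ?_ (Finset.le_sup (f := fun q : κ × κ' => M + m q.1 q.2 + s.degreeOf q.1)
      (Finset.mem_univ (i, k)))
    have _ : (Ideal.span {(X i : MvPolynomial κ K)}).IsPrime :=
      (Ideal.span_singleton_prime (X_ne_zero i)).2 X_prime
    obtain ⟨W, hW⟩ := ValuationSubring.exists_isCenteredAt (invCoord K z i)
      (invCoord_injective (hz i) hzi) (Ideal.span {X i})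
    refine hW.degreeOf_le (hz i) ?_
    have hcomp' : ∀ (g : L →ₐ[N] L), (g : L →+* L).comp (invCoord K z i) = invCoord K z i :=
      fun g => by
        have hgz : ∀ j, g (z j) = z j := fun j => by
          have := RingHom.congr_fun (hcomp g) (X j)
          exact this
        have h1 : ((g.restrictScalars K).comp (aeval (Function.update z i (z i)⁻¹)) :
            MvPolynomial κ K →ₐ[K] L) = aeval (Function.update z i (z i)⁻¹) := by
          refine algHom_ext fun j => ?_
          rw [AlgHom.comp_apply, aeval_X]
          change g _ = _
          by_cases hj : j = i
          · subst hj
            rw [Function.update_self, map_inv₀, hgz]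
          · rw [Function.update_of_ne hj, hgz]
        refine RingHom.ext fun x => ?_
        exact AlgHom.congr_fun h1 x
    have h0 := hle W ((z i)⁻¹ ^ (M + m i k + s.degreeOf i)) (fun τ => by
      have hWτ : (W.comap (τ.liftNormal L : L →+* L)).IsCenteredAt (invCoord K z i)
          (Ideal.span {X i}) := ValuationSubring.IsCenteredAt.comap _ (by rwa [hcomp'])
      have h1 := hinf ξ hξ i _ hWτ
      have h2 := hm i k _ hWτ
      have h3 := (hWτ (reverseCoord i s)).1
      rw [invCoord_reverseCoord (hz i), haz] at h3
      have h4 := mul_le_one' (mul_le_one' h1 h2) h3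
      rw [← map_mul, ← map_mul] at h4
      rw [MulMemClass.coe_mul, MulMemClass.coe_mul, hS]
      convert h4 using 2
      change _ = ((z i)⁻¹ ^ M * ξ) * ((z i)⁻¹ ^ m i k * b k) *
        (algebraMap T L s * (z i)⁻¹ ^ s.degreeOf i)
      ring) ⟨(algebraMap T N (X i))⁻¹ ^ (M + m i k + s.degreeOf i), by
        rw [map_pow, map_inv₀, ← IsScalarTower.algebraMap_apply]⟩
    have hp' : algebraMap T N p = Algebra.trace N E (S * ξ * b k) := hp
    rwa [← hp', ← IsScalarTower.algebraMap_apply, mul_comm, ← haz] at h0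
  have hQ : Module.Finite K Q := by
    have _ : Module.Finite K (restrictDegree κ K n) := inferInstance
    exact inferInstance
  let Ψ : V →ₗ[K] (κ' → Q) := LinearMap.pi fun k =>
    { toFun := fun ξ => ⟨Algebra.trace N E (S * ⟨ξ, hE ξ ξ.2⟩ * b k), key _ k ξ.2⟩
      map_add' := fun ξ η => by
        refine Subtype.ext ?_
        change Algebra.trace N E _ = Algebra.trace N E _ + Algebra.trace N E _
        rw [← map_add, ← add_mul, ← mul_add]
        rfl
      map_smul' := fun c ξ => by
        refine Subtype.ext ?_
        change Algebra.trace N E _ = c • Algebra.trace N E _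
        rw [← algebraMap_smul N c (Algebra.trace N E _), ← map_smul, ← smul_mul_assoc,
          ← mul_smul_comm]
        congr 3
        refine Subtype.ext ?_
        change c • (ξ : L) = algebraMap K N c • (ξ : L)
        rw [algebraMap_smul] }
  refine Module.Finite.of_injective Ψ ?_
  rw [injective_iff_map_eq_zero]
  intro ξ hξ
  have h1 : ∀ k, Algebra.trace N E (S * ⟨ξ, hE ξ ξ.2⟩ * b k) = 0 := fun k =>
    congrArg Subtype.val (congrFun hξ k)
  have h2 : S * ⟨ξ, hE ξ ξ.2⟩ = 0 := by
    refine (traceForm_nondegenerate N E).1 _ fun x => ?_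
    have h3 : Algebra.traceForm N E (S * ⟨ξ, hE ξ ξ.2⟩) = 0 := b.ext fun k => h1 k
    rw [h3, LinearMap.zero_apply]
  have h3 := congrArg (algebraMap E L) h2
  rw [map_mul, map_zero] at h3
  have h4 : algebraMap T L s * (ξ : L) = 0 := by
    rw [← hS]
    exact h3
  refine Subtype.ext ((mul_eq_zero.1 h4).resolve_left fun h => hs (hinj ?_))
  rw [h, map_zero]

end

section

open Polynomial

/-- A finite extension of an integrally closed domain of characteristic zero has a primitive
element, up to denominators. -/
theorem exists_primitive_integral_element (A : Type*) {R : Type*} [CommRing A] [IsDomain A]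
    [IsIntegrallyClosed A] [CharZero A] [CommRing R] [IsDomain R] [Algebra A R] [FaithfulSMul A R]
    [Module.Finite A R] :
    ∃ (f : A[X]) (y β : R), f.Monic ∧ aeval y f = 0 ∧ aeval y f.derivative ≠ 0 ∧ β ≠ 0 ∧
      ∀ r, ∃ q : A[X], β * r = aeval y q := by
  classical
  let N := FractionRing A
  let F := FractionRing R
  let _ : Algebra N F := FractionRing.liftAlgebra A F
  have _ : IsScalarTower A N F := FractionRing.isScalarTower_liftAlgebra A F
  have _ : CharZero N := IsFractionRing.charZero A
  have hRF := IsFractionRing.injective R F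
  have hAN := IsFractionRing.injective A N
  have hIntg : Algebra.IsIntegral A R := inferInstance
  have _ : Algebra.IsAlgebraic A R := inferInstance
  have hfrac : ∀ e : F, ∃ (r : R) (d : A), d ≠ 0 ∧ algebraMap A F d * e = algebraMap R F r := by
    intro e
    obtain ⟨r, s, hs, rfl⟩ := IsFractionRing.div_surjective (A := R) e
    have hs0 : s ≠ 0 := nonZeroDivisors.ne_zero hs
    obtain ⟨d, hd, c, hc⟩ := (Algebra.IsAlgebraic.isAlgebraic (R := A) s).exists_nonzero_dvd
      (mem_nonZeroDivisors_of_ne_zero hs0)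
    refine ⟨c * r, d, hd, ?_⟩
    have hs1 : algebraMap R F s ≠ 0 := fun h => hs0 (hRF (h.trans (map_zero _).symm))
    rw [IsScalarTower.algebraMap_apply A R F, hc, map_mul, map_mul, mul_div_assoc', div_eq_iff hs1]
    ring
  obtain ⟨G, hG⟩ := (Module.Finite.fg_top : (⊤ : Submodule A R).FG)
  have hspan : ∀ r : R, algebraMap R F r ∈ Submodule.span N (G.image (algebraMap R F) : Set F) := by
    intro r
    have hr : r ∈ Submodule.span A (G : Set R) := hG ▸ Submodule.mem_top
    induction hr using Submodule.span_induction with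
    | mem x hx => exact Submodule.subset_span (Finset.mem_coe.2 (Finset.mem_image_of_mem _ hx))
    | zero => rw [map_zero]; exact zero_mem _
    | add x y _ _ hx hy => rw [map_add]; exact add_mem hx hy
    | smul a x _ hx =>
      rw [Algebra.smul_def, map_mul, ← IsScalarTower.algebraMap_apply,
        IsScalarTower.algebraMap_apply A N F, ← Algebra.smul_def]
      exact Submodule.smul_mem _ _ hx
  have _ : FiniteDimensional N F := by
    refine ⟨⟨G.image (algebraMap R F), Submodule.eq_top_iff'.2 fun e => ?_⟩⟩
    obtain ⟨r, d, hd, he⟩ := hfrac e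
    have hd' : algebraMap A N d ≠ 0 := fun h => hd (hAN (h.trans (map_zero _).symm))
    have : e = (algebraMap A N d)⁻¹ • algebraMap R F r := by
      rw [← he, IsScalarTower.algebraMap_apply A N F, ← Algebra.smul_def, inv_smul_smul₀ hd']
    rw [this]
    exact Submodule.smul_mem _ _ (hspan r)
  obtain ⟨α, hα⟩ := Field.exists_primitive_element N F
  obtain ⟨y, d, hd, hy⟩ := hfrac α
  have hd' : algebraMap A N d ≠ 0 := fun h => hd (hAN (h.trans (map_zero _).symm))
  have hytop : IntermediateField.adjoin N {algebraMap R F y} = ⊤ := by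
    rw [eq_top_iff, ← hα, IntermediateField.adjoin_simple_le_iff]
    have : α = (algebraMap A N d)⁻¹ • algebraMap R F y := by
      rw [← hy, IsScalarTower.algebraMap_apply A N F, ← Algebra.smul_def, inv_smul_smul₀ hd']
    rw [this]
    exact (IntermediateField.adjoin N {algebraMap R F y}).smul_mem
      (IntermediateField.mem_adjoin_simple_self N _)
  have hyint : IsIntegral A y := Algebra.IsIntegral.isIntegral y
  have hpoly : ∀ e : F, ∃ q : N[X], aeval (algebraMap R F y) q = e := by
    intro e
    have h1 : e ∈ (IntermediateField.adjoin N {algebraMap R F y}).toSubalgebra := by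
      rw [hytop]; exact IntermediateField.mem_top
    rw [IntermediateField.adjoin_simple_toSubalgebra_of_isAlgebraic
      (Algebra.IsAlgebraic.isAlgebraic _), Algebra.adjoin_singleton_eq_range_aeval] at h1
    exact h1
  have hmul : ∀ r : R, ∃ β : A, β ≠ 0 ∧ ∃ q : A[X], algebraMap A R β * r = aeval y q := by
    intro r
    obtain ⟨q, hq⟩ := hpoly (algebraMap R F r)
    obtain ⟨b, hb, hbq⟩ := IsLocalization.integerNormalization_spec (R := A) (nonZeroDivisors A) q
    refine ⟨b, nonZeroDivisors.ne_zero hb, IsLocalization.integerNormalization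
        (nonZeroDivisors A) q, hRF ?_⟩
    rw [← aeval_algebraMap_apply, ← aeval_map_algebraMap N, hbq, map_mul, ← hq,
      ← algebraMap_smul N b q, map_smul, Algebra.smul_def, ← IsScalarTower.algebraMap_apply,
      ← IsScalarTower.algebraMap_apply]
  choose b hb0 hbq using hmul
  let β : A := ∏ r ∈ G, b r
  have hβ0 : β ≠ 0 := Finset.prod_ne_zero_iff.2 fun r _ => hb0 r
  refine ⟨minpoly A y, y, algebraMap A R β, minpoly.monic hyint, minpoly.aeval A y, fun h => ?_,
    fun h => hβ0 ((FaithfulSMul.algebraMap_injective A R) (h.trans (map_zero _).symm)), fun r => ?_⟩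
  · have h1 : aeval (algebraMap R F y) (minpoly N (algebraMap R F y)).derivative ≠ 0 :=
      (Algebra.IsSeparable.isSeparable N (algebraMap R F y)).aeval_derivative_ne_zero
        (minpoly.aeval N (algebraMap R F y))
    rw [minpoly.isIntegrallyClosed_eq_field_fractions N F hyint, derivative_map,
      aeval_map_algebraMap, aeval_algebraMap_apply, h, map_zero] at h1
    exact h1 rfl
  · have hr : r ∈ Submodule.span A (G : Set R) := hG ▸ Submodule.mem_top
    induction hr using Submodule.span_induction with
    | mem x hx =>
      obtain ⟨q, hq⟩ := hbq x
      refine ⟨C (∏ r ∈ G.erase x, b r) * q, ?_⟩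
      rw [map_mul, aeval_C, ← hq, ← mul_assoc, ← map_mul]
      congr 2
      rw [mul_comm]
      exact (Finset.mul_prod_erase G b hx).symm
    | zero => exact ⟨0, by rw [mul_zero, map_zero]⟩
    | add x z _ _ hx hz =>
      obtain ⟨q, hq⟩ := hx
      obtain ⟨q', hq'⟩ := hz
      exact ⟨q + q', by rw [mul_add, hq, hq', map_add]⟩
    | smul a x _ hx =>
      obtain ⟨q, hq⟩ := hx
      exact ⟨a • q, by rw [mul_smul_comm, hq, map_smul]⟩

end

section

open MvPolynomial

theorem exists_ne_zero_forall_not_dvd {T α : Type*} [CommRing T] [IsDomain T] [Finite α]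
    {p : α → T → Prop} (h : ∀ i, ∃ s : T, s ≠ 0 ∧ ∀ t, ¬ t ∣ s → p i t) :
    ∃ s : T, s ≠ 0 ∧ ∀ t, ¬ t ∣ s → ∀ i, p i t := by
  have _ := Fintype.ofFinite α
  choose s hs h using h
  exact ⟨∏ i, s i, Finset.prod_ne_zero_iff.2 fun i _ => hs i, fun t ht i =>
    h i t fun hd => ht (hd.trans (Finset.dvd_prod_of_mem s (Finset.mem_univ i)))⟩

theorem exists_ne_zero_forall_valuation_mul_le_one {T L α : Type*} [CommRing T] [IsDomain T]
    [Field L]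
    [Algebra T L] [Algebra.IsAlgebraic T L] [Finite α] (e : α → L) :
    ∃ s : T, s ≠ 0 ∧ ∀ W : ValuationSubring L, (∀ a, algebraMap T L a ∈ W) →
      ∀ i, W.valuation (algebraMap T L s * e i) ≤ 1 := by
  have _ := Fintype.ofFinite α
  classical
  choose s hs h using fun i => ValuationSubring.exists_valuation_mul_le_one (T := T) (e i)
  refine ⟨∏ i, s i, Finset.prod_ne_zero_iff.2 fun i _ => hs i, fun W hW i => ?_⟩
  rw [← Finset.prod_erase_mul _ _ (Finset.mem_univ i), map_mul (algebraMap T L), mul_assoc,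
    map_mul W.valuation]
  exact mul_le_one' ((W.valuation_le_one_iff _).2 (hW _)) (h i W hW)

theorem ValuationSubring.IsCenteredAt.exists_pow_eq_pow {T N L : Type*}
    [CommRing T] [IsDomain T] [WfDvdMonoid T] [Field N] [Field L] [Algebra T N] [IsFractionRing T N]
    [Algebra T L] [FaithfulSMul T L] [Algebra N L] [IsScalarTower T N L]
    (E : IntermediateField N L) [FiniteDimensional N E] {W : ValuationSubring L}
    {t : T} (ht : Prime t)
    (hW : W.IsCenteredAt (algebraMap T L) (Ideal.span {t})) {u : L} (hu : u ∈ E)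
    (hu0 : u ≠ 0) (hu1 : W.valuation u < 1) : ∃ n k : ℕ, n ≠ 0 ∧ k ≠ 0 ∧
      W.valuation u ^ n = W.valuation (algebraMap T L t) ^ k := by
  obtain ⟨p, hp, hpu, hd⟩ := IsFractionRing.exists_poly_natDegree_le (T := T) E hu
  obtain ⟨k, hk⟩ := hW.factorial_pow ht hu0 hp hpu hd
  have hlt : W.valuation u ^ (Module.finrank N E).factorial < 1 :=
    pow_lt_one₀ zero_le hu1 (Nat.factorial_ne_zero _)
  have hk0 : 0 < k := by
    by_contra! hk0
    obtain ⟨m, rfl⟩ := Int.exists_eq_neg_ofNat hk0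
    rw [hk, zpow_neg, zpow_natCast] at hlt
    refine hlt.not_ge ((one_le_inv₀ (pow_pos (hW.pos ht) _)).2 (pow_le_one₀ zero_le hW.lt_one.le))
  lift k to ℕ using hk0.le
  exact ⟨_, k, Nat.factorial_ne_zero _, by omega, by rw [hk, zpow_natCast]⟩

section Coordinates

variable {κ K L : Type*} [Field K] [Field L]
  [Algebra K L] [Algebra (MvPolynomial κ K) L] [IsScalarTower K (MvPolynomial κ K) L]

theorem aeval_algebraMap_X (p : MvPolynomial κ K) :
    aeval (fun l => algebraMap (MvPolynomial κ K) L (X l)) p = algebraMap _ L p := by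
  exact (aeval_algebraMap_apply L X p).trans (by rw [aeval_X_left_apply])

theorem ValuationSubring.valuation_algebraMap_eq_one {W : ValuationSubring L}
    (hW : ∀ p : MvPolynomial κ K, algebraMap _ L p ∈ W) {c : K} (hc : c ≠ 0) :
    W.valuation (algebraMap K L c) = 1 := by
  have h (c : K) : W.valuation (algebraMap K L c) ≤ 1 :=
    (W.valuation_le_one_iff _).2 (by
      rw [IsScalarTower.algebraMap_apply K (MvPolynomial κ K) L]; exact hW _)
  refine (h c).antisymm ?_
  have h1 := h c⁻¹
  rw [map_inv₀, map_inv₀] at h1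
  exact (inv_le_one₀ (zero_lt_iff.2 ((map_ne_zero _).2 ((map_ne_zero _).2 hc)))).1 h1

theorem exists_coordDerivation [CharZero K] [FaithfulSMul (MvPolynomial κ K) L]
    [Algebra.IsAlgebraic (MvPolynomial κ K) L] :
    ∃ δ : κ → Derivation K L L, ∀ l (p : MvPolynomial κ K),
      δ l (algebraMap _ L p) = algebraMap _ L (pderiv l p) := by
  have _ : CharZero L := charZero_of_injective_algebraMap (algebraMap K L).injective
  choose δ hδ using fun l => Derivation.exists_extension (L := L)
    ((Algebra.linearMap (MvPolynomial κ K) L).compDer (pderiv (R := K) l))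
  exact ⟨δ, fun l p => hδ l p⟩

theorem Derivation.exists_ne_zero_isIntegral_mul [Fintype κ]
    [Algebra.IsAlgebraic (MvPolynomial κ K) L] (D : Derivation K L L) :
    ∃ c : MvPolynomial κ K, c ≠ 0 ∧ ∀ p : MvPolynomial κ K,
      IsIntegral (MvPolynomial κ K) (algebraMap _ L c * D (algebraMap _ L p)) := by
  classical
  obtain ⟨c, hc, h⟩ := Algebra.IsAlgebraic.exists_integral_multiples (MvPolynomial κ K)
    (Finset.univ.image fun l => D (algebraMap (MvPolynomial κ K) L (X l)))
  refine ⟨c, hc, fun p => ?_⟩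
  rw [← aeval_algebraMap_X p, D.apply_mvPolynomial_aeval, Finset.mul_sum]
  refine IsIntegral.sum _ fun l _ => ?_
  rw [aeval_algebraMap_X, mul_left_comm, ← Algebra.smul_def c]
  exact isIntegral_algebraMap.mul (h _ (Finset.mem_image_of_mem _ (Finset.mem_univ l)))

variable [CharZero K] [Fintype κ] {N : Type*} [Field N]
  [Algebra (MvPolynomial κ K) N]
  [IsFractionRing (MvPolynomial κ K) N] [Algebra N L] [IsScalarTower (MvPolynomial κ K) N L]
  [Algebra.IsAlgebraic (MvPolynomial κ K) L]

theorem Derivation.exists_ne_zero_forall_valuation_le_one {α : Type*} [Finite α]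
    [FaithfulSMul (MvPolynomial κ K) L] (D : α → Derivation K L L) (E : IntermediateField N L)
    [FiniteDimensional N E] :
    ∃ s : MvPolynomial κ K, s ≠ 0 ∧ ∀ t, ¬ t ∣ s → ∀ i (W : ValuationSubring L), Prime t →
      W.IsCenteredAt (algebraMap (MvPolynomial κ K) L) (Ideal.span {t}) →
      ∀ e ∈ E, W.valuation e ≤ 1 → W.valuation (D i e) ≤ 1 := by
  have _ : CharZero L := charZero_of_injective_algebraMap (algebraMap K L).injective
  refine exists_ne_zero_forall_not_dvd fun i => ?_
  obtain ⟨c, hc, h⟩ := (D i).exists_ne_zero_isIntegral_mul (κ := κ)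
  obtain ⟨s, hs, hs'⟩ := Derivation.exists_forall_valuation_le_one (N := N)
    ((D i).restrictScalars ℤ) hc h E
  exact ⟨s, hs, fun t ht W htp hW e he => hs' t W htp ht hW e he⟩

end Coordinates

/-- A Noether normalisation `x` of an algebra, together with a monic polynomial `f` with a simple
root `y` which generates the algebra up to the denominator `β`. -/
structure NoetherModel (K R : Type*) [Field K] [CommRing R] [Algebra K R] where
  /-- the number of coordinates -/
  n : ℕ
  /-- the coordinates -/
  x : Fin n → R
  /-- the polynomial satisfied by the primitive element -/
  f : Polynomial (MvPolynomial (Fin n) K)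
  /-- the primitive element -/
  y : R
  /-- the common denominator -/
  β : R
  isIntegral : (aeval x : MvPolynomial (Fin n) K →ₐ[K] R).toRingHom.IsIntegral
  algebraicIndependent : AlgebraicIndependent K x
  monic : f.Monic
  eval_eq_zero : (f.map (aeval x : MvPolynomial (Fin n) K →ₐ[K] R).toRingHom).eval y = 0
  eval_derivative_ne_zero :
    (f.map (aeval x : MvPolynomial (Fin n) K →ₐ[K] R).toRingHom).derivative.eval y ≠ 0
  beta_ne_zero : β ≠ 0
  exists_mul_eq : ∀ r, ∃ q : Polynomial (MvPolynomial (Fin n) K),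
    β * r = (q.map (aeval x : MvPolynomial (Fin n) K →ₐ[K] R).toRingHom).eval y

theorem NoetherModel.nonempty (K R : Type*) [Field K] [CharZero K] [CommRing R] [IsDomain R]
    [Algebra K R] [Algebra.FiniteType K R] : Nonempty (NoetherModel K R) := by
  obtain ⟨n, g, hg, hfin⟩ := exists_finite_inj_algHom_of_fg K R
  let _ : Algebra (MvPolynomial (Fin n) K) R := g.toRingHom.toAlgebra
  have hmap : algebraMap (MvPolynomial (Fin n) K) R = g.toRingHom := rfl
  have _ : FaithfulSMul (MvPolynomial (Fin n) K) R :=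
    (faithfulSMul_iff_algebraMap_injective _ _).2 hg
  have _ : Module.Finite (MvPolynomial (Fin n) K) R := hfin
  obtain ⟨f, y, β, hf, hy, hy', hβ, h⟩ :=
    exists_primitive_integral_element (MvPolynomial (Fin n) K) (R := R)
  have hgx : g = aeval fun i => g (X i) := by ext i; simp
  have hmap' : algebraMap (MvPolynomial (Fin n) K) R =
      (aeval fun i => g (X i) : MvPolynomial (Fin n) K →ₐ[K] R).toRingHom := by
    rw [hmap, ← hgx]
  refine ⟨⟨n, fun i => g (X i), f, y, β, ?_, ?_, hf, ?_, ?_, hβ, fun r => ?_⟩⟩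
  · rw [← hgx]; exact hfin.to_isIntegral
  · rw [algebraicIndependent_iff_injective_aeval, ← hgx]; exact hg
  · rw [← hmap', Polynomial.eval_map_algebraMap]; exact hy
  · rw [← hmap', Polynomial.derivative_map, Polynomial.eval_map_algebraMap]; exact hy'
  · obtain ⟨q, hq⟩ := h r
    exact ⟨q, by rw [← hmap', Polynomial.eval_map_algebraMap]; exact hq⟩

namespace NoetherModel

section Pairing

variable {K R F L : Type*} [Field K] [CommRing R] [Algebra K R]
  [Field F] [Algebra R F] [Algebra K F] [Field L] [Algebra K L]

/-- The value on `D` of the pull back along `σ` of the differential form with coordinates `w`. -/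
noncomputable def pairing (M : NoetherModel K R) (σ : F →ₐ[K] L) (D : Derivation K L L) :
    (Fin M.n → F) →ₗ[K] L :=
  ∑ j, LinearMap.mulLeft K (D (σ (algebraMap R F (M.x j)))) ∘ₗ σ.toLinearMap ∘ₗ LinearMap.proj j

theorem pairing_apply (M : NoetherModel K R) (σ : F →ₐ[K] L) (D : Derivation K L L)
    (w : Fin M.n → F) : M.pairing σ D w = ∑ j, D (σ (algebraMap R F (M.x j))) * σ (w j) := by
  simp [pairing]

variable [IsScalarTower K R F]

/-- The form with coordinates `w` pulls back to the logarithmic form attached to `P`. -/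
def IsDivisorForm (M : NoetherModel K R) (L : Type*) [Field L] [Algebra K L] (P : Ideal R)
    (w : Fin M.n → F) : Prop :=
  ∃ h a j₀, IsNormalDirection M.x P h a j₀ ∧ ∀ (σ : F →ₐ[K] L) (D : Derivation K L L),
    branchForm P M.x a j₀ (M.f.map (aeval M.x : MvPolynomial (Fin M.n) K →ₐ[K] R).toRingHom) M.y
      (σ.comp (IsScalarTower.toAlgHom K R F)) D = M.pairing σ D w

theorem exists_prime_iff_dvd [IsDomain R] (M : NoetherModel K R) {P : Ideal R}
    (hP : HeightOnePrime P) :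
    ∃ h : MvPolynomial (Fin M.n) K, Prime h ∧ ∀ p, aeval M.x p ∈ P ↔ h ∣ p := by
  let _ : Algebra (MvPolynomial (Fin M.n) K) R := (aeval M.x).toRingHom.toAlgebra
  have _ : FaithfulSMul (MvPolynomial (Fin M.n) K) R :=
    (faithfulSMul_iff_algebraMap_injective _ _).2 M.algebraicIndependent
  have _ : Algebra.IsIntegral (MvPolynomial (Fin M.n) K) R := ⟨M.isIntegral⟩
  obtain ⟨h, hh, hPh⟩ := hP.exists_comap_eq_span (T := MvPolynomial (Fin M.n) K)
  refine ⟨h, hh, fun p => ?_⟩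
  rw [← Ideal.mem_span_singleton, ← hPh, Ideal.mem_comap]
  rfl

theorem heightOnePrime_of_mem_iff [IsDomain R] (M : NoetherModel K R) {P : Ideal R} (hP : P.IsPrime)
    (hP0 : P ≠ ⊥) {h : MvPolynomial (Fin M.n) K} (hh : Prime h)
    (hPh : P.comap (aeval M.x : MvPolynomial (Fin M.n) K →ₐ[K] R).toRingHom = Ideal.span {h}) :
    HeightOnePrime P := by
  let _ : Algebra (MvPolynomial (Fin M.n) K) R := (aeval M.x).toRingHom.toAlgebra
  have _ : Algebra.IsIntegral (MvPolynomial (Fin M.n) K) R := ⟨M.isIntegral⟩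
  exact HeightOnePrime.of_comap_eq_span hP hh hPh hP0

theorem comap_ne_bot [IsDomain R] (M : NoetherModel K R) {P : Ideal R} (hP0 : P ≠ ⊥) :
    P.comap (aeval M.x : MvPolynomial (Fin M.n) K →ₐ[K] R).toRingHom ≠ ⊥ := by
  let _ : Algebra (MvPolynomial (Fin M.n) K) R := (aeval M.x).toRingHom.toAlgebra
  have _ : Algebra.IsIntegral (MvPolynomial (Fin M.n) K) R := ⟨M.isIntegral⟩
  obtain ⟨r, hr, hr0⟩ := Submodule.exists_mem_ne_zero_of_ne_bot hP0
  exact Ideal.comap_ne_bot_of_integral_mem hr0 hr (Algebra.IsIntegral.isIntegral r)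

theorem exists_isDivisorForm [IsDomain R] [CharZero K] [Algebra.FiniteType K R]
    [IsFractionRing R F] [IsAlgClosed L] (M : NoetherModel K R) {P : Ideal R}
    (hP : HeightOnePrime P) : ∃ w : Fin M.n → F, M.IsDivisorForm L P w := by
  obtain ⟨h, hh, hPh⟩ := M.exists_prime_iff_dvd hP
  obtain ⟨a, j₀, hd⟩ := exists_isNormalDirection hh hPh
  obtain ⟨w, hw⟩ := hd.exists_descent F M.algebraicIndependent M.isIntegral
    (M.f.map (aeval M.x : MvPolynomial (Fin M.n) K →ₐ[K] R).toRingHom) M.y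
  exact ⟨w, h, a, j₀, hd, fun σ D => (hw σ D).trans (M.pairing_apply σ D w).symm⟩

theorem mem_of_forall_mem (M : NoetherModel K R) (φ : R →ₐ[K] L) {W : ValuationSubring L}
    (hK : ∀ c : K, algebraMap K L c ∈ W) (hx : ∀ j, φ (M.x j) ∈ W) (r : R) : φ r ∈ W := by
  let _ : Algebra (MvPolynomial (Fin M.n) K) L :=
    (φ.comp (aeval M.x : MvPolynomial (Fin M.n) K →ₐ[K] R)).toRingHom.toAlgebra
  refine ValuationSubring.mem_of_isIntegral (T := MvPolynomial (Fin M.n) K) (fun p => ?_) ?_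
  · change φ (aeval M.x p) ∈ W
    induction p using MvPolynomial.induction_on with
    | C c => simpa using hK c
    | add p q hp hq => simpa using add_mem hp hq
    | mul_X p j hp => simpa using mul_mem hp (hx j)
  · obtain ⟨p, hp, hpr⟩ := M.isIntegral r
    refine ⟨p, hp, ?_⟩
    have := congrArg φ hpr
    rw [_root_.map_zero] at this
    rw [← this]
    exact (Polynomial.hom_eval₂ p (aeval M.x : MvPolynomial (Fin M.n) K →ₐ[K] R).toRingHom
      φ.toRingHom r).symm

end Pairing

end NoetherModel

section Good

variable {κ K N L R F : Type*} [Fintype κ] [DecidableEq κ] [Field K] [CharZero K] [Field N]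
  [Field L]
  [Algebra K L] [Algebra K N] [Algebra (MvPolynomial κ K) N]
  [IsFractionRing (MvPolynomial κ K) N] [Algebra (MvPolynomial κ K) L] [Algebra N L]
  [IsScalarTower (MvPolynomial κ K) N L] [IsScalarTower K (MvPolynomial κ K) L]
  [IsScalarTower K N L] [Algebra.IsAlgebraic (MvPolynomial κ K) L]

theorem exists_ne_zero_forall_valuation_le (δ : κ → Derivation K L L)
    (hδ : ∀ l (p : MvPolynomial κ K), δ l (algebraMap _ L p) = algebraMap _ L (pderiv l p))
    (E : IntermediateField N L) [FiniteDimensional N E] :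
    ∃ s : MvPolynomial κ K, s ≠ 0 ∧ ∀ t, ¬ t ∣ s → ∀ W : ValuationSubring L, Prime t →
      W.IsCenteredAt (algebraMap (MvPolynomial κ K) L) (Ideal.span {t}) →
      ∀ e ∈ E, W.valuation e < 1 →
        W.valuation e ≤ W.valuation (algebraMap (MvPolynomial κ K) L t) := by
  have _ : FaithfulSMul (MvPolynomial κ K) L := FaithfulSMul.trans _ N L
  obtain ⟨s, hs, h⟩ := Derivation.exists_ne_zero_forall_valuation_le_one (κ := κ) δ E
  refine ⟨s, hs, fun t hts W ht hW e he he1 => ?_⟩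
  have := W.valuation_le_of_dual (fun c => ValuationSubring.valuation_algebraMap_eq_one hW.mem)
    (E.restrictScalars K) (fun l => algebraMap (MvPolynomial κ K) L (X l)) (fun l => ?_) δ
    (fun j l => ?_) (fun j e he => h t hts j W ht hW e he) ht (fun p => ?_) (fun u hu => ?_) he he1
  · rwa [aeval_algebraMap_X] at this
  · rw [IsScalarTower.algebraMap_apply _ N L]; exact E.algebraMap_mem _
  · rw [hδ, pderiv_X]
    by_cases h : l = j
    · subst h; simp
    · simp [Pi.single_eq_of_ne h]
  · have := hW p
    rwa [← aeval_algebraMap_X p] at this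
  · rw [aeval_algebraMap_X]; exact hW.exists_pow_eq_pow E ht hu

variable [IsAlgClosed L] [CommRing R] [IsDomain R] [Algebra K R] [Algebra.FiniteType K R]
  [Field F] [Algebra R F] [IsFractionRing R F] [Algebra K F] [IsScalarTower K R F]

/-- A place lying over the prime divisor `t` of affine space whose centre `P` on the source of `σ`
is well behaved. -/
structure NoetherModel.IsGoodPlace (M : NoetherModel K R) (σ : F →ₐ[K] L)
    (δ : κ → Derivation K L L) (W : ValuationSubring L) (t : MvPolynomial κ K) (P : Ideal R) :
    Prop where
  center : W.IsCenteredAt ((σ : F →+* L).comp (algebraMap R F)) P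
  heightOne : P ≠ ⊥ → HeightOnePrime P
  pairing_sub_lt_one : ∀ w, M.IsDivisorForm L P w → ∀ l,
    W.valuation (algebraMap _ L t * M.pairing σ (δ l) w - δ l (algebraMap _ L t)) < 1
  pairing_lt_one : ∀ P' w, HeightOnePrime P' → P' ≠ P → M.IsDivisorForm L P' w → ∀ l,
    W.valuation (algebraMap _ L t * M.pairing σ (δ l) w) < 1

theorem NoetherModel.exists_isGoodPlace (M : NoetherModel K R) (σ : F →ₐ[K] L)
    (δ : κ → Derivation K L L)
    (hδ : ∀ l (p : MvPolynomial κ K), δ l (algebraMap _ L p) = algebraMap _ L (pderiv l p))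
    (E : IntermediateField N L) [FiniteDimensional N E]
    (hE : ∀ j, σ (algebraMap R F (M.x j)) ∈ E) :
    ∃ s : MvPolynomial κ K, s ≠ 0 ∧ ∀ t, ¬ t ∣ s → ∀ W : ValuationSubring L, Prime t →
      W.IsCenteredAt (algebraMap (MvPolynomial κ K) L) (Ideal.span {t}) →
      ∃ P, M.IsGoodPlace σ δ W t P := by
  have _ : CharZero L := charZero_of_injective_algebraMap (algebraMap K L).injective
  have _ : FaithfulSMul (MvPolynomial κ K) L := FaithfulSMul.trans _ N L
  let φ : R →ₐ[K] L := σ.comp (IsScalarTower.toAlgHom K R F)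
  have hφ : Function.Injective φ := σ.injective.comp (IsFractionRing.injective R F)
  have hφi : AlgebraicIndependent K fun j => φ (M.x j) := M.algebraicIndependent.map' hφ
  choose D hD using fun j => hφi.exists_derivation (L := L) (Pi.single (M := fun _ => L) j 1)
  obtain ⟨s₁, hs₁, h₁⟩ := Derivation.exists_ne_zero_forall_valuation_le_one
    (κ := κ) D E
  obtain ⟨s₂, hs₂, h₂⟩ := exists_ne_zero_forall_valuation_mul_le_one (T := MvPolynomial κ K)
    (Sum.elim (fun j => φ (M.x j)) ![(φ M.β)⁻¹, (φ ((M.f.map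
      (aeval M.x : MvPolynomial (Fin M.n) K →ₐ[K] R).toRingHom).derivative.eval M.y))⁻¹])
  obtain ⟨s₃, hs₃, h₃⟩ := exists_ne_zero_forall_valuation_le δ hδ E
  refine ⟨s₁ * s₂ * s₃, mul_ne_zero (mul_ne_zero hs₁ hs₂) hs₃, fun t hts W ht hW => ?_⟩
  have hts₁ : ¬ t ∣ s₁ := fun h => hts ((h.mul_right _).mul_right _)
  have hts₂ : ¬ t ∣ s₂ := fun h => hts ((h.mul_left _).mul_right _)
  have hts₃ : ¬ t ∣ s₃ := fun h => hts (h.mul_left _)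
  set τ := algebraMap (MvPolynomial κ K) L t with hτ
  have hτ0 : τ ≠ 0 := (map_ne_zero_iff _ (FaithfulSMul.algebraMap_injective _ _)).2 ht.ne_zero
  have hTW := hW.mem
  have hK (c : K) (hc : c ≠ 0) := ValuationSubring.valuation_algebraMap_eq_one hTW hc
  have hKW (c : K) : algebraMap K L c ∈ W := by
    rw [IsScalarTower.algebraMap_apply K (MvPolynomial κ K) L]; exact hTW _
  have hs₂W : W.valuation (algebraMap _ L s₂) = 1 :=
    hW.eq_one fun h => hts₂ (Ideal.mem_span_singleton.1 h)
  replace h₂ := h₂ W hTW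
  simp only [map_mul W.valuation, hs₂W, one_mul, Sum.forall, Sum.elim_inl, Sum.elim_inr,
    Fin.forall_fin_two, Matrix.cons_val_zero, Matrix.cons_val_one] at h₂
  obtain ⟨hxW, hβ, hy⟩ := h₂
  have hRW (r : R) : φ r ∈ W :=
    M.mem_of_forall_mem φ hKW (fun j => (W.valuation_le_one_iff _).1 (hxW j)) r
  have hRv (r : R) : W.valuation (φ r) ≤ 1 := (W.valuation_le_one_iff _).2 (hRW r)
  have hunit {r : R} (hr : r ≠ 0) (h : W.valuation (φ r)⁻¹ ≤ 1) : W.valuation (φ r) = 1 := by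
    refine (hRv r).antisymm ?_
    rw [map_inv₀] at h
    exact (inv_le_one₀ (zero_lt_iff.2 ((map_ne_zero _).2
      ((map_ne_zero_iff _ hφ).2 hr)))).1 h
  replace hβ := hunit M.beta_ne_zero hβ
  replace hy := hunit M.eval_derivative_ne_zero hy
  have hτE : τ ∈ E := by
    rw [hτ, IsScalarTower.algebraMap_apply _ N L]; exact E.algebraMap_mem _
  have hpow (u) (hu : u ∈ E) := hW.exists_pow_eq_pow E ht hu
  have hDE (j e) (he : e ∈ E) := h₁ t hts₁ j W ht hW e he
  have hlog (l) (u : L) (hu : u ≠ 0) : W.valuation (τ * (δ l u / u)) ≤ 1 :=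
    hW.log_le_one ht ((δ l).restrictScalars ℤ) (fun p => ⟨_, hδ l p⟩) hu
  have hδlt (l) (u : L) (hu : W.valuation u ≤ 1) : W.valuation (τ * δ l u) < 1 :=
    hW.mul_derivation_lt_one ht ((δ l).restrictScalars ℤ) (fun p => ⟨_, hδ l p⟩) hu
  let P : Ideal R := (IsLocalRing.maximalIdeal W).comap (φ.toRingHom.codRestrict W.toSubring hRW)
  have hPprime : P.IsPrime := inferInstanceAs (Ideal.comap _ _).IsPrime
  have hP (r : R) : W.valuation (φ r) < 1 ↔ r ∈ P :=
    (W.valuation_lt_one_iff (φ.toRingHom.codRestrict W.toSubring hRW r)).symm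
  have hP1 {r : R} (hr : r ∉ P) : W.valuation (φ r) = 1 :=
    (hRv r).antisymm (not_lt.1 fun h => hr ((hP r).1 h))
  have key (hP0 : P ≠ ⊥) : ∃ h : MvPolynomial (Fin M.n) K, Prime h ∧
      P.comap (aeval M.x : MvPolynomial (Fin M.n) K →ₐ[K] R).toRingHom = Ideal.span {h} ∧
      W.valuation (φ (aeval M.x h)) = W.valuation τ := by
    have haev (p : MvPolynomial (Fin M.n) K) : aeval (fun j => φ (M.x j)) p = φ (aeval M.x p) :=
      by
      induction p using MvPolynomial.induction_on with
      | C c => simp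
      | add p q hp hq => simp [hp, hq]
      | mul_X p j hp => simp [hp]
    obtain ⟨h, hh, hI, hv⟩ := W.exists_valuation_eq_of_dual hK (E.restrictScalars K)
      (fun j => φ (M.x j)) hE hxW D (fun j l => hD j l) hDE hτE hτ0 hW.lt_one
      (h₃ t hts₃ W ht hW) hpow
      (P.comap (aeval M.x : MvPolynomial (Fin M.n) K →ₐ[K] R).toRingHom)
      (fun p => by rw [haev, hP]; rfl) (M.comap_ne_bot hP0) hφi
    exact ⟨h, hh, hI, by rw [← haev, hv]⟩
  have hheight (hP0 : P ≠ ⊥) : HeightOnePrime P := by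
    obtain ⟨h, hh, hI, -⟩ := key hP0
    exact M.heightOnePrime_of_mem_iff hPprime hP0 hh hI
  refine ⟨P, fun r => ⟨hRv r, hP r⟩, hheight, ?_, ?_⟩
  · rintro w ⟨h, a, j₀, hd, hw⟩ l
    rw [← hw]
    have hmem : aeval M.x h ∈ P := (hd.mem_iff h).2 dvd_rfl
    have hP0 : P ≠ ⊥ := fun h0 => hd.prime.ne_zero (M.algebraicIndependent (by
      rw [_root_.map_zero]; rw [h0] at hmem; exact hmem))
    obtain ⟨h', hh', hI, hv⟩ := key hP0
    have h1 : h ∣ h' := (hd.mem_iff h').1 (by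
      have : h' ∈ Ideal.span {h'} := Ideal.mem_span_singleton_self h'
      rw [← hI] at this; exact this)
    have h2 : h' ∣ h := by
      rw [← Ideal.mem_span_singleton, ← hI]; exact hmem
    have hle {p q : MvPolynomial (Fin M.n) K} (hpq : p ∣ q) :
        W.valuation (φ (aeval M.x q)) ≤ W.valuation (φ (aeval M.x p)) := by
      obtain ⟨c, rfl⟩ := hpq
      rw [_root_.map_mul, _root_.map_mul, map_mul W.valuation]
      exact mul_le_of_le_one_right' (hRv _)
    exact hd.valuation_branchForm_sub_lt_one M.isIntegral M.algebraicIndependent hφ M.f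
      M.eval_eq_zero M.exists_mul_eq hβ hy (δ l) (hlog l) (hδlt l) (fun r => ⟨hRv r, hP r⟩) hτ0
      (((hle h2).antisymm (hle h1)).trans hv)
  · rintro P' w hP' hne ⟨h, a, j₀, hd, hw⟩ l
    rw [← hw]
    have hr : ∃ r ∈ P', r ∉ P := by
      by_contra! hle
      by_cases hP0 : P = ⊥
      · exact hP'.2.1 (le_bot_iff.1 (hP0 ▸ hle))
      · exact hne ((hheight hP0).eq_of_le hP'.1 hP'.2.1 hle)
    obtain ⟨r, hr, hr'⟩ := hr
    exact hd.valuation_branchForm_lt_one M.isIntegral M.algebraicIndependent hφ M.f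
      M.eval_eq_zero M.exists_mul_eq hRv hβ hy (δ l) (hlog l) (hδlt l) ⟨r, hr, hP1 hr'⟩

end Good

section Infinity

variable {κ K L : Type*} [DecidableEq κ] [Field K] [Field L] [Algebra K L] {z : κ → L} {i : κ}

theorem invCoord_X_self : invCoord K z i (X i) = (z i)⁻¹ := by simp [invCoord]

theorem invCoord_C (c : K) : invCoord K z i (C c) = algebraMap K L c := by simp [invCoord]

theorem ValuationSubring.IsCenteredAt.inv_coord_lt_one {W : ValuationSubring L}
    (hW : W.IsCenteredAt (invCoord K z i) (Ideal.span {X i})) : W.valuation (z i)⁻¹ < 1 := by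
  rw [← invCoord_X_self (K := K)]
  exact (hW _).2.2 (Ideal.mem_span_singleton_self _)

theorem ValuationSubring.IsCenteredAt.valuation_constant {W : ValuationSubring L}
    (hW : W.IsCenteredAt (invCoord K z i) (Ideal.span {X i})) {c : K} (hc : c ≠ 0) :
    W.valuation (algebraMap K L c) = 1 := by
  rw [← invCoord_C (z := z) (i := i)]
  refine hW.eq_one fun h => (X_prime (R := K) (i := i)).not_isUnit (isUnit_of_dvd_unit
    (Ideal.mem_span_singleton.1 h) ((isUnit_iff_ne_zero.2 hc).map C))

variable [Fintype κ]

theorem exists_valuation_inv_pow_mul_le_one {α : Type*} [Finite α] (hz : z i ≠ 0)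
    (hzi : AlgebraicIndependent K z)
    (halg : @Algebra.IsAlgebraic (MvPolynomial κ K) L _ _ (invCoord K z i).toAlgebra) (e : α → L) :
    ∃ m : ℕ, ∀ W : ValuationSubring L, W.IsCenteredAt (invCoord K z i) (Ideal.span {X i}) →
      ∀ a, W.valuation ((z i)⁻¹ ^ m * e a) ≤ 1 := by
  have _ := Fintype.ofFinite α
  let _ := (invCoord K z i).toAlgebra
  have _ : Algebra.IsAlgebraic (MvPolynomial κ K) L := halg
  have _ : FaithfulSMul (MvPolynomial κ K) L :=
    (faithfulSMul_iff_algebraMap_injective _ _).2 (invCoord_injective hz hzi)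
  have hX : algebraMap (MvPolynomial κ K) L (X i) = (z i)⁻¹ := invCoord_X_self
  choose n hn using fun a => ValuationSubring.exists_valuation_pow_mul_le_one
    (X_prime : Prime (X i : MvPolynomial κ K)) (e a)
  refine ⟨Finset.univ.sup n, fun W hW a => ?_⟩
  obtain ⟨k, hk⟩ := Nat.exists_eq_add_of_le' (Finset.le_sup (f := n) (Finset.mem_univ a))
  rw [hk, pow_add, mul_assoc, map_mul W.valuation, map_pow]
  have h1 := hn a W hW
  rw [hX] at h1
  exact mul_le_one' (pow_le_one₀ zero_le hW.inv_coord_lt_one.le) h1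

theorem ValuationSubring.IsCenteredAt.inv_coord_log_le_one [CharZero K] (hz : z i ≠ 0)
    (hzi : AlgebraicIndependent K z)
    (halg : @Algebra.IsAlgebraic (MvPolynomial κ K) L _ _ (invCoord K z i).toAlgebra)
    {W : ValuationSubring L} (hW : W.IsCenteredAt (invCoord K z i) (Ideal.span {X i}))
    (D : Derivation K L L) {d : κ → K} (hD : ∀ j, D (z j) = algebraMap K L (d j)) {u : L}
    (hu : u ≠ 0) : W.valuation ((z i)⁻¹ * (D u / u)) ≤ 1 := by
  have _ : CharZero L := charZero_of_injective_algebraMap (algebraMap K L).injective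
  let _ := (invCoord K z i).toAlgebra
  have _ : Algebra.IsAlgebraic (MvPolynomial κ K) L := halg
  have _ : FaithfulSMul (MvPolynomial κ K) L :=
    (faithfulSMul_iff_algebraMap_injective _ _).2 (invCoord_injective hz hzi)
  have hX : algebraMap (MvPolynomial κ K) L (X i) = (z i)⁻¹ := invCoord_X_self
  rw [← hX]
  refine ValuationSubring.IsCenteredAt.log_le_one (T := MvPolynomial κ K) hW X_prime
    (D.restrictScalars ℤ) (fun p => ?_) hu
  refine ⟨∑ j, pderiv j p * (if j = i then - X i ^ 2 * C (d i) else C (d j)), ?_⟩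
  change D (invCoord K z i p) = invCoord K z i _
  rw [map_sum]
  refine (D.apply_mvPolynomial_aeval _ p).trans (Finset.sum_congr rfl fun j _ => ?_)
  rw [map_mul]
  congr 1
  by_cases hj : j = i
  · subst hj
    rw [if_pos rfl, Function.update_self, map_mul, map_neg, map_pow, invCoord_X_self, invCoord_C,
      Derivation.leibniz_inv, hD, smul_eq_mul, inv_pow]
  · rw [if_neg hj, Function.update_of_ne hj, invCoord_C, hD]

end Infinity

namespace NoetherModel

variable {K L R F : Type*} [Field K] [Field L] [Algebra K L]
  [CommRing R] [IsDomain R] [Algebra K R] [Algebra.FiniteType K R]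
  [Field F] [Algebra R F] [IsFractionRing R F] [Algebra K F] [IsScalarTower K R F]

/-- The elements whose poles bound those of the pull backs of divisor forms. -/
noncomputable def poles (M : NoetherModel K R) (σ : F →ₐ[K] L) : Fin M.n ⊕ Fin 2 → L :=
  Sum.elim (fun j => σ (algebraMap R F (M.x j))) ![σ (algebraMap R F M.y),
    (σ (algebraMap R F ((M.f.map
      (aeval M.x : MvPolynomial (Fin M.n) K →ₐ[K] R).toRingHom).derivative.eval M.y)))⁻¹]

theorem valuation_pairing_le_one (M : NoetherModel K R) (σ : F →ₐ[K] L) {W : ValuationSubring L}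
    (hK : ∀ c : K, c ≠ 0 → W.valuation (algebraMap K L c) = 1) {τ : L} (hτ0 : τ ≠ 0)
    (hτ : W.valuation τ ≤ 1) (he : ∀ a, W.valuation (τ * M.poles σ a) ≤ 1) (D : Derivation K L L)
    {π : L} (hlog : ∀ u, u ≠ 0 → W.valuation (π * (D u / u)) ≤ 1) {P : Ideal R} {w : Fin M.n → F}
    (hw : M.IsDivisorForm L P w) :
    W.valuation (π * (τ ^ branchBound M.f * M.pairing σ D w)) ≤ 1 := by
  obtain ⟨h, a, j₀, hd, hw⟩ := hw
  have hτv : 0 < W.valuation τ := zero_lt_iff.2 ((map_ne_zero _).2 hτ0)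
  have hg {e : L} (h : W.valuation (τ * e) ≤ 1) : W.valuation e ≤ (W.valuation τ)⁻¹ := by
    rw [map_mul W.valuation] at h
    exact (le_inv_mul_iff₀ hτv).2 h |>.trans_eq (mul_one _)
  simp only [Sum.forall, poles, Sum.elim_inl, Sum.elim_inr, Fin.forall_fin_two,
    Matrix.cons_val_zero, Matrix.cons_val_one] at he
  have key := hd.valuation_branchForm_le M.isIntegral M.algebraicIndependent
    (σ := σ.comp (IsScalarTower.toAlgHom K R F))
    (σ.injective.comp (IsFractionRing.injective R F)) hK M.monic M.eval_eq_zero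
    ((one_le_inv₀ hτv).2 hτ) (fun j => hg (he.1 j)) (hg he.2.1) (hg he.2.2) D hlog
  rw [hw] at key
  rw [mul_left_comm, map_mul W.valuation, map_pow]
  refine (mul_le_mul_right key _).trans_eq ?_
  rw [← mul_pow, mul_inv_cancel₀ hτv.ne', one_pow]

end NoetherModel

namespace NoetherModel

section Sum

variable {κ K L R F : Type*} [Field K] [Field L] [Algebra K L]
  [CommRing R] [Algebra K R] [Field F] [Algebra R F] [Algebra K F] [IsScalarTower K R F]
  {M : NoetherModel K R} {σ : F →ₐ[K] L} {W : ValuationSubring L} {ω : Ideal R → Fin M.n → F}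

theorem IsGoodPlace.linearCombination [Algebra (MvPolynomial κ K) L] {δ : κ → Derivation K L L}
    {t : MvPolynomial κ K} {P₀ : Ideal R} (hg : M.IsGoodPlace σ δ W t P₀)
    (hK : ∀ c : K, c ≠ 0 → W.valuation (algebraMap K L c) = 1)
    (hω : ∀ P, HeightOnePrime P → M.IsDivisorForm L P (ω P)) {c : Ideal R →₀ K}
    (hc : ∀ P ∈ c.support, HeightOnePrime P) (l : κ) :
    W.valuation (algebraMap _ L t * M.pairing σ (δ l) (Finsupp.linearCombination K ω c) -
      algebraMap K L (c P₀) * δ l (algebraMap _ L t)) < 1 := by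
  classical
  have h1 : algebraMap K L (c P₀) * δ l (algebraMap _ L t) =
      ∑ P ∈ c.support, algebraMap K L (c P) * if P = P₀ then δ l (algebraMap _ L t) else 0 := by
    rw [Finset.sum_eq_single P₀]
    · rw [if_pos rfl]
    · intro P _ hP
      rw [if_neg hP, mul_zero]
    · intro hP
      rw [Finsupp.notMem_support_iff.1 hP, map_zero, zero_mul]
  rw [h1, Finsupp.linearCombination_apply, Finsupp.sum, map_sum, Finset.mul_sum,
    ← Finset.sum_sub_distrib]
  refine Valuation.map_sum_lt _ one_ne_zero fun P hP => ?_
  rw [map_smul, Algebra.smul_def, mul_left_comm, ← mul_sub, map_mul W.valuation,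
    hK _ (Finsupp.mem_support_iff.1 hP), one_mul]
  by_cases h : P = P₀
  · subst h
    rw [if_pos rfl]
    exact hg.pairing_sub_lt_one _ (hω P (hc P hP)) l
  · rw [if_neg h, sub_zero]
    exact hg.pairing_lt_one P _ (hc P hP) h (hω P (hc P hP)) l

theorem valuation_pairing_linearCombination_le_one [IsDomain R] [Algebra.FiniteType K R]
    [IsFractionRing R F]
    (hK : ∀ c : K, c ≠ 0 → W.valuation (algebraMap K L c) = 1) {τ : L} (hτ0 : τ ≠ 0)
    (hτ : W.valuation τ ≤ 1) (he : ∀ a, W.valuation (τ * M.poles σ a) ≤ 1) (D : Derivation K L L)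
    {π : L} (hlog : ∀ u, u ≠ 0 → W.valuation (π * (D u / u)) ≤ 1)
    (hω : ∀ P, HeightOnePrime P → M.IsDivisorForm L P (ω P)) {c : Ideal R →₀ K}
    (hc : ∀ P ∈ c.support, HeightOnePrime P) :
    W.valuation (π * (τ ^ branchBound M.f *
      M.pairing σ D (Finsupp.linearCombination K ω c))) ≤ 1 := by
  rw [Finsupp.linearCombination_apply, Finsupp.sum, map_sum, Finset.mul_sum, Finset.mul_sum]
  refine Valuation.map_sum_le _ fun P hP => ?_
  rw [map_smul, Algebra.smul_def, mul_left_comm (τ ^ _), mul_left_comm π, map_mul W.valuation,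
    hK _ (Finsupp.mem_support_iff.1 hP), one_mul]
  exact M.valuation_pairing_le_one σ hK hτ0 hτ he D hlog (hω P (hc P hP))

end Sum

variable {κ K N L R F : Type*} [Fintype κ] [DecidableEq κ] [Field K] [CharZero K] [Field N]
  [Field L]
  [Algebra K L] [Algebra K N] [Algebra (MvPolynomial κ K) N]
  [IsFractionRing (MvPolynomial κ K) N] [Algebra (MvPolynomial κ K) L] [Algebra N L]
  [IsScalarTower (MvPolynomial κ K) N L] [IsScalarTower K (MvPolynomial κ K) L]
  [IsScalarTower K (MvPolynomial κ K) N] [IsScalarTower K N L]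
  [Algebra.IsAlgebraic (MvPolynomial κ K) L] [IsAlgClosed L] [CommRing R]
  [IsDomain R] [Algebra K R] [Algebra.FiniteType K R]
  [Field F] [Algebra R F] [IsFractionRing R F] [Algebra K F] [IsScalarTower K R F]

theorem exists_finiteDimensional (M : NoetherModel K R) (σ : Fin 2 → F →ₐ[K] L)
    (δ : κ → Derivation K L L)
    (hδ : ∀ l (p : MvPolynomial κ K), δ l (algebraMap _ L p) = algebraMap _ L (pderiv l p))
    (E : IntermediateField N L) [FiniteDimensional N E] (hE : ∀ i (e : F), σ i e ∈ E)
    (hδE : ∀ i l j, δ l (σ i (algebraMap R F (M.x j))) ∈ E) {ω : Ideal R → Fin M.n → F}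
    (hω : ∀ P, HeightOnePrime P → M.IsDivisorForm L P (ω P)) :
    ∃ V : Submodule K L, FiniteDimensional K V ∧ ∀ c : Ideal R →₀ K,
      (∀ P ∈ c.support, HeightOnePrime P) →
      (∀ (t : MvPolynomial κ K) (W : ValuationSubring L) (P : Fin 2 → Ideal R), Prime t →
        W.IsCenteredAt (algebraMap (MvPolynomial κ K) L) (Ideal.span {t}) →
        (∀ i, W.IsCenteredAt ((σ i : F →+* L).comp (algebraMap R F)) (P i)) → c (P 0) = c (P 1)) →
      ∀ l, M.pairing (σ 0) (δ l) (Finsupp.linearCombination K ω c) -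
        M.pairing (σ 1) (δ l) (Finsupp.linearCombination K ω c) ∈ V := by
  have _ : FaithfulSMul (MvPolynomial κ K) L := FaithfulSMul.trans _ N L
  have hinj : Function.Injective (algebraMap (MvPolynomial κ K) L) :=
    FaithfulSMul.algebraMap_injective _ _
  set z : κ → L := fun l => algebraMap (MvPolynomial κ K) L (X l) with hz
  have hz0 (i : κ) : z i ≠ 0 := (map_ne_zero_iff _ hinj).2 (X_ne_zero i)
  have haz (p : MvPolynomial κ K) : aeval z p = algebraMap _ L p := aeval_algebraMap_X p
  have hzi : AlgebraicIndependent K z := fun p q h => hinj (by rw [← haz, ← haz]; exact h)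
  have halg (i : κ) := isAlgebraic_invCoord (hz0 i) haz
  obtain ⟨s₁, hs₁, h₁⟩ := exists_ne_zero_forall_not_dvd fun i =>
    M.exists_isGoodPlace (σ i) δ hδ E fun j => hE i _
  obtain ⟨s₂, hs₂, h₂⟩ := exists_ne_zero_forall_valuation_le δ hδ E
  obtain ⟨s₃, hs₃, h₃⟩ := exists_ne_zero_forall_valuation_mul_le_one (T := MvPolynomial κ K)
    fun a : Fin 2 × (Fin M.n ⊕ Fin 2) => M.poles (σ a.1) a.2
  choose m hm using fun i => exists_valuation_inv_pow_mul_le_one (hz0 i) hzi (halg i)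
    fun a : Fin 2 × (Fin M.n ⊕ Fin 2) => M.poles (σ a.1) a.2
  set B := branchBound M.f with hB
  set s := s₁ * s₂ * s₃ with hs
  have hs0 : s ≠ 0 := mul_ne_zero (mul_ne_zero hs₁ hs₂) hs₃
  set b := 1 + (Finset.univ.sup m) * B with hb
  let V : Submodule K L :=
    { carrier := {ξ | ξ ∈ E ∧ (∀ (t : MvPolynomial κ K) (W : ValuationSubring L), Prime t →
        W.IsCenteredAt (algebraMap (MvPolynomial κ K) L) (Ideal.span {t}) →
        W.valuation (algebraMap _ L (s ^ (B + 1)) * ξ) ≤ 1) ∧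
        ∀ (i : κ) (W : ValuationSubring L), W.IsCenteredAt (invCoord K z i) (Ideal.span {X i}) →
        W.valuation ((z i)⁻¹ ^ b * ξ) ≤ 1}
      zero_mem' := ⟨E.zero_mem, by simp, by simp⟩
      add_mem' := by
        rintro ξ η ⟨h1, h2, h3⟩ ⟨h1', h2', h3'⟩
        refine ⟨E.add_mem h1 h1', fun t W ht hW => ?_, fun i W hW => ?_⟩
        · rw [mul_add]; exact W.valuation.map_add_le (h2 t W ht hW) (h2' t W ht hW)
        · rw [mul_add]; exact W.valuation.map_add_le (h3 i W hW) (h3' i W hW)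
      smul_mem' := by
        rintro c ξ ⟨h1, h2, h3⟩
        by_cases hc : c = 0
        · subst hc
          rw [zero_smul]
          exact ⟨E.zero_mem, by simp, by simp⟩
        refine ⟨(E.restrictScalars K).smul_mem h1, fun t W ht hW => ?_, fun i W hW => ?_⟩
        · rw [Algebra.smul_def, mul_left_comm, map_mul W.valuation,
            ValuationSubring.valuation_algebraMap_eq_one hW.mem hc, one_mul]
          exact h2 t W ht hW
        · rw [Algebra.smul_def, mul_left_comm, map_mul W.valuation, hW.valuation_constant hc,
            one_mul]
          exact h3 i W hW }
  refine ⟨V, finiteDimensional_of_forall_valuation_le_one E (pow_ne_zero (B + 1) hs0) b V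
    (fun ξ hξ => hξ.1) (fun ξ hξ => hξ.2.1) (fun ξ hξ => hξ.2.2), fun c hc hcP l => ?_⟩
  set ξ := Finsupp.linearCombination K ω c with hξ
  have hpE (i) : M.pairing (σ i) (δ l) ξ ∈ E := by
    rw [pairing_apply]
    exact E.sum_mem fun j _ => E.mul_mem (hδE i l j) (hE i _)
  refine ⟨E.sub_mem (hpE 0) (hpE 1), fun t W ht hW => ?_, fun i W hW => ?_⟩
  · set τ := algebraMap (MvPolynomial κ K) L t with hτ
    have hTW (p : MvPolynomial κ K) : W.valuation (algebraMap _ L p) ≤ 1 :=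
      (W.valuation_le_one_iff _).2 (hW.mem p)
    have hK (c : K) (hc : c ≠ 0) := ValuationSubring.valuation_algebraMap_eq_one hW.mem hc
    by_cases hts : t ∣ s
    · obtain ⟨r, hr⟩ := hts
      have hbd (i) : W.valuation (τ * (algebraMap _ L s ^ B * M.pairing (σ i) (δ l) ξ)) ≤ 1 := by
        refine valuation_pairing_linearCombination_le_one hK ((map_ne_zero_iff _ hinj).2 hs0)
          (hTW s) (fun a => ?_) (δ l) (fun u hu => ?_) hω hc
        · rw [hs, map_mul (algebraMap _ L), mul_assoc, map_mul W.valuation]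
          exact mul_le_one' (hTW _) (h₃ W hW.mem (i, a))
        · have _ : CharZero L := charZero_of_injective_algebraMap (algebraMap K L).injective
          exact hW.log_le_one ht ((δ l).restrictScalars ℤ) (fun p => ⟨_, hδ l p⟩) hu
      have hsplit : algebraMap (MvPolynomial κ K) L (s ^ (B + 1)) *
          (M.pairing (σ 0) (δ l) ξ - M.pairing (σ 1) (δ l) ξ) =
          algebraMap _ L r * (τ * (algebraMap _ L s ^ B * M.pairing (σ 0) (δ l) ξ) -
            τ * (algebraMap _ L s ^ B * M.pairing (σ 1) (δ l) ξ)) := by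
        rw [pow_succ, map_mul (algebraMap _ L), map_pow]
        conv_lhs => rw [show algebraMap (MvPolynomial κ K) L s = τ * algebraMap _ L r by
          rw [hr, map_mul (algebraMap _ L)]]
        rw [hr, map_mul (algebraMap _ L)]
        ring
      rw [hsplit, map_mul W.valuation]
      exact mul_le_one' (hTW r) (W.valuation.map_sub_le (hbd 0) (hbd 1))
    · have hts₁ : ¬ t ∣ s₁ := fun h => hts ((h.mul_right _).mul_right _)
      have hts₂ : ¬ t ∣ s₂ := fun h => hts ((h.mul_left _).mul_right _)
      choose P hP using fun i => h₁ t hts₁ i W ht hW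
      have hg (i) := (hP i).linearCombination hK hω hc l
      have hlt : W.valuation (τ * (M.pairing (σ 0) (δ l) ξ - M.pairing (σ 1) (δ l) ξ)) < 1 := by
        have h := hcP t W P ht hW fun i => (hP i).center
        have h0 := hg 0
        rw [h] at h0
        have := (W.valuation.map_sub _ _).trans_lt (max_lt h0 (hg 1))
        rwa [sub_sub_sub_cancel_right, ← mul_sub] at this
      have hτE : τ ∈ E := by
        rw [hτ, IsScalarTower.algebraMap_apply _ N L]; exact E.algebraMap_mem _
      have hle := h₂ t hts₂ W ht hW _ (E.mul_mem hτE (E.sub_mem (hpE 0) (hpE 1))) hlt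
      rw [map_mul W.valuation] at hle ⊢
      refine mul_le_one' (hTW _) ?_
      exact le_of_mul_le_mul_left (hle.trans_eq (mul_one _).symm) (hW.pos ht)
  · have hK (c : K) (hc : c ≠ 0) := hW.valuation_constant hc
    have hlt := hW.inv_coord_lt_one.le
    have hbd (k) : W.valuation ((z i)⁻¹ * (((z i)⁻¹ ^ m i) ^ B * M.pairing (σ k) (δ l) ξ)) ≤ 1 := by
      refine valuation_pairing_linearCombination_le_one hK (pow_ne_zero _ (inv_ne_zero (hz0 i)))
        ?_ (fun a => hm i W hW (k, a)) (δ l) (fun u hu => ?_) hω hc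
      · rw [map_pow]; exact pow_le_one₀ zero_le hlt
      · refine hW.inv_coord_log_le_one (hz0 i) hzi (halg i) (δ l)
          (d := fun j => Pi.single (M := fun _ => K) l 1 j) (fun j => ?_) hu
        rw [hz, hδ, pderiv_X]
        by_cases h : j = l
        · subst h; simp
        · simp [Pi.single_eq_of_ne h]
    obtain ⟨k, hk⟩ := Nat.exists_eq_add_of_le' (show 1 + m i * B ≤ b from
      Nat.add_le_add_left (Nat.mul_le_mul_right _ (Finset.le_sup (Finset.mem_univ i))) _)
    have hsplit : (z i)⁻¹ ^ b * (M.pairing (σ 0) (δ l) ξ - M.pairing (σ 1) (δ l) ξ) =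
        (z i)⁻¹ ^ k * ((z i)⁻¹ * (((z i)⁻¹ ^ m i) ^ B * M.pairing (σ 0) (δ l) ξ) -
          (z i)⁻¹ * (((z i)⁻¹ ^ m i) ^ B * M.pairing (σ 1) (δ l) ξ)) := by
      rw [hk]; ring
    rw [hsplit, map_mul W.valuation, map_pow]
    exact mul_le_one' (pow_le_one₀ zero_le hlt) (W.valuation.map_sub_le (hbd 0) (hbd 1))

end NoetherModel

theorem Derivation.apply_eq_sum_coordDerivation {κ K L : Type*} [Fintype κ] [Field K] [CharZero K]
    [Field L]
    [Algebra K L] [Algebra (MvPolynomial κ K) L] [IsScalarTower K (MvPolynomial κ K) L]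
    [Algebra.IsAlgebraic (MvPolynomial κ K) L] [FaithfulSMul (MvPolynomial κ K) L]
    {δ : κ → Derivation K L L}
    (hδ : ∀ l (p : MvPolynomial κ K), δ l (algebraMap _ L p) = algebraMap _ L (pderiv l p))
    (D : Derivation K L L) (u : L) :
    D u = ∑ l, D (algebraMap (MvPolynomial κ K) L (X l)) * δ l u := by
  have _ : CharZero L := charZero_of_injective_algebraMap (algebraMap K L).injective
  have happ (u : L) : (∑ l, D (algebraMap (MvPolynomial κ K) L (X l)) • δ l) u =
      ∑ l, D (algebraMap (MvPolynomial κ K) L (X l)) * δ l u := by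
    change Derivation.coeFnAddMonoidHom _ u = _
    rw [map_sum, Finset.sum_apply]
    rfl
  rw [← happ]
  congr 1
  refine Derivation.eq_of_forall_algebraMap (A := MvPolynomial κ K) _ _ fun p => ?_
  rw [happ, ← aeval_algebraMap_X p, D.apply_mvPolynomial_aeval, aeval_algebraMap_X]
  simp only [hδ, aeval_algebraMap_X, mul_comm]

namespace NoetherModel

theorem pairing_smul {K L R F : Type*} [Field K] [Field L] [Algebra K L] [CommRing R]
    [Algebra K R] [Field F] [Algebra R F] [Algebra K F] (M : NoetherModel K R) (σ : F →ₐ[K] L)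
    (D : Derivation K L L) (g : F) (w : Fin M.n → F) :
    M.pairing σ D (g • w) = σ g * M.pairing σ D w := by
  simp only [pairing_apply, Pi.smul_apply, smul_eq_mul, map_mul σ, Finset.mul_sum, mul_left_comm]

variable {κ K L R F : Type*} [Fintype κ] [Field K] [CharZero K] [Field L]
  [Algebra K L] [Algebra (MvPolynomial κ K) L] [IsScalarTower K (MvPolynomial κ K) L]
  [Algebra.IsAlgebraic (MvPolynomial κ K) L] [FaithfulSMul (MvPolynomial κ K) L] [CommRing R]
  [Algebra K R] [Field F] [Algebra R F] [IsFractionRing R F] [Algebra K F] [IsScalarTower K R F]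

theorem eq_zero_of_forall_sum_eq_zero (M : NoetherModel K R) (σ : F →ₐ[K] L)
    {δ : κ → Derivation K L L}
    (hδ : ∀ l (p : MvPolynomial κ K), δ l (algebraMap _ L p) = algebraMap _ L (pderiv l p))
    {v : Fin M.n → L} (hv : ∀ l, ∑ j, δ l (σ (algebraMap R F (M.x j))) * v j = 0) : v = 0 := by
  have hσ : AlgebraicIndependent K fun j => σ (algebraMap R F (M.x j)) :=
    M.algebraicIndependent.map' (f := σ.comp (IsScalarTower.toAlgHom K R F))
      (σ.injective.comp (IsFractionRing.injective R F))
  funext k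
  obtain ⟨D, hD⟩ := hσ.exists_derivation (L := L) (Pi.single (M := fun _ => L) k 1)
  have h : ∑ j, D (σ (algebraMap R F (M.x j))) * v j = 0 := by
    rw [Finset.sum_congr rfl fun j _ => congrArg (· * v j)
      (D.apply_eq_sum_coordDerivation hδ (σ (algebraMap R F (M.x j))))]
    simp only [Finset.sum_mul, mul_assoc]
    rw [Finset.sum_comm]
    simp only [← Finset.mul_sum, hv, mul_zero, Finset.sum_const_zero]
  simpa [hD, Pi.single_apply] using h

theorem finiteDimensional_of_pairing_eq (M : NoetherModel K R) (σ : Fin 2 → F →ₐ[K] L)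
    {δ : κ → Derivation K L L}
    (hδ : ∀ l (p : MvPolynomial κ K), δ l (algebraMap _ L p) = algebraMap _ L (pderiv l p))
    (hσ : ∀ g, σ 0 g = σ 1 g → ∃ c, algebraMap K F c = g) {U : Submodule K (Fin M.n → F)}
    (hU : ∀ w ∈ U, ∀ l, M.pairing (σ 0) (δ l) w = M.pairing (σ 1) (δ l) w) :
    FiniteDimensional K U := by
  classical
  obtain ⟨b, hbU, hspan, hb⟩ := exists_linearIndependent F (U : Set (Fin M.n → F))
  have hfin : b.Finite := hb.setFinite
  have _ : Fintype b := hfin.fintype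
  have _ : FiniteDimensional K (Submodule.span K b) := FiniteDimensional.span_of_finite K hfin
  refine Submodule.finiteDimensional_of_le (S₂ := Submodule.span K b) fun w hw => ?_
  obtain ⟨ρ, hρ⟩ := LinearMap.exists_leftInverse_of_injective
    (Fintype.linearCombination F ((↑) : b → Fin M.n → F))
    (LinearMap.ker_eq_bot.2 hb.fintypeLinearCombination_injective)
  have hwspan : w ∈ Submodule.span F (Set.range ((↑) : b → Fin M.n → F)) := by
    rw [Subtype.range_coe, hspan]
    exact Submodule.subset_span hw
  obtain ⟨g, hg⟩ := (Submodule.mem_span_range_iff_exists_fun F).1 hwspan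
  have hd : ∀ k, σ 0 (g k) = σ 1 (g k) := by
    have hv := M.eq_zero_of_forall_sum_eq_zero (σ 0) hδ
      (v := fun j => ∑ k, (σ 0 (g k) - σ 1 (g k)) * σ 0 ((k : Fin M.n → F) j)) fun l => by
        have h0 : ∑ k : b, (σ 0 (g k) - σ 1 (g k)) * M.pairing (σ 0) (δ l) k = 0 := by
          have h1 := hU w hw l
          rw [← hg, map_sum, map_sum] at h1
          simp only [pairing_smul] at h1
          simp only [sub_mul, Finset.sum_sub_distrib]
          rw [h1, sub_eq_zero]
          exact Finset.sum_congr rfl fun k _ => by rw [hU k (hbU k.2)]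
        rw [← h0]
        simp only [pairing_apply, Finset.mul_sum]
        rw [Finset.sum_comm]
        exact Finset.sum_congr rfl fun k _ => Finset.sum_congr rfl fun j _ => mul_left_comm _ _ _
    intro k
    set r : Fin M.n → F := fun j => ρ (fun j' => if j = j' then 1 else 0) k with hr
    have hρk (k' : b) : ∑ j, r j * (k' : Fin M.n → F) j = if k' = k then 1 else 0 := by
      have h1 := congrFun (LinearMap.congr_fun hρ (Pi.single k' 1)) k
      rw [LinearMap.comp_apply, Fintype.linearCombination_apply_single, one_smul,
        LinearMap.id_apply, LinearMap.pi_apply_eq_sum_univ ρ, Finset.sum_apply, Pi.single_apply]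
        at h1
      simp only [Pi.smul_apply, smul_eq_mul] at h1
      simp only [eq_comm (a := k'), ← h1, hr, mul_comm]
    have h2 : ∑ j, σ 0 (r j) *
        ∑ k', (σ 0 (g k') - σ 1 (g k')) * σ 0 ((k' : Fin M.n → F) j) = 0 :=
      Finset.sum_eq_zero fun j _ => by rw [congrFun hv j]; exact mul_zero _
    have h3 : ∑ j, σ 0 (r j) *
        ∑ k', (σ 0 (g k') - σ 1 (g k')) * σ 0 ((k' : Fin M.n → F) j) =
        ∑ k', (σ 0 (g k') - σ 1 (g k')) * σ 0 (∑ j, r j * (k' : Fin M.n → F) j) := by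
      simp only [map_sum, map_mul (σ 0), Finset.mul_sum]
      rw [Finset.sum_comm]
      exact Finset.sum_congr rfl fun k _ => Finset.sum_congr rfl fun j _ => mul_left_comm _ _ _
    rw [h3] at h2
    simp only [hρk] at h2
    simp only [apply_ite (σ 0), map_one, _root_.map_zero, mul_ite, mul_one, mul_zero,
      Finset.sum_ite_eq', Finset.mem_univ, if_true] at h2
    exact sub_eq_zero.1 h2
  rw [← hg]
  refine Submodule.sum_mem _ fun k _ => ?_
  obtain ⟨c, hc⟩ := hσ _ (hd k)
  rw [← hc, algebraMap_smul]
  exact Submodule.smul_mem _ _ (Submodule.subset_span k.2)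

end NoetherModel

theorem Finsupp.exists_finite_support_subset {K α : Type*} [Field K] (U : Submodule K (α →₀ K))
    [FiniteDimensional K U] : ∃ A : Set α, A.Finite ∧ ∀ c ∈ U, (c.support : Set α) ⊆ A := by
  classical
  obtain ⟨B, hB⟩ := Submodule.fg_iff_finiteDimensional U |>.2 inferInstance
  refine ⟨↑(B.biUnion Finsupp.support), Finset.finite_toSet _, fun c hc => ?_⟩
  have h : U ≤ Finsupp.supported K K ↑(B.biUnion Finsupp.support) := by
    rw [← hB, Submodule.span_le]
    exact fun b hb => (Finsupp.mem_supported _ _).2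
      (Finset.coe_subset.2 (Finset.subset_biUnion_of_mem _ hb))
  exact (Finsupp.mem_supported _ _).1 (h hc)

theorem Finsupp.finiteDimensional_of_support_subset {K α : Type*} [Field K]
    {U : Submodule K (α →₀ K)} {A : Set α} (hA : A.Finite)
    (hU : ∀ c ∈ U, (c.support : Set α) ⊆ A) : FiniteDimensional K U := by
  have _ : Finite A := hA
  have _ : FiniteDimensional K (Finsupp.supported K K A) :=
    Module.Finite.equiv (Finsupp.supportedEquivFinsupp (R := K) (M := K) A).symm
  exact Submodule.finiteDimensional_of_le (S₂ := Finsupp.supported K K A)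
    fun c hc => (Finsupp.mem_supported _ _).2 (hU c hc)

theorem LinearMap.finiteDimensional_of_map_le {K V W : Type*} [Field K] [AddCommGroup V]
    [Module K V] [AddCommGroup W] [Module K W] (f : V →ₗ[K] W) {U : Submodule K V}
    {U' : Submodule K W} [FiniteDimensional K U'] (h : U.map f ≤ U')
    (hker : FiniteDimensional K (U ⊓ LinearMap.ker f : Submodule K V)) : FiniteDimensional K U := by
  have _ := Submodule.finiteDimensional_of_le h
  exact (Submodule.fg_iff_finiteDimensional _).1 (Submodule.fg_of_fg_map_of_fg_inf_ker f
    ((Submodule.fg_iff_finiteDimensional _).2 inferInstance)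
    ((Submodule.fg_iff_finiteDimensional _).2 hker))

theorem Prime.exists_not_dvd_pderiv {κ K : Type*} [Field K] [CharZero K]
    {t : MvPolynomial κ K} (ht : Prime t) : ∃ l, ¬ t ∣ pderiv l t := by
  obtain ⟨j, hj⟩ : ∃ j, pderiv j t ≠ 0 := by
    by_contra! hc
    obtain ⟨c, rfl⟩ := eq_C_of_forall_pderiv_eq_zero hc
    refine ht.not_isUnit (IsUnit.map C (IsUnit.mk0 _ fun h0 => ht.ne_zero (by rw [h0, map_zero])))
  refine ⟨j, fun ⟨w, hw⟩ => ?_⟩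
  have hw0 : w ≠ 0 := fun h0 => hj (by rw [hw, h0, mul_zero])
  have h1 := totalDegree_pderiv_lt hj
  rw [hw, totalDegree_mul_of_isDomain ht.ne_zero hw0] at h1
  omega

theorem ValuationSubring.IsCenteredAt.unique {T L : Type*} [CommRing T] [Field L]
    {W : ValuationSubring L} {φ : T →+* L} {P Q : Ideal T} (hP : W.IsCenteredAt φ P)
    (hQ : W.IsCenteredAt φ Q) : P = Q := by
  ext a
  rw [← (hP a).2, (hQ a).2]

theorem ValuationSubring.exists_isCenteredAt_of_forall_mem {S L : Type*} [CommRing S] [Field L]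
    {W : ValuationSubring L} (φ : S →+* L) (h : ∀ a, φ a ∈ W) :
    ∃ Q : Ideal S, Q.IsPrime ∧ W.IsCenteredAt φ Q := by
  refine ⟨(IsLocalRing.maximalIdeal W).comap (φ.codRestrict W.toSubring h), inferInstance,
    fun a => ⟨(W.valuation_le_one_iff _).2 (h a), ?_⟩⟩
  exact (W.valuation_lt_one_iff (φ.codRestrict W.toSubring h a)).symm

theorem ValuationSubring.IsCenteredAt.comp {T S L : Type*} [CommRing T] [CommRing S] [Field L]
    {W : ValuationSubring L} {φ : S →+* L} {Q : Ideal S} (hQ : W.IsCenteredAt φ Q) (ψ : T →+* S) :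
    W.IsCenteredAt (φ.comp ψ) (Q.comap ψ) := fun a => hQ (ψ a)

section Integral

variable {T S L : Type*} [CommRing T] [IsDomain T] [UniqueFactorizationMonoid T]
  [CommRing S] [IsDomain S] [Algebra T S] [FaithfulSMul T S] [Algebra.IsIntegral T S] [Field L]
  [Algebra T L] [Algebra S L] [IsScalarTower T S L]

theorem HeightOnePrime.exists_isCenteredAt [FaithfulSMul S L] {Q : Ideal S}
    (hQ : HeightOnePrime Q) : ∃ (t : T) (W : ValuationSubring L), Prime t ∧
      Q.comap (algebraMap T S) = Ideal.span {t} ∧ W.IsCenteredAt (algebraMap S L) Q ∧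
      W.IsCenteredAt (algebraMap T L) (Ideal.span {t}) := by
  have _ := hQ.1
  obtain ⟨t, ht, hQt⟩ := hQ.exists_comap_eq_span (T := T)
  obtain ⟨W, hW⟩ := ValuationSubring.exists_isCenteredAt (algebraMap S L)
    (FaithfulSMul.algebraMap_injective S L) Q
  refine ⟨t, W, ht, hQt, hW, ?_⟩
  rw [← hQt, IsScalarTower.algebraMap_eq T S L]
  exact hW.comp _

theorem ValuationSubring.IsCenteredAt.exists_heightOnePrime {W : ValuationSubring L} {t : T}
    (ht : Prime t) (hW : W.IsCenteredAt (algebraMap T L) (Ideal.span {t})) :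
    ∃ Q : Ideal S, HeightOnePrime Q ∧ W.IsCenteredAt (algebraMap S L) Q := by
  obtain ⟨Q, hQp, hQ⟩ := ValuationSubring.exists_isCenteredAt_of_forall_mem (W := W)
    (algebraMap S L) fun a => ValuationSubring.mem_of_isIntegral (T := T) hW.mem
      ((Algebra.IsIntegral.isIntegral a).map (IsScalarTower.toAlgHom T S L))
  have h : Q.comap (algebraMap T S) = Ideal.span {t} := by
    refine ValuationSubring.IsCenteredAt.unique (W := W) ?_ hW
    rw [IsScalarTower.algebraMap_eq T S L]
    exact hQ.comp _
  refine ⟨Q, HeightOnePrime.of_comap_eq_span hQp ht h ?_, hQ⟩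
  rintro rfl
  rw [Ideal.comap_bot_of_injective _ (FaithfulSMul.algebraMap_injective T S), eq_comm,
    Ideal.span_singleton_eq_bot] at h
  exact ht.ne_zero h

end Integral

namespace NoetherModel

theorem isCenteredAt_comap {K L S R F : Type*} [Field K] [Field L] [Algebra K L] [CommRing S]
    [Algebra K S] [Algebra S L] [CommRing R] [Algebra K R] [Field F] [Algebra R F] [Algebra K F]
    {σ : F →ₐ[K] L} {f : R →ₐ[K] S}
    (hσ : ∀ r, σ (algebraMap R F r) = algebraMap S L (f r)) {W : ValuationSubring L} {Q : Ideal S}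
    (hQ : W.IsCenteredAt (algebraMap S L) Q) :
    W.IsCenteredAt ((σ : F →+* L).comp (algebraMap R F)) (Q.comap (f : R →+* S)) := by
  rw [show (σ : F →+* L).comp (algebraMap R F) = (algebraMap S L).comp (f : R →+* S) from
    RingHom.ext hσ]
  exact hQ.comp _

theorem IsGoodPlace.apply_eq_zero {κ K L R F : Type*} [Field K] [CharZero K] [Field L]
    [Algebra K L] [Algebra (MvPolynomial κ K) L] [IsScalarTower K (MvPolynomial κ K) L]
    [CommRing R] [Algebra K R] [Field F] [Algebra R F] [Algebra K F] [IsScalarTower K R F]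
    {M : NoetherModel K R}
    {σ : F →ₐ[K] L} {δ : κ → Derivation K L L}
    (hδ : ∀ l (p : MvPolynomial κ K), δ l (algebraMap _ L p) = algebraMap _ L (pderiv l p))
    {W : ValuationSubring L} {t : MvPolynomial κ K} {P : Ideal R} (ht : Prime t)
    (hW : W.IsCenteredAt (algebraMap (MvPolynomial κ K) L) (Ideal.span {t}))
    (hg : M.IsGoodPlace σ δ W t P) {ω : Ideal R → Fin M.n → F}
    (hω : ∀ P, HeightOnePrime P → M.IsDivisorForm L P (ω P)) {c : Ideal R →₀ K}
    (hc : ∀ P ∈ c.support, HeightOnePrime P) (h0 : Finsupp.linearCombination K ω c = 0) :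
    c P = 0 := by
  have hK (c : K) (hc : c ≠ 0) : W.valuation (algebraMap K L c) = 1 :=
    ValuationSubring.valuation_algebraMap_eq_one hW.mem hc
  by_contra hcP
  obtain ⟨l, hl⟩ := ht.exists_not_dvd_pderiv
  have h := hg.linearCombination hK hω hc l
  rw [h0, _root_.map_zero, mul_zero, zero_sub, Valuation.map_neg, map_mul W.valuation, hK _ hcP,
    one_mul, hδ, hW.eq_one (by rwa [Ideal.mem_span_singleton])] at h
  exact lt_irrefl _ h

variable {κ K N L S R F : Type*} [Fintype κ] [DecidableEq κ] [Field K] [CharZero K] [Field N]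
  [Field L] [Algebra K L] [Algebra K N] [Algebra (MvPolynomial κ K) N]
  [IsFractionRing (MvPolynomial κ K) N] [Algebra (MvPolynomial κ K) L] [Algebra N L]
  [IsScalarTower (MvPolynomial κ K) N L] [IsScalarTower K (MvPolynomial κ K) L]
  [IsScalarTower K N L]
  [Algebra.IsAlgebraic (MvPolynomial κ K) L] [IsAlgClosed L]
  [CommRing S] [IsDomain S] [Algebra K S] [Algebra (MvPolynomial κ K) S]
  [FaithfulSMul (MvPolynomial κ K) S] [Algebra.IsIntegral (MvPolynomial κ K) S] [Algebra S L]
  [FaithfulSMul S L] [IsScalarTower (MvPolynomial κ K) S L]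
  [CommRing R] [IsDomain R] [Algebra K R] [Algebra.FiniteType K R]
  [Field F] [Algebra R F] [IsFractionRing R F] [Algebra K F] [IsScalarTower K R F]

theorem exists_ne_zero_forall_isGoodPlace_comap (M : NoetherModel K R) (σ : F →ₐ[K] L)
    (δ : κ → Derivation K L L)
    (hδ : ∀ l (p : MvPolynomial κ K), δ l (algebraMap _ L p) = algebraMap _ L (pderiv l p))
    (E : IntermediateField N L) [FiniteDimensional N E]
    (hE : ∀ j, σ (algebraMap R F (M.x j)) ∈ E) (f : R →ₐ[K] S)
    (hσ : ∀ r, σ (algebraMap R F r) = algebraMap S L (f r)) :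
    ∃ s : S, s ≠ 0 ∧ ∀ Q : Ideal S, HeightOnePrime Q → s ∉ Q →
      ∃ (t : MvPolynomial κ K) (W : ValuationSubring L), Prime t ∧
        W.IsCenteredAt (algebraMap (MvPolynomial κ K) L) (Ideal.span {t}) ∧
        M.IsGoodPlace σ δ W t (Q.comap (f : R →+* S)) := by
  obtain ⟨s, hs, h⟩ := M.exists_isGoodPlace σ δ hδ E hE
  refine ⟨algebraMap _ S s, (map_ne_zero_iff _ (FaithfulSMul.algebraMap_injective _ S)).2 hs,
    fun Q hQ hsQ => ?_⟩
  obtain ⟨t, W, ht, hQt, hWQ, hW⟩ :=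
    hQ.exists_isCenteredAt (T := MvPolynomial κ K) (L := L)
  have hts : ¬ t ∣ s := by
    rwa [← Ideal.mem_span_singleton, ← hQt, Ideal.mem_comap]
  obtain ⟨P, hP⟩ := h t hts W ht hW
  obtain rfl := hP.center.unique (isCenteredAt_comap hσ hWQ)
  exact ⟨t, W, ht, hW, hP⟩

theorem exists_finite_support_subset [IsScalarTower K (MvPolynomial κ K) N]
    [Algebra.FiniteType K S] (M : NoetherModel K R)
    (f : Fin 2 → R →ₐ[K] S) (hf : Function.Injective (f 0))
    (σ : Fin 2 → F →ₐ[K] L) (hσf : ∀ i r, σ i (algebraMap R F r) = algebraMap S L (f i r))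
    (δ : κ → Derivation K L L)
    (hδ : ∀ l (p : MvPolynomial κ K), δ l (algebraMap _ L p) = algebraMap _ L (pderiv l p))
    (E : IntermediateField N L) [FiniteDimensional N E] (hE : ∀ i (e : F), σ i e ∈ E)
    (hδE : ∀ i l j, δ l (σ i (algebraMap R F (M.x j))) ∈ E)
    (hσ : ∀ g, σ 0 g = σ 1 g → ∃ c, algebraMap K F c = g) :
    ∃ A : Set (Ideal R), A.Finite ∧ ∀ c : Ideal R →₀ K, (∀ P ∈ c.support, HeightOnePrime P) →
      (∀ Q : Ideal S, HeightOnePrime Q →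
        c (Q.comap (f 0 : R →+* S)) = c (Q.comap (f 1 : R →+* S))) →
      (c.support : Set (Ideal R)) ⊆ A := by
  classical
  have _ : FaithfulSMul (MvPolynomial κ K) L := FaithfulSMul.trans _ N L
  have _ := Algebra.FiniteType.isNoetherianRing K R
  have _ := Algebra.FiniteType.isNoetherianRing K S
  have hω : ∀ P : Ideal R, ∃ w : Fin M.n → F, HeightOnePrime P → M.IsDivisorForm L P w := by
    intro P
    by_cases hP : HeightOnePrime P
    · exact (M.exists_isDivisorForm hP).imp fun _ h _ => h
    · exact ⟨0, fun h => absurd h hP⟩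
  choose ω hω using hω
  obtain ⟨V, _, hV⟩ := M.exists_finiteDimensional σ δ hδ E hE hδE hω
  let Δ : (Fin M.n → F) →ₗ[K] (κ → L) :=
    LinearMap.pi fun l => M.pairing (σ 0) (δ l) - M.pairing (σ 1) (δ l)
  let V' : Submodule K (Fin M.n → F) := (Submodule.pi Set.univ fun _ => V).comap Δ
  have _ : FiniteDimensional K (Submodule.pi Set.univ fun _ : κ => V) := by
    refine Module.Finite.of_injective (M := _) (N := κ → V)
      (LinearMap.pi fun l => LinearMap.codRestrict V
        (LinearMap.proj l ∘ₗ Submodule.subtype _) fun v => v.2 l trivial) fun v v' h => ?_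
    ext l
    exact congrArg Subtype.val (congrFun h l)
  have _ : FiniteDimensional K V' := by
    refine LinearMap.finiteDimensional_of_map_le Δ (U' := Submodule.pi Set.univ fun _ => V)
      (Submodule.map_comap_le _ _) (M.finiteDimensional_of_pairing_eq σ hδ hσ ?_)
    exact fun w hw l => sub_eq_zero.1 (congrFun hw.2 l)
  obtain ⟨s, hs, hgood⟩ := M.exists_ne_zero_forall_isGoodPlace_comap (σ 0) δ hδ E
    (fun j => hE 0 _) (f 0) (hσf 0)
  have hfin := finite_heightOnePrime_not_comap (f 0 : R →+* S) hf
    (AlgHom.FiniteType.of_comp_finiteType (f := Algebra.ofId K R) (g := f 0) (by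
      rw [Subsingleton.elim ((f 0).comp (Algebra.ofId K R)) (Algebra.ofId K S)]
      exact (RingHom.finiteType_algebraMap (A := K) (B := S)).2 inferInstance)) hs
  let U : Submodule K (Ideal R →₀ K) := Finsupp.supported K K {P | HeightOnePrime P} ⊓
    V'.comap (Finsupp.linearCombination K ω)
  have hU {c} (hc : c ∈ U) : ∀ P ∈ c.support, HeightOnePrime P :=
    fun P hP => (Finsupp.mem_supported _ _).1 hc.1 hP
  have _ : FiniteDimensional K U := by
    refine LinearMap.finiteDimensional_of_map_le (Finsupp.linearCombination K ω) (U' := V')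
      ((Submodule.map_mono inf_le_right).trans (Submodule.map_comap_le _ _))
      (Finsupp.finiteDimensional_of_support_subset hfin fun c hc P hP => ?_)
    refine ⟨hU hc.1 P hP, ?_⟩
    rintro ⟨Q, hQ, hsQ, rfl⟩
    obtain ⟨t, W, ht, hW, hg⟩ := hgood Q hQ hsQ
    exact Finsupp.mem_support_iff.1 hP (hg.apply_eq_zero hδ ht hW hω (hU hc.1) hc.2)
  obtain ⟨A, hA, h⟩ := Finsupp.exists_finite_support_subset U
  refine ⟨A, hA, fun c hc hcQ => h c ⟨(Finsupp.mem_supported _ _).2 hc, fun l _ => ?_⟩⟩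
  refine hV c hc (fun t W P ht hW hP => ?_) l
  obtain ⟨Q, hQ, hWQ⟩ := hW.exists_heightOnePrime (S := S) ht
  rw [(hP 0).unique (isCenteredAt_comap (hσf 0) hWQ),
    (hP 1).unique (isCenteredAt_comap (hσf 1) hWQ)]
  exact hcQ Q hQ

end NoetherModel

theorem finite_hypersurfaceIdeal {K R S : Type*} [Field K] [CommRing R] [IsNoetherianRing R]
    [CommRing S] [IsNoetherianRing S] [IsDomain R] {f₁ f₂ : R →+* S} (hf₁ : Function.Injective f₁)
    (hf₂ : Function.Injective f₂) {A : Set (Ideal R)} (hA : A.Finite)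
    (h : ∀ c : Ideal R →₀ K, (∀ P ∈ c.support, HeightOnePrime P) →
      (∀ Q : Ideal S, HeightOnePrime Q → c (Q.comap f₁) = c (Q.comap f₂)) →
      (c.support : Set (Ideal R)) ⊆ A) :
    {I : Ideal R | IsHypersurfaceIdeal I ∧ properTransform f₁ I = properTransform f₂ I}.Finite := by
  classical
  refine Set.Finite.of_finite_image (f := Ideal.minimalPrimes) (hA.finite_subsets.subset ?_) ?_
  · rintro _ ⟨I, ⟨hI, hIe⟩, rfl⟩ P hP
    have hfin := I.finite_minimalPrimes_of_isNoetherianRing R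
    let c : Ideal R →₀ K := Finsupp.indicator hfin.toFinset fun _ _ => 1
    have hc (P) : c P = if P ∈ I.minimalPrimes then 1 else 0 := by
      simp [c, Finsupp.indicator_apply]
    refine h c (fun P hP => hI.2.2 P ?_) (fun Q hQ => ?_) ?_
    · by_contra hPI
      exact Finsupp.mem_support_iff.1 hP (by rw [hc, if_neg hPI])
    · rw [hc, hc]
      congr 1
      exact propext ⟨comap_mem_minimalPrimes_of_properTransform_le hf₁ hf₂ hI.ne_bot hIe.ge hQ,
        comap_mem_minimalPrimes_of_properTransform_le hf₂ hf₁ hI.ne_bot hIe.le hQ⟩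
    · simp [hc, hP]
  · rintro I ⟨hI, -⟩ J ⟨hJ, -⟩ hIJ
    rw [← hI.1.radical, ← hJ.1.radical, ← Ideal.sInf_minimalPrimes, ← Ideal.sInf_minimalPrimes, hIJ]

theorem NoetherModel.exists_intermediateField {κ K N L R F : Type*} [Finite κ] [Field K] [Field N]
    [Field L] [Algebra K L] [Algebra K N] [Algebra N L] [IsScalarTower K N L]
    [Algebra.IsAlgebraic N L] [CommRing R] [IsDomain R] [Algebra K R] [Algebra.FiniteType K R]
    [Field F] [Algebra R F] [IsFractionRing R F] [Algebra K F] [IsScalarTower K R F]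
    (M : NoetherModel K R) {ι : Type*} [Finite ι] (σ : ι → F →ₐ[K] L) (δ : κ → Derivation K L L) :
    ∃ E : IntermediateField N L, FiniteDimensional N E ∧ (∀ i e, σ i e ∈ E) ∧
      ∀ i l j, δ l (σ i (algebraMap R F (M.x j))) ∈ E := by
  obtain ⟨B, hB⟩ := Algebra.FiniteType.out (R := K) (A := R)
  let A : Set L := (⋃ i, (fun r => σ i (algebraMap R F r)) '' B) ∪
    Set.range fun p : ι × κ × Fin M.n => δ p.2.1 (σ p.1 (algebraMap R F (M.x p.2.2)))
  have hA : A.Finite := (Set.finite_iUnion fun i => B.finite_toSet.image _).union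
    (Set.finite_range _)
  refine ⟨IntermediateField.adjoin N A,
    have _ := hA.to_subtype
    IntermediateField.finiteDimensional_adjoin fun x _ => Algebra.IsIntegral.isIntegral x,
    fun i e => ?_, fun i l j => IntermediateField.subset_adjoin N A (Or.inr ⟨(i, l, j), rfl⟩)⟩
  have hR (r : R) : σ i (algebraMap R F r) ∈ IntermediateField.adjoin N A := by
    have hr : r ∈ Algebra.adjoin K (B : Set R) := by rw [hB]; trivial
    induction hr using Algebra.adjoin_induction with
    | mem r hr =>
      exact IntermediateField.subset_adjoin N A (Or.inl (Set.mem_iUnion_of_mem i ⟨r, hr, rfl⟩))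
    | algebraMap c =>
      rw [← IsScalarTower.algebraMap_apply K R F, AlgHom.commutes,
        IsScalarTower.algebraMap_apply K N L]
      exact IntermediateField.algebraMap_mem _ _
    | add r s _ _ hr hs => simpa using add_mem hr hs
    | mul r s _ _ hr hs => simpa using mul_mem hr hs
  obtain ⟨a, b, -, rfl⟩ := IsFractionRing.div_surjective (A := R) e
  rw [map_div₀]
  exact div_mem (hR a) (hR b)

end

/-- **Theorem 6.1.** For dominant rational maps `φ₁, φ₂ : Z → X` of algebraic varieties over
an algebraically closed field of characteristic zero, there are infinitely many
hypersurfaces `H` on `X` with `φ₁*H = φ₂*H` if and only if there is a nonconstant rational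
function `g` on `X` with `g∘φ₁ = g∘φ₂`. -/
theorem main_reduced
    (K : Type*) [Field K] [IsAlgClosed K] [CharZero K]
    (R : Type*) [CommRing R] [IsDomain R] [Algebra K R] [Algebra.FiniteType K R]
    (S : Type*) [CommRing S] [IsDomain S] [Algebra K S] [Algebra.FiniteType K S]
    (f₁ f₂ : R →ₐ[K] S)
    (hdom₁ : Function.Injective f₁) (hdom₂ : Function.Injective f₂) :
    {I : Ideal R | IsHypersurfaceIdeal I ∧
        properTransform (f₁ : R →+* S) I = properTransform (f₂ : R →+* S) I}.Infinite
      ↔ ∃ a b : R, b ≠ 0 ∧ (∀ c : K, a ≠ algebraMap K R c * b) ∧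
          f₁ a * f₂ b = f₂ a * f₁ b := by
  obtain ⟨m, g, hg, hgf⟩ := exists_finite_inj_algHom_of_fg K S
  let _ : Algebra (MvPolynomial (Fin m) K) S := g.toRingHom.toAlgebra
  have _ : FaithfulSMul (MvPolynomial (Fin m) K) S :=
    (faithfulSMul_iff_algebraMap_injective _ _).2 hg
  have _ : Module.Finite (MvPolynomial (Fin m) K) S := hgf
  have _ : IsScalarTower K (MvPolynomial (Fin m) K) S :=
    IsScalarTower.of_algebraMap_eq fun c => (g.commutes c).symm
  let N := FractionRing (MvPolynomial (Fin m) K)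
  let L := AlgebraicClosure (FractionRing S)
  let F := FractionRing R
  let _ : Algebra N (FractionRing S) := FractionRing.liftAlgebra (MvPolynomial (Fin m) K) _
  have _ : IsScalarTower (MvPolynomial (Fin m) K) N (FractionRing S) :=
    FractionRing.isScalarTower_liftAlgebra _ _
  have _ : IsScalarTower (MvPolynomial (Fin m) K) S L := inferInstance
  have _ : IsScalarTower (MvPolynomial (Fin m) K) N L := inferInstance
  have _ : IsScalarTower K (MvPolynomial (Fin m) K) L := inferInstance
  have _ : IsScalarTower K (MvPolynomial (Fin m) K) N := inferInstance
  have _ : IsScalarTower K N L := inferInstance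
  have _ : FaithfulSMul S L := FaithfulSMul.trans S (FractionRing S) L
  have _ : IsScalarTower K S L := inferInstance
  have _ : Algebra.IsAlgebraic S (FractionRing S) :=
    IsLocalization.isAlgebraic _ (nonZeroDivisors S)
  have _ : Algebra.IsAlgebraic (MvPolynomial (Fin m) K) (FractionRing S) :=
    Algebra.IsAlgebraic.trans _ S _
  have _ : Algebra.IsAlgebraic (MvPolynomial (Fin m) K) L :=
    Algebra.IsAlgebraic.trans _ (FractionRing S) _
  have _ : FaithfulSMul (MvPolynomial (Fin m) K) L := FaithfulSMul.trans _ S L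
  have _ : Algebra.IsAlgebraic N L :=
    IsFractionRing.comap_isAlgebraic_iff (A := MvPolynomial (Fin m) K).1 inferInstance
  have _ := Algebra.FiniteType.isNoetherianRing K R
  have _ := Algebra.FiniteType.isNoetherianRing K S
  have hSL : Function.Injective (algebraMap S L) := FaithfulSMul.algebraMap_injective S L
  let f : Fin 2 → R →ₐ[K] S := ![f₁, f₂]
  have hf : ∀ i, Function.Injective (f i) := by simpa [Fin.forall_fin_two] using ⟨hdom₁, hdom₂⟩
  let φ (i : Fin 2) : R →ₐ[K] L := (IsScalarTower.toAlgHom K S L).comp (f i)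
  have hφ (i : Fin 2) : Function.Injective (φ i) := hSL.comp (hf i)
  let σ (i : Fin 2) : F →ₐ[K] L := IsFractionRing.liftAlgHom (hφ i)
  have hσf (i : Fin 2) (r : R) : σ i (algebraMap R F r) = algebraMap S L (f i r) :=
    IsFractionRing.lift_algebraMap (hφ i) r
  obtain ⟨δ, hδ⟩ := exists_coordDerivation (κ := Fin m) (K := K) (L := L)
  obtain ⟨M⟩ := NoetherModel.nonempty K R
  obtain ⟨E, _, hE, hδE⟩ := M.exists_intermediateField (N := N) σ δ
  constructor
  · intro hinf
    by_contra hne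
    have hσ : ∀ e, σ 0 e = σ 1 e → ∃ c, algebraMap K F c = e := by
      intro e he
      obtain ⟨a, b, hb, rfl⟩ := IsFractionRing.div_surjective (A := R) e
      have hb0 : b ≠ 0 := nonZeroDivisors.ne_zero hb
      have hbF : algebraMap R F b ≠ 0 := (map_ne_zero_iff _ (IsFractionRing.injective R F)).2 hb0
      by_contra! hc
      refine hne ⟨a, b, hb0, fun c hac => hc c ?_, hSL ?_⟩
      · rw [eq_div_iff hbF, hac, map_mul, IsScalarTower.algebraMap_apply K R F]
      · rw [map_div₀, map_div₀, div_eq_div_iff ((map_ne_zero _).2 hbF)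
          ((map_ne_zero _).2 hbF)] at he
        simp only [hσf, ← map_mul] at he
        exact he
    obtain ⟨A, hA, h⟩ := M.exists_finite_support_subset f (hf 0) σ hσf δ hδ E hE hδE hσ
    exact hinf (finite_hypersurfaceIdeal (K := K) hdom₁ hdom₂ hA h)
  · rintro ⟨a, b, hb, hab, h⟩
    choose s hs0 hs using fun i => M.exists_ne_zero_forall_isGoodPlace_comap (σ i) δ hδ E
      (fun j => hE i _) (f i) (hσf i)
    have hs' (i : Fin 2) (Q : Ideal S) (hQ : HeightOnePrime Q) (hsQ : s 0 * s 1 ∉ Q)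
        (h0 : Q.comap (f i : R →+* S) ≠ ⊥) : HeightOnePrime (Q.comap (f i : R →+* S)) := by
      obtain ⟨t, W, -, -, hg⟩ := hs i Q hQ fun hi => hsQ <| by
        fin_cases i
        · exact Q.mul_mem_right _ hi
        · exact Q.mul_mem_left _ hi
      exact hg.heightOne h0
    exact infinite_hypersurfaceIdeal f₁ f₂ hdom₁ hdom₂ (mul_ne_zero (hs0 0) (hs0 1)) (hs' 0) (hs' 1)
      hb hab h
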